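/- (Pointwise lower bound for the Green function.) Let n ≥ 3, let Ω ⊂ ℝⁿ be open, and let L = −div(A∇·) + B·∇ with measurable coefficients satisfying Σ|A_{ij}(X)| ≤ M, A(X)ξ·ξ ≥ λ|ξ|², and δ(X)|B(X)| ≤ M. Then there is a constant K = K(M, λ, n) > 0 such that for every y ∈ Ω, every Green function g for L with pole y, and every x ∈ Ω with 0 < |x − y| ≤ δ(y)/2, one has g(x) > 0 and g(x) ≥ K |x − y|^{2−n}. -/

import Mathlib

open MeasureTheory Metric Set

noncomputable section

/-- Distance to the boundary of `Ω`. -/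
def bdryDist {n : ℕ} (Ω : Set (EuclideanSpace ℝ (Fin n))) (x : EuclideanSpace ℝ (Fin n)) : ℝ :=
  Metric.infDist x (frontier Ω)

/-- Uniform ellipticity and boundedness of the coefficients on `Ω`:
`Σ|A_{ij}| ≤ M`, `A ξ·ξ ≥ λ|ξ|²`, and `δ(X)|B(X)| ≤ M`. -/
def EllipticCoeffs {n : ℕ} (Ω : Set (EuclideanSpace ℝ (Fin n)))
    (A : EuclideanSpace ℝ (Fin n) → Matrix (Fin n) (Fin n) ℝ)
    (B : EuclideanSpace ℝ (Fin n) → EuclideanSpace ℝ (Fin n)) (lam M : ℝ) : Prop :=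
  (∀ x ∈ Ω, ∑ i, ∑ j, |A x i j| ≤ M) ∧
  (∀ x ∈ Ω, ∀ ξ : EuclideanSpace ℝ (Fin n), lam * ‖ξ‖ ^ 2 ≤ ∑ i, ∑ j, A x i j * ξ i * ξ j) ∧
  (∀ x ∈ Ω, bdryDist Ω x * ‖B x‖ ≤ M)

/-- `g` is a Green function for `L = -div(A∇·) + B·∇` in `Ω` with pole `y`:
nonnegative, continuous and locally `W^{1,2}` away from the pole, locally integrable
together with its gradient, and satisfying the adjoint identity
`∫ (Aᵀ∇g·∇φ - g B·∇φ) = φ(y)` for all test functions `φ`. -/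
def IsGreenWithPole {n : ℕ} (Ω : Set (EuclideanSpace ℝ (Fin n)))
    (A : EuclideanSpace ℝ (Fin n) → Matrix (Fin n) (Fin n) ℝ)
    (B : EuclideanSpace ℝ (Fin n) → EuclideanSpace ℝ (Fin n))
    (y : EuclideanSpace ℝ (Fin n)) (g : EuclideanSpace ℝ (Fin n) → ℝ) : Prop :=
  (∀ x ∈ Ω, 0 ≤ g x) ∧
  ContinuousOn g (Ω \ {y}) ∧
  (∀ x ∈ Ω \ {y}, DifferentiableAt ℝ g x) ∧
  LocallyIntegrableOn (fun x => ‖gradient g x‖ ^ 2) (Ω \ {y}) volume ∧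
  LocallyIntegrableOn g Ω volume ∧
  LocallyIntegrableOn (fun x => ‖gradient g x‖) Ω volume ∧
  ∀ φ : EuclideanSpace ℝ (Fin n) → ℝ,
    ContDiff ℝ (⊤ : ℕ∞) φ → HasCompactSupport φ → tsupport φ ⊆ Ω →
    ∫ x in Ω, ((∑ i, ∑ j, A x j i * gradient g x j * gradient φ x i) -
      g x * ∑ i, B x i * gradient φ x i) = φ y

section Helpers
open Filter Topology
open scoped ENNReal NNReal Convolution

variable {n : ℕ}

local notation "𝔼" => EuclideanSpace ℝ (Fin n)

/-- Mollification of a real function. -/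
def mollify (ρ : ContDiffBump (0 : EuclideanSpace ℝ (Fin n))) (f : EuclideanSpace ℝ (Fin n) → ℝ) :
    EuclideanSpace ℝ (Fin n) → ℝ :=
  ρ.normed volume ⋆[ContinuousLinearMap.lsmul ℝ ℝ, volume] f

lemma contDiff_mollify (ρ : ContDiffBump (0 : 𝔼)) {f : 𝔼 → ℝ} (hf : Continuous f) :
    ContDiff ℝ (⊤ : ℕ∞) (mollify ρ f) :=
  ρ.hasCompactSupport_normed.contDiff_convolution_left _ ρ.contDiff_normed hf.locallyIntegrable

lemma hasCompactSupport_mollify (ρ : ContDiffBump (0 : 𝔼)) {f : 𝔼 → ℝ}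
    (hc : HasCompactSupport f) : HasCompactSupport (mollify ρ f) :=
  HasCompactSupport.convolution _ ρ.hasCompactSupport_normed hc

lemma tsupport_mollify_subset (ρ : ContDiffBump (0 : 𝔼)) (f : 𝔼 → ℝ) :
    tsupport (mollify ρ f) ⊆ cthickening ρ.rOut (tsupport f) := by
  refine closure_minimal ?_ isClosed_cthickening
  intro x hx
  obtain ⟨a, ha, b, hb, rfl⟩ := support_convolution_subset _ hx
  refine mem_cthickening_of_dist_le _ b _ _ (subset_closure hb) ?_
  rw [ρ.support_normed_eq, mem_ball_zero_iff] at ha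
  simpa [dist_eq_norm] using ha.le

lemma fderiv_mollify_apply (ρ : ContDiffBump (0 : 𝔼)) {f : 𝔼 → ℝ} (hf : Differentiable ℝ f)
    (hi : Integrable (fderiv ℝ f)) (x v : 𝔼) :
    fderiv ℝ (mollify ρ f) x v = ∫ t, ρ.normed volume t * fderiv ℝ f (x - t) v := by
  have h1 := ρ.hasCompactSupport_normed (μ := volume) |>.hasFDerivAt_convolution_left
    (ContinuousLinearMap.lsmul ℝ ℝ) (ρ.contDiff_normed (n := 1))
    hf.continuous.locallyIntegrable (μ := volume) x
  have hgd : ∀ t, HasFDerivAt (fun t => f (x - t)) (-(fderiv ℝ f (x - t))) t := fun t => by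
    have h1 := (hf (x - t)).hasFDerivAt
    have h2 : HasFDerivAt (fun t : 𝔼 => x - t) (-(ContinuousLinearMap.id ℝ 𝔼)) t :=
      (hasFDerivAt_id t).const_sub x
    have := h1.comp t h2
    rw [ContinuousLinearMap.comp_neg, ContinuousLinearMap.comp_id] at this
    exact this
  have hfx : Continuous (fun t => f (x - t)) := hf.continuous.comp (continuous_const.sub continuous_id)
  have hix : Integrable (fun t => fderiv ℝ f (x - t) v) :=
    (hi.comp_sub_left x).apply_continuousLinearMap v
  have hρ : Continuous (ρ.normed (volume : Measure 𝔼)) := ρ.continuous_normed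
  have hρs : HasCompactSupport (ρ.normed (volume : Measure 𝔼)) := ρ.hasCompactSupport_normed
  have hdρ : Continuous (fun t => fderiv ℝ (ρ.normed (volume : Measure 𝔼)) t v) :=
    ((ρ.contDiff_normed (n := 1)).continuous_fderiv (by simp)).clm_apply continuous_const
  have hdρs : HasCompactSupport (fun t => fderiv ℝ (ρ.normed (volume : Measure 𝔼)) t v) :=
    (hρs.fderiv (𝕜 := ℝ)).comp_left (g := fun L : 𝔼 →L[ℝ] ℝ => L v) (by simp)
  have hbd : ∃ C, ∀ t, ‖ρ.normed (volume : Measure 𝔼) t‖ ≤ C :=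
    hρ.bounded_above_of_compact_support hρs
  have key := integral_mul_fderiv_eq_neg_fderiv_mul_of_integrable (𝕜 := ℝ) (μ := volume)
    (f := ρ.normed (volume : Measure 𝔼)) (g := fun t => f (x - t)) (v := v)
    ((hdρ.mul hfx).integrable_of_hasCompactSupport (hdρs.mul_right)) ?_
    ((hρ.mul hfx).integrable_of_hasCompactSupport (hρs.mul_right))
    (fun t _ => ((ρ.contDiff_normed (n := 1)).differentiable (by simp)) t)
    (fun t _ => (hgd t).differentiableAt)
  · rw [mollify, h1.fderiv]
    have h2 : ∀ t, fderiv ℝ (fun t => f (x - t)) t v = -(fderiv ℝ f (x - t) v) := fun t => by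
      rw [(hgd t).fderiv]; simp
    simp only [h2, mul_neg, integral_neg, neg_inj] at key
    rw [key, convolution]
    have hint : ConvolutionExistsAt (fderiv ℝ (ρ.normed (volume : Measure 𝔼))) f x
        ((ContinuousLinearMap.lsmul ℝ ℝ).precompL 𝔼) volume :=
      (hρs.fderiv (𝕜 := ℝ)).convolutionExists_left _
        ((ρ.contDiff_normed (n := 1)).continuous_fderiv (by simp)) hf.continuous.locallyIntegrable x
    rw [ContinuousLinearMap.integral_apply hint]
    rfl
  · simp only [(hgd _).fderiv]
    obtain ⟨C, hC⟩ := hbd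
    refine hix.neg.bdd_mul hρ.aestronglyMeasurable (c := C) (Eventually.of_forall hC)

lemma continuous_integral_inner_translate {G F : 𝔼 → 𝔼} (hG : MemLp G 2) (hF : MemLp F 2) :
    Continuous fun t : 𝔼 => ∫ x, inner ℝ (F x) (G (x - t)) := by
  have hmp : ∀ t : 𝔼, MeasurePreserving (fun x : 𝔼 => x - t) volume volume :=
    fun t => measurePreserving_sub_right _ t
  let τ : C(𝔼, C(𝔼, 𝔼)) :=
    (ContinuousMap.mk (fun p : 𝔼 × 𝔼 => p.2 - p.1) (by fun_prop)).curry
  have h1 : Continuous fun t : 𝔼 =>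
      Lp.compMeasurePreserving (τ t) (hmp t) (hG.toLp G) :=
    Continuous.compMeasurePreservingLp continuous_const τ.continuous hmp (by simp)
  have h2 : Continuous fun t : 𝔼 =>
      inner ℝ (hF.toLp F) (Lp.compMeasurePreserving (τ t) (hmp t) (hG.toLp G)) :=
    continuous_const.inner h1
  convert! h2 using 2 with t
  rw [L2.inner_def]
  refine integral_congr_ae ?_
  have h3 : Lp.compMeasurePreserving (τ t) (hmp t) (hG.toLp G) =
      (hG.comp_measurePreserving (hmp t)).toLp _ := rfl
  rw [h3]
  filter_upwards [hF.coeFn_toLp, (hG.comp_measurePreserving (hmp t)).coeFn_toLp] with x hx1 hx2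
  rw [hx1, hx2]; rfl

lemma memLp_gradient {ψ : 𝔼 → ℝ} {p : ℝ≥0∞} (h2 : MemLp (fderiv ℝ ψ) p) :
    MemLp (gradient ψ) p :=
  (InnerProductSpace.toDual ℝ 𝔼).symm.toContinuousLinearEquiv.toContinuousLinearMap.comp_memLp' h2

lemma inner_gradient {ψ : 𝔼 → ℝ} (x v : 𝔼) : inner ℝ v (gradient ψ x) = fderiv ℝ ψ x v := by
  rw [real_inner_comm, gradient, InnerProductSpace.toDual_symm_apply]

lemma memLp_one_of_hasCompactSupport {X : Type*} [NormedAddCommGroup X] {f : 𝔼 → X}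
    (hc : HasCompactSupport f) (h2 : MemLp f 2) : Integrable f := by
  rw [← memLp_one_iff_integrable]
  refine h2.mono_exponent_of_measure_support_ne_top (s := tsupport f)
    (fun x hx => image_eq_zero_of_notMem_tsupport hx) hc.isCompact.measure_lt_top.ne (by norm_num)

/-- A weak identity against smooth test functions extends to differentiable test functions
with square integrable derivative. -/
lemma integral_fderiv_eq_zero_of_smooth {U : Set 𝔼} (hU : IsOpen U) {F : 𝔼 → 𝔼}
    (hF : ∀ K ⊆ U, IsCompact K → MemLp F 2 (volume.restrict K))
    (h : ∀ φ : 𝔼 → ℝ, ContDiff ℝ (⊤ : ℕ∞) φ → HasCompactSupport φ → tsupport φ ⊆ U →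
      ∫ x, fderiv ℝ φ x (F x) = 0)
    {ψ : 𝔼 → ℝ} (hψ : Differentiable ℝ ψ) (hc : HasCompactSupport ψ) (hs : tsupport ψ ⊆ U)
    (h2 : MemLp (fderiv ℝ ψ) 2) : ∫ x, fderiv ℝ ψ x (F x) = 0 := by
  obtain ⟨δ, hδ, hδU⟩ := hc.isCompact.exists_cthickening_subset_open hU hs
  set K := cthickening δ (tsupport ψ) with hK
  have hKc : IsCompact K := hc.isCompact.cthickening
  have hKm : MeasurableSet K := hKc.measurableSet
  set F' : 𝔼 → 𝔼 := K.indicator F with hF'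
  have hF'2 : MemLp F' 2 := (memLp_indicator_iff_restrict hKm).2 (hF K hδU hKc)
  have hi : Integrable (fderiv ℝ ψ) :=
    memLp_one_of_hasCompactSupport (hc.fderiv (𝕜 := ℝ)) h2
  have hG : MemLp (gradient ψ) 2 := memLp_gradient h2
  set c : 𝔼 → ℝ := fun t => ∫ x, inner ℝ (F' x) (gradient ψ (x - t)) with hcdef
  have hcc : Continuous c := continuous_integral_inner_translate hG hF'2
  have hsub : ∀ φ : 𝔼 → ℝ, tsupport φ ⊆ K →
      ∀ x, fderiv ℝ φ x (F x) = fderiv ℝ φ x (F' x) := by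
    intro φ hφ x
    by_cases hx : x ∈ K
    · rw [hF', indicator_of_mem hx]
    · have : fderiv ℝ φ x = 0 := image_eq_zero_of_notMem_tsupport
        fun hx' => hx (hφ (tsupport_fderiv_subset ℝ hx'))
      simp [this]
  have hc0 : ∫ x, fderiv ℝ ψ x (F x) = c 0 := by
    refine integral_congr_ae (Eventually.of_forall fun x => ?_)
    simp only [sub_zero, inner_gradient]
    exact hsub ψ (self_subset_cthickening _) x
  rw [hc0]
  have hρ0 : ∀ ρ : ContDiffBump (0 : 𝔼), ρ.rOut ≤ δ →
      ∫ t, ρ.normed volume t * c t = 0 := by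
    intro ρ hρ
    have hts : tsupport (mollify ρ ψ) ⊆ K :=
      (tsupport_mollify_subset ρ ψ).trans (cthickening_mono hρ _)
    have h0 := h (mollify ρ ψ) (contDiff_mollify ρ hψ.continuous) (hasCompactSupport_mollify ρ hc)
      (hts.trans hδU)
    simp only [hsub _ hts, fderiv_mollify_apply ρ hψ hi] at h0
    rw [integral_integral_swap] at h0
    · rw [← h0]
      refine integral_congr_ae (Eventually.of_forall fun t => ?_)
      simp only [hcdef, inner_gradient]
      rw [integral_const_mul]
    · have hρi : Integrable (ρ.normed (volume : Measure 𝔼)) := ρ.integrable_normed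
      have hA : Integrable (fun p : 𝔼 × 𝔼 => ρ.normed volume p.2 * ‖gradient ψ (p.1 - p.2)‖ ^ 2)
          (volume.prod volume) :=
        hρi.convolution_integrand (ContinuousLinearMap.mul ℝ ℝ)
          ((memLp_two_iff_integrable_sq_norm hG.1).1 hG)
      have hB : Integrable (fun p : 𝔼 × 𝔼 => ‖F' p.1‖ ^ 2 * ρ.normed volume p.2)
          (volume.prod volume) :=
        Integrable.mul_prod ((memLp_two_iff_integrable_sq_norm hF'2.1).1 hF'2) hρi
      refine (hA.add hB).mono ?_ (Eventually.of_forall fun p => ?_)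
      · have e : (Function.uncurry fun (x t : 𝔼) => ρ.normed volume t * fderiv ℝ ψ (x - t) (F' x)) =
          fun p : 𝔼 × 𝔼 => ρ.normed volume p.2 * inner ℝ (F' p.1) (gradient ψ (p.1 - p.2)) := by
          ext p; simp [Function.uncurry]
        rw [e]
        have m1 : AEStronglyMeasurable (fun p : 𝔼 × 𝔼 => gradient ψ (p.1 - p.2))
            (volume.prod volume) :=
          hG.1.comp_quasiMeasurePreserving (quasiMeasurePreserving_sub _ _)
        have m2 : AEStronglyMeasurable (fun p : 𝔼 × 𝔼 => F' p.1) (volume.prod volume) :=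
          hF'2.1.comp_fst
        exact (ρ.continuous_normed.comp continuous_snd).aestronglyMeasurable.mul (m2.inner m1)
      · have hn := ρ.nonneg_normed (μ := volume) p.2
        simp only [Function.uncurry, Pi.add_apply, ← inner_gradient]
        rw [norm_mul, Real.norm_eq_abs (ρ.normed _ _), abs_of_nonneg hn]
        have h3 := norm_inner_le_norm (𝕜 := ℝ) (F' p.1) (gradient ψ (p.1 - p.2))
        calc ρ.normed volume p.2 * ‖inner ℝ (F' p.1) (gradient ψ (p.1 - p.2))‖
            ≤ ρ.normed volume p.2 * (‖gradient ψ (p.1 - p.2)‖ ^ 2 + ‖F' p.1‖ ^ 2) := by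
              gcongr
              refine h3.trans ?_
              nlinarith [sq_nonneg (‖F' p.1‖ - ‖gradient ψ (p.1 - p.2)‖),
                sq_nonneg (‖F' p.1‖), sq_nonneg ‖gradient ψ (p.1 - p.2)‖]
          _ ≤ _ := by
              refine le_trans (le_of_eq ?_) (Real.le_norm_self _)
              ring
  by_contra hne
  obtain ⟨r, hr, hball⟩ := Metric.continuous_iff.1 (hcc.comp continuous_neg) 0 (|c 0| / 2)
    (half_pos (abs_pos.2 hne))
  set s := min r δ with hsdef
  have hs0 : 0 < s := lt_min hr hδ
  let ρ : ContDiffBump (0 : 𝔼) := ⟨s / 2, s, by linarith, by linarith⟩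
  have h4 := ContDiffBump.dist_normed_convolution_le (μ := volume) (φ := ρ) (x₀ := (0 : 𝔼))
    (g := c ∘ Neg.neg) (ε := |c 0| / 2)
    (hcc.comp continuous_neg).aestronglyMeasurable
    (fun x hx => (hball x (lt_of_lt_of_le (mem_ball.1 hx) (min_le_left _ _))).le)
  have h5 : (ρ.normed volume ⋆[ContinuousLinearMap.lsmul ℝ ℝ, volume] (c ∘ Neg.neg)) 0 = 0 := by
    rw [convolution, ← hρ0 ρ (min_le_right _ _)]
    simp
  rw [h5, Real.dist_eq] at h4
  simp only [Function.comp, neg_zero, zero_sub, abs_neg] at h4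
  linarith [abs_pos.2 hne]

lemma integral_norm_fderiv_mollify_le (ρ : ContDiffBump (0 : 𝔼)) {f : 𝔼 → ℝ}
    (hf : Differentiable ℝ f) (hi : Integrable (fderiv ℝ f)) :
    ∫ x, ‖fderiv ℝ (mollify ρ f) x‖ ≤ ∫ x, ‖fderiv ℝ f x‖ := by
  have hρi : Integrable (ρ.normed (volume : Measure 𝔼)) := ρ.integrable_normed
  have hpt : ∀ x, ‖fderiv ℝ (mollify ρ f) x‖ ≤ mollify ρ (fun y => ‖fderiv ℝ f y‖) x := by
    intro x
    have hnn : ∀ t, 0 ≤ ρ.normed volume t * ‖fderiv ℝ f (x - t)‖ := fun t =>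
      mul_nonneg (ρ.nonneg_normed t) (norm_nonneg _)
    have hint : Integrable (fun t => ρ.normed volume t * ‖fderiv ℝ f (x - t)‖) := by
      obtain ⟨C, hC⟩ := ρ.continuous_normed.bounded_above_of_compact_support
        (ρ.hasCompactSupport_normed (μ := volume))
      exact (hi.comp_sub_left x).norm.bdd_mul ρ.continuous_normed.aestronglyMeasurable (c := C)
        (Eventually.of_forall hC)
    refine ContinuousLinearMap.opNorm_le_bound _ (integral_nonneg hnn) fun v => ?_
    rw [fderiv_mollify_apply ρ hf hi]
    have e : mollify ρ (fun y => ‖fderiv ℝ f y‖) x =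
      ∫ t, ρ.normed volume t * ‖fderiv ℝ f (x - t)‖ := rfl
    change _ ≤ (∫ t, ρ.normed volume t * ‖fderiv ℝ f (x - t)‖) * ‖v‖
    rw [← integral_mul_const]
    refine norm_integral_le_of_norm_le (hint.mul_const _) (Eventually.of_forall fun t => ?_)
    rw [norm_mul, mul_assoc, Real.norm_of_nonneg (ρ.nonneg_normed t)]
    exact mul_le_mul_of_nonneg_left (ContinuousLinearMap.le_opNorm _ _) (ρ.nonneg_normed t)
  calc ∫ x, ‖fderiv ℝ (mollify ρ f) x‖ ≤ ∫ x, mollify ρ (fun y => ‖fderiv ℝ f y‖) x := by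
        refine integral_mono_of_nonneg (Eventually.of_forall fun x => norm_nonneg _) ?_
          (Eventually.of_forall hpt)
        exact hρi.integrable_convolution _ hi.norm
    _ = ∫ x, ‖fderiv ℝ f x‖ := by
        rw [mollify, integral_convolution _ hρi hi.norm]
        simp [ρ.integral_normed]

/-- The Sobolev inequality for `W^{1,1}`, in the form of a bound of the integral by the measure of
the support. -/
lemma exists_sobolev_const (hn : 2 ≤ n) : ∃ C : ℝ, 0 < C ∧ ∀ h : 𝔼 → ℝ, Differentiable ℝ h →
    HasCompactSupport h → Integrable (fderiv ℝ h) →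
    ∫ x, ‖h x‖ ≤ C * volume.real (Function.support h) ^ (1 / (n : ℝ)) * ∫ x, ‖fderiv ℝ h x‖ := by
  have hn1 : (1 : ℝ≥0) < n := by exact_mod_cast hn
  set p := NNReal.conjExponent (n : ℝ≥0) with hp
  have hconj : NNReal.HolderConjugate (Module.finrank ℝ 𝔼) p := by
    rw [finrank_euclideanSpace_fin]; exact NNReal.HolderConjugate.conjExponent hn1
  set C : ℝ≥0 := eLpNormLESNormFDerivOneConst (volume : Measure 𝔼) p with hC
  refine ⟨C + 1, by positivity, fun h hd hc hi => ?_⟩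
  set I := ∫ x, ‖fderiv ℝ h x‖ with hI
  have hI0 : 0 ≤ I := integral_nonneg fun _ => norm_nonneg _
  have hmain : eLpNorm h p volume ≤ C * ENNReal.ofReal I := by
    let ρ : ℕ → ContDiffBump (0 : 𝔼) := fun k =>
      ⟨1 / (k + 1) / 2, 1 / (k + 1), by positivity, half_lt_self (by positivity)⟩
    have hlim : ∀ x, Tendsto (fun k => mollify (ρ k) h x) atTop (𝓝 (h x)) := fun x =>
      ContDiffBump.convolution_tendsto_right_of_continuous (φ := ρ)
        tendsto_one_div_add_atTop_nhds_zero_nat hd.continuous x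
    refine (Lp.eLpNorm_lim_le_liminf_eLpNorm
      (fun k => (contDiff_mollify (ρ k) hd.continuous).continuous.aestronglyMeasurable) h
      (Eventually.of_forall hlim)).trans ?_
    refine liminf_le_of_frequently_le' (Frequently.of_forall fun k => ?_)
    have hsm : ContDiff ℝ 1 (mollify (ρ k) h) := (contDiff_mollify (ρ k) hd.continuous).of_le
      (by exact_mod_cast le_top)
    refine (eLpNorm_le_eLpNorm_fderiv_one volume hsm
      (hasCompactSupport_mollify (ρ k) hc) hconj).trans ?_
    gcongr
    rw [eLpNorm_one_eq_lintegral_enorm, ← ofReal_integral_norm_eq_lintegral_enorm]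
    · exact ENNReal.ofReal_le_ofReal (integral_norm_fderiv_mollify_le (ρ k) hd hi)
    · exact (hsm.continuous_fderiv (by simp)).integrable_of_hasCompactSupport
        ((hasCompactSupport_mollify (ρ k) hc).fderiv (𝕜 := ℝ))
  set S := Function.support h with hS
  have hSfin : volume S ≠ ⊤ :=
    ((measure_mono (subset_tsupport h)).trans_lt hc.isCompact.measure_lt_top).ne
  have hp1 : (1 : ℝ≥0∞) ≤ p := by exact_mod_cast hconj.symm.lt.le
  have h1 := eLpNorm_le_eLpNorm_mul_rpow_measure_univ (μ := volume.restrict S) hp1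
    (f := h) hd.continuous.aestronglyMeasurable
  rw [eLpNorm_restrict_eq_of_support_subset subset_rfl,
    eLpNorm_restrict_eq_of_support_subset subset_rfl, Measure.restrict_apply_univ] at h1
  have hexp : 1 / (1 : ℝ≥0∞).toReal - 1 / (p : ℝ≥0∞).toReal = 1 / (n : ℝ) := by
    have := hconj.coe.inv_add_inv_eq_one
    simp only [finrank_euclideanSpace_fin, NNReal.coe_natCast] at this
    simp only [ENNReal.toReal_one, ENNReal.coe_toReal, one_div, inv_one]
    linarith
  rw [hexp] at h1
  have h2 : eLpNorm h 1 volume ≤ C * ENNReal.ofReal I * volume S ^ (1 / (n : ℝ)) :=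
    h1.trans (by gcongr)
  rw [eLpNorm_one_eq_lintegral_enorm, ← ofReal_integral_norm_eq_lintegral_enorm
    (hd.continuous.integrable_of_hasCompactSupport hc)] at h2
  have h3 : (C : ℝ≥0∞) * ENNReal.ofReal I * volume S ^ (1 / (n : ℝ)) =
      ENNReal.ofReal (C * I * volume.real S ^ (1 / (n : ℝ))) := by
    rw [ENNReal.ofReal_mul (by positivity), ENNReal.ofReal_mul (by positivity),
      ENNReal.ofReal_coe_nnreal, ← ENNReal.ofReal_rpow_of_nonneg (by positivity) (by positivity),
      measureReal_def, ENNReal.ofReal_toReal hSfin]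
  rw [h3, ENNReal.ofReal_le_ofReal_iff (by positivity)] at h2
  refine h2.trans ?_
  have : 0 ≤ volume.real S ^ (1 / (n : ℝ)) * I := by positivity
  nlinarith

lemma lintegral_comp_add_smul_le {G : 𝔼 → ℝ≥0∞} (hG : Measurable G) {t : ℝ} (ht : 1 / 2 ≤ t)
    (a : 𝔼) : ∫⁻ x, G (a + t • x) ≤ 2 ^ n * ∫⁻ x, G x := by
  have ht0 : t ≠ 0 := by linarith
  have h1 : ∫⁻ x, G (a + t • x) = ∫⁻ y, G (a + y) ∂(Measure.map (t • ·) volume) := by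
    rw [lintegral_map (by fun_prop) (by fun_prop)]
  rw [h1, Measure.map_addHaar_smul _ ht0, lintegral_smul_measure, lintegral_add_left_eq_self]
  rw [finrank_euclideanSpace_fin, smul_eq_mul]
  gcongr
  rw [abs_of_nonneg (by positivity), ← inv_pow, ENNReal.ofReal_pow (by positivity)]
  gcongr
  rw [show (2 : ℝ≥0∞) = ENNReal.ofReal 2 by simp]
  refine ENNReal.ofReal_le_ofReal ?_
  rw [inv_le_comm₀ (by linarith) (by norm_num)]
  linarith

lemma enorm_sq_le_lintegral_deriv_sq {g g' : ℝ → ℝ} (hg : ∀ t ∈ Icc (0 : ℝ) 1, HasDerivAt g (g' t) t)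
    (hm : Measurable g') (h0 : g 0 = 0) :
    ‖g 1‖ₑ ^ 2 ≤ ∫⁻ t in Ioc (0 : ℝ) 1, ‖g' t‖ₑ ^ 2 := by
  by_cases hfin : ∫⁻ t in Ioc (0 : ℝ) 1, ‖g' t‖ₑ ^ 2 = ⊤
  · rw [hfin]; exact le_top
  set ν := (volume : Measure ℝ).restrict (Ioc 0 1) with hν
  have : IsProbabilityMeasure ν := ⟨by simp [hν]⟩
  have e2 : eLpNorm g' 2 ν ^ 2 = ∫⁻ t, ‖g' t‖ₑ ^ 2 ∂ν := by
    have := eLpNorm_nnreal_pow_eq_lintegral (f := g') (μ := ν) (p := 2) (by norm_num)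
    simpa using this
  have hmem : MemLp g' 2 ν := by
    refine ⟨hm.aestronglyMeasurable, ?_⟩
    rw [lt_top_iff_ne_top]
    intro h
    rw [h] at e2
    exact hfin (by rw [← e2]; simp)
  have hint : Integrable g' ν := hmem.integrable (by norm_num)
  have hii : IntervalIntegrable g' volume 0 1 :=
    (intervalIntegrable_iff_integrableOn_Ioc_of_le zero_le_one).2 hint
  have hftc := intervalIntegral.integral_eq_sub_of_hasDerivAt
    (by rwa [uIcc_of_le zero_le_one] : ∀ t ∈ uIcc (0 : ℝ) 1, HasDerivAt g (g' t) t) hii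
  rw [h0, sub_zero, intervalIntegral.integral_of_le zero_le_one] at hftc
  rw [← hftc, ← e2]
  gcongr
  refine (enorm_integral_le_lintegral_enorm _).trans ?_
  rw [← eLpNorm_one_eq_lintegral_enorm]
  exact eLpNorm_le_eLpNorm_of_exponent_le (by norm_num) hm.aestronglyMeasurable

lemma lintegral_segment_le {G : 𝔼 → ℝ≥0∞} (hG : Measurable G) (B : Set 𝔼) :
    ∫⁻ z in B, ∫⁻ x in B, ∫⁻ t in Ioc (0 : ℝ) 1, G ((1 - t) • z + t • x) ≤
      volume B * (2 ^ n * ∫⁻ x, G x) := by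
  have hm1 : Measurable fun p : (𝔼 × ℝ) × 𝔼 => G ((1 - p.1.2) • p.1.1 + p.1.2 • p.2) :=
    hG.comp (by fun_prop)
  have hm2 : Measurable fun p : 𝔼 × ℝ => ∫⁻ x in B, G ((1 - p.2) • p.1 + p.2 • x) :=
    Measurable.lintegral_prod_right' (ν := volume.restrict B) hm1
  have e1 : ∀ z, ∫⁻ x in B, ∫⁻ t in Ioc (0 : ℝ) 1, G ((1 - t) • z + t • x) =
      ∫⁻ t in Ioc (0 : ℝ) 1, ∫⁻ x in B, G ((1 - t) • z + t • x) := fun z => by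
    have hsw : Measurable (Function.uncurry fun (x : 𝔼) (t : ℝ) => G ((1 - t) • z + t • x)) :=
      hG.comp (show Measurable fun p : 𝔼 × ℝ => (1 - p.2) • z + p.2 • p.1 by fun_prop)
    exact lintegral_lintegral_swap hsw.aemeasurable
  simp only [e1]
  rw [lintegral_lintegral_swap hm2.aemeasurable]
  calc _ ≤ ∫⁻ _ in Ioc (0 : ℝ) 1, volume B * (2 ^ n * ∫⁻ x, G x) := by
        refine setLIntegral_mono' measurableSet_Ioc fun t _ => ?_
        rcases le_total (1 / 2) t with ht | ht
        · calc _ ≤ ∫⁻ z in B, 2 ^ n * ∫⁻ x, G x := by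
                refine lintegral_mono fun z => ?_
                exact (setLIntegral_le_lintegral _ _).trans
                  (lintegral_comp_add_smul_le hG ht ((1 - t) • z))
            _ = _ := by rw [setLIntegral_const, mul_comm]
        · have hsw : Measurable (Function.uncurry fun (z x : 𝔼) => G ((1 - t) • z + t • x)) :=
            hG.comp (show Measurable fun p : 𝔼 × 𝔼 => (1 - t) • p.1 + t • p.2 by fun_prop)
          rw [lintegral_lintegral_swap hsw.aemeasurable]
          calc _ ≤ ∫⁻ z in B, 2 ^ n * ∫⁻ x, G x := by
                refine lintegral_mono fun x => (setLIntegral_le_lintegral _ _).trans ?_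
                simp only [add_comm _ (t • x)]
                exact lintegral_comp_add_smul_le hG (by linarith) (t • x)
            _ = _ := by rw [setLIntegral_const, mul_comm]
    _ = _ := by
        rw [setLIntegral_const, Real.volume_Ioc]
        simp

/-- A Poincaré inequality for functions vanishing on a subset of a ball. -/
lemma poincare_ball {f : 𝔼 → ℝ} {x₀ : 𝔼} {R : ℝ} (hf : ∀ x ∈ ball x₀ R, DifferentiableAt ℝ f x)
    {Z : Set 𝔼} (hZ : Z ⊆ ball x₀ R) (h0 : ∀ z ∈ Z, f z = 0) :
    volume Z * ∫⁻ x in ball x₀ R, ‖f x‖ₑ ^ 2 ≤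
      ENNReal.ofReal (2 * R) ^ 2 * 2 ^ n * volume (ball x₀ R) *
        ∫⁻ x in ball x₀ R, ‖fderiv ℝ f x‖ₑ ^ 2 := by
  set B := ball x₀ R with hB
  set D := ENNReal.ofReal (2 * R) with hD
  set G : 𝔼 → ℝ≥0∞ := B.indicator fun y => ‖fderiv ℝ f y‖ₑ ^ 2 with hG
  have hGm : Measurable G := ((measurable_fderiv ℝ f).enorm.pow_const 2).indicator measurableSet_ball
  have hDtop : D ^ 2 ≠ ⊤ := ENNReal.pow_ne_top ENNReal.ofReal_ne_top
  have hpt : ∀ z ∈ Z, ∀ x ∈ B, ‖f x‖ₑ ^ 2 ≤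
      D ^ 2 * ∫⁻ t in Ioc (0 : ℝ) 1, G ((1 - t) • z + t • x) := by
    intro z hz x hx
    have hseg : ∀ t ∈ Icc (0 : ℝ) 1, (1 - t) • z + t • x ∈ B := fun t ht =>
      (convex_ball x₀ R) (hZ hz) hx (by linarith [ht.2]) ht.1 (by ring)
    have hline : ∀ t : ℝ, HasDerivAt (fun t : ℝ => (1 - t) • z + t • x) (x - z) t := fun t => by
      have := (((hasDerivAt_id t).const_sub 1).smul_const z).add ((hasDerivAt_id t).smul_const x)
      convert! this using 1
      simp [neg_add_eq_sub]
    have h1 := enorm_sq_le_lintegral_deriv_sq (g := fun t => f ((1 - t) • z + t • x))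
      (g' := fun t => fderiv ℝ f ((1 - t) • z + t • x) (x - z))
      (fun t ht => (hf _ (hseg t ht)).hasFDerivAt.comp_hasDerivAt t (hline t))
      ((measurable_fderiv_apply_const ℝ f (x - z)).comp (by fun_prop)) (by simp [h0 z hz])
    simp only [sub_self, zero_smul, one_smul, zero_add] at h1
    refine h1.trans ?_
    have hmt : Measurable fun t : ℝ => G ((1 - t) • z + t • x) := hGm.comp (by fun_prop)
    rw [← lintegral_const_mul _ hmt]
    refine setLIntegral_mono' measurableSet_Ioc fun t ht => ?_
    rw [hG, indicator_of_mem (hseg t ⟨ht.1.le, ht.2⟩), mul_comm, ← mul_pow]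
    gcongr
    refine (ContinuousLinearMap.le_opENorm _ _).trans ?_
    gcongr
    rw [← ofReal_norm]
    refine ENNReal.ofReal_le_ofReal ?_
    rw [← dist_eq_norm]
    have h2 := mem_ball.1 hx
    have h3 := mem_ball.1 (hZ hz)
    linarith [dist_triangle_right x z x₀]
  calc volume Z * ∫⁻ x in B, ‖f x‖ₑ ^ 2
      = ∫⁻ _ in Z, ∫⁻ x in B, ‖f x‖ₑ ^ 2 := by rw [setLIntegral_const, mul_comm]
    _ ≤ ∫⁻ z in Z, ∫⁻ x in B, D ^ 2 * ∫⁻ t in Ioc (0 : ℝ) 1, G ((1 - t) • z + t • x) := by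
        refine setLIntegral_mono ?_ fun z hz =>
          setLIntegral_mono' measurableSet_ball fun x hx => hpt z hz x hx
        have hm : Measurable fun p : (𝔼 × 𝔼) × ℝ => G ((1 - p.2) • p.1.1 + p.2 • p.1.2) :=
          hGm.comp (by fun_prop)
        have hm' : Measurable fun p : 𝔼 × 𝔼 =>
            D ^ 2 * ∫⁻ t in Ioc (0 : ℝ) 1, G ((1 - t) • p.1 + t • p.2) :=
          (Measurable.lintegral_prod_right' (ν := volume.restrict (Ioc (0:ℝ) 1)) hm).const_mul _
        exact Measurable.lintegral_prod_right' (ν := volume.restrict B) hm'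
    _ ≤ ∫⁻ z in B, ∫⁻ x in B, D ^ 2 * ∫⁻ t in Ioc (0 : ℝ) 1, G ((1 - t) • z + t • x) :=
        lintegral_mono_set hZ
    _ = D ^ 2 * ∫⁻ z in B, ∫⁻ x in B, ∫⁻ t in Ioc (0 : ℝ) 1, G ((1 - t) • z + t • x) := by
        simp only [lintegral_const_mul' _ _ hDtop]
    _ ≤ D ^ 2 * (volume B * (2 ^ n * ∫⁻ x, G x)) := by
        gcongr
        exact lintegral_segment_le hGm B
    _ = _ := by
        rw [hG, lintegral_indicator measurableSet_ball]
        ring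

lemma hasDerivAt_sq_posPart (t : ℝ) :
    HasDerivAt (fun t : ℝ => (max t 0) ^ 2) (2 * max t 0) t := by
  rcases lt_trichotomy t 0 with h | rfl | h
  · have e : (fun t : ℝ => (max t 0) ^ 2) =ᶠ[𝓝 t] fun _ => 0 := by
      filter_upwards [gt_mem_nhds h] with s hs
      simp [max_eq_right hs.le]
    rw [max_eq_right h.le, mul_zero]
    exact (hasDerivAt_const t 0).congr_of_eventuallyEq e
  · rw [max_self, mul_zero, hasDerivAt_iff_isLittleO]
    have h1 : (fun t : ℝ => t ^ 2) =o[𝓝 0] fun t : ℝ => t := by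
      simpa using Asymptotics.isLittleO_pow_id (𝕜 := ℝ) (n := 2) (by norm_num)
    refine Asymptotics.IsBigO.trans_isLittleO ?_ (by simpa using h1)
    refine Asymptotics.IsBigO.of_bound 1 (Eventually.of_forall fun s => ?_)
    simp only [max_self, smul_zero, sub_zero, one_mul, norm_pow, Real.norm_eq_abs, sq_abs]
    simp only [ne_eq, OfNat.ofNat_ne_zero, not_false_eq_true, zero_pow, sub_zero, abs_pow, sq_abs]
    rcases le_total s 0 with hs | hs
    · rw [max_eq_right hs]; simpa using sq_nonneg s
    · rw [max_eq_left hs]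
  · have e : (fun t : ℝ => (max t 0) ^ 2) =ᶠ[𝓝 t] fun s => s ^ 2 := by
      filter_upwards [lt_mem_nhds h] with s hs
      simp [max_eq_left hs.le]
    rw [max_eq_left h.le]
    exact (by simpa using hasDerivAt_pow 2 t : HasDerivAt (fun s : ℝ => s ^ 2) (2 * t) t)
      |>.congr_of_eventuallyEq e

/-- A `C¹` convex approximation of the positive part. -/
def softPos (δ t : ℝ) : ℝ := √((max t 0) ^ 2 + δ ^ 2) - δ

/-- The derivative of `softPos`. -/
def softPosDeriv (δ t : ℝ) : ℝ := max t 0 / √((max t 0) ^ 2 + δ ^ 2)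

section
variable {δ : ℝ} (hδ : 0 < δ) (t : ℝ)
include hδ

lemma hasDerivAt_softPos : HasDerivAt (softPos δ) (softPosDeriv δ t) t := by
  have h := (((hasDerivAt_sq_posPart t).add_const (δ ^ 2)).sqrt (by positivity)).sub_const δ
  refine h.congr_deriv ?_
  rw [softPosDeriv, mul_div_mul_left _ _ two_ne_zero]

lemma continuous_softPosDeriv : Continuous (softPosDeriv δ) := by
  unfold softPosDeriv
  refine Continuous.div (by fun_prop) (by fun_prop) fun x => ?_
  positivity

omit hδ in
lemma softPos_nonneg : 0 ≤ softPos δ t := by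
  have : δ ≤ √((max t 0) ^ 2 + δ ^ 2) := Real.le_sqrt_of_sq_le (by nlinarith [sq_nonneg (max t 0)])
  unfold softPos; linarith

lemma softPosDeriv_nonneg : 0 ≤ softPosDeriv δ t := by
  unfold softPosDeriv
  have : 0 ≤ max t 0 := le_max_right _ _
  positivity

lemma softPosDeriv_le_one : softPosDeriv δ t ≤ 1 := by
  unfold softPosDeriv
  refine div_le_one_of_le₀ (Real.le_sqrt_of_sq_le (by nlinarith)) (by positivity)

lemma softPos_le : softPos δ t ≤ max t 0 := by
  have h0 : 0 ≤ max t 0 := le_max_right _ _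
  have : √((max t 0) ^ 2 + δ ^ 2) ≤ max t 0 + δ := by
    rw [Real.sqrt_le_left (by positivity)]; nlinarith
  unfold softPos; linarith

omit hδ in
lemma le_softPos : max t 0 - δ ≤ softPos δ t := by
  have : max t 0 ≤ √((max t 0) ^ 2 + δ ^ 2) := Real.le_sqrt_of_sq_le (by nlinarith)
  unfold softPos; linarith

lemma sq_softPos_le : softPos δ t ^ 2 ≤ max t 0 ^ 2 * softPosDeriv δ t := by
  have h0 : 0 ≤ max t 0 := le_max_right _ _
  unfold softPos softPosDeriv
  set p := max t 0
  set S := √(p ^ 2 + δ ^ 2) with hS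
  have hS2 : S ^ 2 = p ^ 2 + δ ^ 2 := Real.sq_sqrt (by positivity)
  have hS0 : 0 < S := by positivity
  have hSδ : δ ≤ S := Real.le_sqrt_of_sq_le (by nlinarith)
  have hSp : S ≤ p + δ := by rw [hS, Real.sqrt_le_left (by positivity)]; nlinarith
  rw [← mul_div_assoc, le_div_iff₀ hS0]
  have e : p ^ 2 = (S - δ) * (S + δ) := by nlinarith
  rw [e]
  have : (S - δ) * S ≤ (S + δ) * p := by nlinarith
  have := mul_le_mul_of_nonneg_left this (sub_nonneg.2 hSδ)
  nlinarith

lemma half_le_softPosDeriv (ht : δ ≤ t) : 1 / 2 ≤ softPosDeriv δ t := by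
  unfold softPosDeriv
  rw [max_eq_left (hδ.le.trans ht), le_div_iff₀ (by positivity)]
  have : √(t ^ 2 + δ ^ 2) ≤ 2 * t := by
    rw [Real.sqrt_le_left (by linarith)]; nlinarith
  linarith

lemma softPos_of_nonpos (ht : t ≤ 0) : softPos δ t = 0 := by
  simp [softPos, max_eq_right ht, Real.sqrt_sq hδ.le]

end

lemma exists_deriv_smoothTransition_le : ∃ C : ℝ, 0 < C ∧ ∀ t, |deriv Real.smoothTransition t| ≤ C := by
  have hc : Continuous (deriv Real.smoothTransition) :=
    (Real.smoothTransition.contDiff (n := 1)).continuous_deriv (by simp)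
  obtain ⟨C, hC⟩ := (isCompact_Icc (a := (0 : ℝ)) (b := 1)).exists_bound_of_continuousOn hc.continuousOn
  refine ⟨max C 1, by positivity, fun t => ?_⟩
  by_cases h0 : t < 0
  · have e : Real.smoothTransition =ᶠ[𝓝 t] fun _ => 0 := by
      filter_upwards [gt_mem_nhds h0] with s hs
      exact Real.smoothTransition.zero_of_nonpos hs.le
    rw [e.deriv_eq]; simp
  by_cases h1 : 1 < t
  · have e : Real.smoothTransition =ᶠ[𝓝 t] fun _ => 1 := by
      filter_upwards [lt_mem_nhds h1] with s hs
      exact Real.smoothTransition.one_of_one_le hs.le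
    rw [e.deriv_eq]; simp
  · exact (hC t ⟨not_lt.1 h0, not_lt.1 h1⟩).trans (le_max_left _ _)

/-- Smooth cutoff functions between concentric balls with a gradient bound. -/
lemma exists_cutoff : ∃ C : ℝ, 1 ≤ C ∧ ∀ (x₀ : 𝔼) (r R : ℝ), 0 < r → r < R → ∃ η : 𝔼 → ℝ,
    ContDiff ℝ (⊤ : ℕ∞) η ∧ (∀ x, 0 ≤ η x) ∧ (∀ x, η x ≤ 1) ∧ (∀ x ∈ closedBall x₀ r, η x = 1) ∧
    (∀ x ∉ closedBall x₀ R, η x = 0) ∧ tsupport η ⊆ closedBall x₀ R ∧ HasCompactSupport η ∧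
    ∀ x, ‖fderiv ℝ η x‖ ≤ C / (R - r) := by
  obtain ⟨C, hC, hCb⟩ := exists_deriv_smoothTransition_le
  refine ⟨2 * C + 1, by linarith, fun x₀ r R hr hrR => ?_⟩
  have hD : 0 < R ^ 2 - r ^ 2 := by nlinarith
  set f : 𝔼 → ℝ := fun x => (R ^ 2 - ‖x - x₀‖ ^ 2) / (R ^ 2 - r ^ 2) with hf
  have hz : ∀ x ∉ closedBall x₀ R, Real.smoothTransition (f x) = 0 := fun x hx => by
    refine Real.smoothTransition.zero_of_nonpos (div_nonpos_of_nonpos_of_nonneg ?_ hD.le)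
    rw [mem_closedBall, dist_eq_norm, not_le] at hx
    nlinarith
  have hts : tsupport (fun x => Real.smoothTransition (f x)) ⊆ closedBall x₀ R := by
    refine closure_minimal (fun x hx => ?_) isClosed_closedBall
    by_contra h
    exact hx (hz x h)
  refine ⟨fun x => Real.smoothTransition (f x), ?_, fun x => Real.smoothTransition.nonneg _,
    fun x => Real.smoothTransition.le_one _, fun x hx => ?_, hz, hts,
    HasCompactSupport.of_support_subset_isCompact (isCompact_closedBall x₀ R)
      ((subset_tsupport _).trans hts), fun x => ?_⟩
  · refine Real.smoothTransition.contDiff.comp ?_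
    exact (contDiff_const.sub ((contDiff_id.sub contDiff_const).norm_sq ℝ)).div_const _
  · refine Real.smoothTransition.one_of_one_le ((one_le_div hD).2 ?_)
    rw [mem_closedBall, dist_eq_norm] at hx
    nlinarith [norm_nonneg (x - x₀)]
  · by_cases hx : x ∈ closedBall x₀ R
    · have h1 : HasFDerivAt f (-((R ^ 2 - r ^ 2)⁻¹ • (2 • (innerSL ℝ (x - x₀))))) x := by
        have := ((hasFDerivAt_id x).sub_const x₀).norm_sq
        have := (this.const_sub (R ^ 2)).mul_const (R ^ 2 - r ^ 2)⁻¹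
        refine this.congr_fderiv ?_
        ext v; simp
      have h2 : HasDerivAt Real.smoothTransition (deriv Real.smoothTransition (f x)) (f x) :=
        ((Real.smoothTransition.contDiff (n := 1)).differentiable (by simp) _).hasDerivAt
      have h4 := (h2.comp_hasFDerivAt x h1).fderiv
      simp only [Function.comp_def] at h4
      rw [h4, norm_smul, norm_neg, norm_smul, ← Nat.cast_smul_eq_nsmul ℝ,
        norm_smul, innerSL_apply_norm, Real.norm_eq_abs, norm_inv, Real.norm_of_nonneg hD.le]
      rw [mem_closedBall, dist_eq_norm] at hx
      simp only [Nat.cast_ofNat, Real.norm_ofNat]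
      have h3 : (R ^ 2 - r ^ 2)⁻¹ * (2 * ‖x - x₀‖) ≤ 2 / (R - r) := by
        rw [← div_eq_inv_mul, div_le_div_iff₀ hD (by linarith)]
        nlinarith [norm_nonneg (x - x₀)]
      calc _ ≤ C * (2 / (R - r)) := mul_le_mul (hCb _) h3 (by positivity) hC.le
        _ ≤ _ := by rw [← mul_div_assoc]; gcongr; linarith
    · have e : (fun x => Real.smoothTransition (f x)) =ᶠ[𝓝 x] fun _ => 0 := by
        filter_upwards [isClosed_closedBall.isOpen_compl.mem_nhds hx] with s hs using hz s hs
      rw [e.fderiv_eq]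
      have : 0 ≤ (2 * C + 1) / (R - r) := div_nonneg (by linarith) (by linarith)
      simpa using this

/-- Weak solutions of `div F = 0` where the field `F` has the structure of a linear elliptic flux
of a positive function `u`. -/
structure IsSol (lam Lam : ℝ) (U : Set (EuclideanSpace ℝ (Fin n)))
    (u : EuclideanSpace ℝ (Fin n) → ℝ) (F : EuclideanSpace ℝ (Fin n) → EuclideanSpace ℝ (Fin n)) :
    Prop where
  isOpen : IsOpen U
  pos : ∀ x ∈ U, 0 < u x
  diff : ∀ x ∈ U, DifferentiableAt ℝ u x
  loc : ∀ K ⊆ U, IsCompact K → MemLp (fderiv ℝ u) 2 (volume.restrict K)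
  meas : AEStronglyMeasurable F (volume.restrict U)
  growth : ∀ x ∈ U, ‖F x‖ ≤ Lam * (‖fderiv ℝ u x‖ + u x)
  ell : ∀ x ∈ U, lam * ‖fderiv ℝ u x‖ ^ 2 - Lam * u x * ‖fderiv ℝ u x‖ ≤ fderiv ℝ u x (F x)
  eq : ∀ φ : EuclideanSpace ℝ (Fin n) → ℝ, ContDiff ℝ (⊤ : ℕ∞) φ → HasCompactSupport φ →
    tsupport φ ⊆ U → ∫ x, fderiv ℝ φ x (F x) = 0

lemma continuous_mul_of_tsupport_subset {U : Set 𝔼} (hU : IsOpen U) {η f : 𝔼 → ℝ}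
    (hη : Continuous η) (hs : tsupport η ⊆ U) (hf : ContinuousOn f U) :
    Continuous fun x => η x * f x := by
  refine ContinuousOn.continuous_of_tsupport_subset (hη.continuousOn.mul hf) hU
    ((tsupport_mul_subset_left (f := η) (g := f)).trans hs)

lemma memLp_smul_fderiv_of_tsupport_subset {U : Set 𝔼} (hU : IsOpen U) {η f : 𝔼 → ℝ}
    (hη : ContDiff ℝ (⊤ : ℕ∞) η) (hc : HasCompactSupport η) (hs : tsupport η ⊆ U)
    (hf : ContinuousOn f U) :
    Measurable (fun x => f x • fderiv ℝ η x) ∧ MemLp (fun x => f x • fderiv ℝ η x) 2 := by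
  have hη' : Continuous (fderiv ℝ η) := hη.continuous_fderiv (by simp)
  have hT : Continuous fun x => f x • fderiv ℝ η x := by
    refine ContinuousOn.continuous_of_tsupport_subset (hf.smul hη'.continuousOn) hU ?_
    exact (tsupport_smul_subset_right f (fderiv ℝ η)).trans ((tsupport_fderiv_subset ℝ).trans hs)
  have hTc : HasCompactSupport fun x => f x • fderiv ℝ η x := by
    refine (hc.fderiv (𝕜 := ℝ)).mono fun x hx hx' => hx ?_
    change f x • fderiv ℝ η x = 0
    rw [hx', smul_zero]
  exact ⟨hT.measurable, hT.memLp_of_hasCompactSupport hTc⟩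

lemma memLp_smul_of_hasCompactSupport {g : 𝔼 → ℝ} {T : 𝔼 → 𝔼 →L[ℝ] ℝ} {K : Set 𝔼}
    (hg : Continuous g) (hc : HasCompactSupport g) (hT : MemLp T 2 (volume.restrict K)) :
    MemLp (fun x => g x • T x) 2 (volume.restrict K) := by
  obtain ⟨C, hC⟩ := hg.bounded_above_of_compact_support hc
  refine MemLp.smul (p := ⊤) (q := 2) (r := 2) (𝕜 := ℝ) (φ := g) (f := T) hT ?_
  exact memLp_top_of_bound hg.aestronglyMeasurable C (Eventually.of_forall hC)

lemma memLp_fun_add {X : Type*} [NormedAddCommGroup X] {S T : 𝔼 → X} (hS : MemLp S 2)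
    (hT : MemLp T 2) : MemLp (fun x => S x + T x) 2 := MemLp.add hS hT

lemma memLp_of_restrict {X : Type*} [NormedAddCommGroup X] {T : 𝔼 → X} {K : Set 𝔼}
    (hK : MeasurableSet K) (h : MemLp T 2 (volume.restrict K)) (h0 : ∀ x ∉ K, T x = 0) :
    MemLp T 2 := by
  rw [← memLp_indicator_iff_restrict hK] at h
  rwa [indicator_eq_self.2 fun x hx => ?_] at h
  by_contra hx'
  exact hx (h0 x hx')

namespace IsSol

variable {lam Lam : ℝ} {U : Set (EuclideanSpace ℝ (Fin n))} {u : EuclideanSpace ℝ (Fin n) → ℝ}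
  {F : EuclideanSpace ℝ (Fin n) → EuclideanSpace ℝ (Fin n)}

lemma continuousOn (h : IsSol lam Lam U u F) : ContinuousOn u U := fun x hx =>
  (h.diff x hx).continuousAt.continuousWithinAt

lemma memLp_field (h : IsSol lam Lam U u F) {K : Set 𝔼} (hK : K ⊆ U) (hc : IsCompact K) :
    MemLp F 2 (volume.restrict K) := by
  have : IsFiniteMeasure (volume.restrict K) :=
    ⟨by rw [Measure.restrict_apply_univ]; exact hc.measure_lt_top⟩
  obtain ⟨C, hC⟩ := hc.exists_bound_of_continuousOn (h.continuousOn.mono hK)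
  refine MemLp.mono' (g := fun x => |Lam| * (‖fderiv ℝ u x‖ + C))
    (((h.loc K hK hc).norm.add (memLp_const C)).const_mul _)
    (h.meas.mono_measure (Measure.restrict_mono hK le_rfl)) ?_
  refine (ae_restrict_iff' hc.measurableSet).2 (Eventually.of_forall fun x hx => ?_)
  have h1 := h.growth x (hK hx)
  have h2 := (le_abs_self _).trans (hC x hx)
  have h3 := h.pos x (hK hx)
  calc _ ≤ Lam * (‖fderiv ℝ u x‖ + u x) := h1
    _ ≤ |Lam| * (‖fderiv ℝ u x‖ + u x) :=
      mul_le_mul_of_nonneg_right (le_abs_self _) (by positivity)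
    _ ≤ _ := by gcongr

lemma integrable_clm_apply (h : IsSol lam Lam U u F) {T : 𝔼 → 𝔼 →L[ℝ] ℝ} (hT : Measurable T)
    {K : Set 𝔼} (hK : K ⊆ U) (hc : IsCompact K) (hT2 : MemLp T 2 (volume.restrict K))
    (h0 : ∀ x ∉ K, T x = 0) : Integrable fun x => T x (F x) := by
  rw [← integrableOn_iff_integrable_of_support_subset (s := K)]
  · have hF := h.memLp_field hK hc
    have : Integrable (fun x => ‖T x‖ * ‖F x‖) (volume.restrict K) :=
      MemLp.integrable_mul (p := 2) (q := 2) hT2.norm hF.norm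
    refine this.mono' ?_ (Eventually.of_forall fun x => ContinuousLinearMap.le_opNorm _ _)
    exact isBoundedBilinearMap_apply.continuous.comp_aestronglyMeasurable
      (hT.aestronglyMeasurable.prodMk hF.1)
  · intro x hx
    by_contra hxK
    exact hx (by simp [h0 x hxK])

lemma integrable_mul_fderiv_left (h : IsSol lam Lam U u F) {f η : 𝔼 → ℝ} (hf : ContinuousOn f U)
    (hη : ContDiff ℝ (⊤ : ℕ∞) η) (hc : HasCompactSupport η) (hs : tsupport η ⊆ U) :
    Integrable fun x => f x * fderiv ℝ η x (F x) := by
  have h0 : ∀ x ∉ tsupport η, fderiv ℝ η x = 0 := fun x hx =>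
    image_eq_zero_of_notMem_tsupport fun h => hx (tsupport_fderiv_subset ℝ h)
  obtain ⟨h1, h2⟩ := memLp_smul_fderiv_of_tsupport_subset h.isOpen hη hc hs hf
  exact h.integrable_clm_apply (T := fun x => f x • fderiv ℝ η x) h1 hs hc.isCompact (h2.restrict _)
    fun x hx => by rw [h0 x hx, smul_zero]

lemma integrable_mul_fderiv_right (h : IsSol lam Lam U u F) {f η : 𝔼 → ℝ} (hf : ContinuousOn f U)
    (hη : Continuous η) (hc : HasCompactSupport η) (hs : tsupport η ⊆ U) :
    Integrable fun x => η x * f x * fderiv ℝ u x (F x) := by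
  have hg : Continuous fun x => η x * f x := continuous_mul_of_tsupport_subset h.isOpen hη hs hf
  refine h.integrable_clm_apply (T := fun x => (η x * f x) • fderiv ℝ u x)
    (hg.measurable.smul (measurable_fderiv ℝ u)) hs hc.isCompact
    (memLp_smul_of_hasCompactSupport hg hc.mul_right (h.loc _ hs hc.isCompact))
    fun x hx => by rw [image_eq_zero_of_notMem_tsupport hx, zero_mul, zero_smul]

/-- Testing the equation with `η Φ(u)`. -/
lemma integral_test (h : IsSol lam Lam U u F) {Φ Φ' : ℝ → ℝ} (hΦ : ∀ t, 0 < t → HasDerivAt Φ (Φ' t) t)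
    (hΦ' : ContinuousOn Φ' (Ioi 0)) {η : 𝔼 → ℝ}
    (hη : ContDiff ℝ (⊤ : ℕ∞) η) (hc : HasCompactSupport η) (hs : tsupport η ⊆ U) :
    ∫ x, (Φ (u x) * fderiv ℝ η x (F x) + η x * Φ' (u x) * fderiv ℝ u x (F x)) = 0 := by
  set ψ : 𝔼 → ℝ := fun x => η x * Φ (u x) with hψ
  have hηd : Differentiable ℝ η := hη.differentiable (by simp)
  have h0 : ∀ x ∉ tsupport η, fderiv ℝ η x = 0 := fun x hx =>
    image_eq_zero_of_notMem_tsupport fun h => hx (tsupport_fderiv_subset ℝ h)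
  have hder : ∀ x, HasFDerivAt ψ (Φ (u x) • fderiv ℝ η x + (η x * Φ' (u x)) • fderiv ℝ u x) x := by
    intro x
    by_cases hx : x ∈ tsupport η
    · have h1 := (hΦ (u x) (h.pos x (hs hx))).comp_hasFDerivAt x (h.diff x (hs hx)).hasFDerivAt
      refine ((hηd x).hasFDerivAt.mul h1).congr_fderiv ?_
      ext v
      simp; ring
    · have e : ψ =ᶠ[𝓝 x] fun _ => 0 := by
        filter_upwards [(isClosed_tsupport η).isOpen_compl.mem_nhds hx] with y hy
        simp [hψ, image_eq_zero_of_notMem_tsupport hy]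
      rw [h0 x hx, image_eq_zero_of_notMem_tsupport hx]
      simpa using (hasFDerivAt_const (0 : ℝ) x).congr_of_eventuallyEq e
  have hΦc : ContinuousOn (fun x => Φ (u x)) U := fun x hx =>
    ((hΦ _ (h.pos x hx)).continuousAt.comp (h.diff x hx).continuousAt).continuousWithinAt
  have hΦ'c : ContinuousOn (fun x => Φ' (u x)) U := hΦ'.comp h.continuousOn fun x hx => h.pos x hx
  have hψs : tsupport ψ ⊆ tsupport η := tsupport_mul_subset_left
  have key := integral_fderiv_eq_zero_of_smooth h.isOpen (F := F) (fun K hK hKc => h.memLp_field hK hKc)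
    h.eq (ψ := ψ) (fun x => (hder x).differentiableAt) hc.mul_right (hψs.trans hs) ?_
  · simpa only [(hder _).fderiv, _root_.add_apply, _root_.smul_apply,
      smul_eq_mul] using key
  · rw [funext fun x => (hder x).fderiv]
    have h2 := (memLp_smul_fderiv_of_tsupport_subset (f := fun x => Φ (u x)) h.isOpen hη hc hs hΦc).2
    refine memLp_fun_add h2 ?_
    have hg : Continuous fun x => η x * Φ' (u x) :=
      continuous_mul_of_tsupport_subset h.isOpen hη.continuous hs hΦ'c
    have h3 := memLp_smul_of_hasCompactSupport hg hc.mul_right (h.loc _ hs hc.isCompact)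
    refine memLp_of_restrict (isClosed_tsupport η).measurableSet h3 fun x hx => ?_
    rw [image_eq_zero_of_notMem_tsupport hx, zero_mul, zero_smul]

end IsSol

lemma fderiv_sq_apply {η : 𝔼 → ℝ} {x : 𝔼} (h : DifferentiableAt ℝ η x) (v : 𝔼) :
    fderiv ℝ (fun x => η x ^ 2) x v = 2 * η x * fderiv ℝ η x v := by
  have := (h.hasFDerivAt.pow 2).fderiv
  rw [this]
  simp

lemma tsupport_sq_subset (η : 𝔼 → ℝ) : tsupport (fun x => η x ^ 2) ⊆ tsupport η := by
  refine closure_mono fun x hx => ?_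
  simpa using hx

lemma hasCompactSupport_sq {η : 𝔼 → ℝ} (hc : HasCompactSupport η) :
    HasCompactSupport (fun x => η x ^ 2) :=
  hc.mono fun x hx => by simpa using hx

lemma log_estimate_pointwise {lam Lam u nu e η T D : ℝ} (hlam : 0 < lam) (hLam : 0 ≤ Lam) (hu : 0 < u)
    (hnu : 0 ≤ nu) (hη : 0 ≤ η) (hT : |T| ≤ e * (Lam * (nu + u)))
    (hD : lam * nu ^ 2 - Lam * u * nu ≤ D) :
    u⁻¹ * (2 * η * T) + η ^ 2 * (-(u ^ 2)⁻¹) * D ≤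
      -(lam / 2) * (η ^ 2 * (nu / u) ^ 2) + (4 * Lam ^ 2 / lam + Lam) * (η ^ 2 + e ^ 2) := by
  set w := nu / u with hw
  have hw0 : 0 ≤ w := by positivity
  have hT' : u⁻¹ * (2 * η * T) ≤ 2 * η * (e * (Lam * (w + 1))) := by
    have h1 : u⁻¹ * (2 * η * T) ≤ u⁻¹ * (2 * η * (e * (Lam * (nu + u)))) := by
      gcongr; exact (le_abs_self T).trans hT
    refine h1.trans_eq ?_
    rw [hw]; field_simp
  have hD' : lam * w ^ 2 - Lam * w ≤ (u ^ 2)⁻¹ * D := by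
    have h1 : (u ^ 2)⁻¹ * (lam * nu ^ 2 - Lam * u * nu) ≤ (u ^ 2)⁻¹ * D := by gcongr
    refine Eq.trans_le ?_ h1
    rw [hw]; field_simp
  have h2 := mul_le_mul_of_nonneg_left hD' (sq_nonneg η)
  have h3 : Lam * η ^ 2 * w ≤ lam / 4 * (η ^ 2 * w ^ 2) + Lam ^ 2 / lam * η ^ 2 := by
    have : 0 ≤ η ^ 2 / lam * (lam / 2 * w - Lam) ^ 2 := by positivity
    have e : η ^ 2 / lam * (lam / 2 * w - Lam) ^ 2 =
      lam / 4 * (η ^ 2 * w ^ 2) + Lam ^ 2 / lam * η ^ 2 - Lam * η ^ 2 * w := by field_simp; ring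
    linarith
  have h4 : 2 * η * e * Lam * w ≤ lam / 4 * (η ^ 2 * w ^ 2) + 4 * Lam ^ 2 / lam * e ^ 2 := by
    have : 0 ≤ 1 / lam * (lam / 2 * (η * w) - 2 * Lam * e) ^ 2 := by positivity
    have e' : 1 / lam * (lam / 2 * (η * w) - 2 * Lam * e) ^ 2 =
      lam / 4 * (η ^ 2 * w ^ 2) + 4 * Lam ^ 2 / lam * e ^ 2 - 2 * η * e * Lam * w := by field_simp; ring
    linarith
  have h5 : 2 * η * e * Lam ≤ Lam * (η ^ 2 + e ^ 2) := by nlinarith [mul_nonneg hLam (sq_nonneg (η - e))]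
  have h6 : Lam ^ 2 / lam * η ^ 2 ≤ 4 * Lam ^ 2 / lam * η ^ 2 := by
    gcongr; nlinarith [sq_nonneg Lam]
  nlinarith

lemma integrable_of_le_of_measurable {f g : 𝔼 → ℝ} (hf : AEStronglyMeasurable f) (h0 : ∀ x, 0 ≤ f x)
    (hg : Integrable g) (h : ∀ x, f x ≤ g x) : Integrable f :=
  hg.mono' hf (Eventually.of_forall fun x => by rw [Real.norm_of_nonneg (h0 x)]; exact h x)

lemma measurable_mul_of_tsupport_subset {U : Set 𝔼} (hU : IsOpen U) {η f : 𝔼 → ℝ}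
    (hη : Continuous η) (hs : tsupport η ⊆ U) (hf : ContinuousOn f U) {u : 𝔼 → ℝ} (k : ℕ) :
    Measurable fun x => η x * (f x * ‖fderiv ℝ u x‖ ^ k) := by
  simp_rw [← mul_assoc]
  exact (continuous_mul_of_tsupport_subset hU hη hs hf).measurable.mul
    ((measurable_fderiv ℝ u).norm.pow_const k)

namespace IsSol

variable {lam Lam : ℝ} {U : Set (EuclideanSpace ℝ (Fin n))} {u : EuclideanSpace ℝ (Fin n) → ℝ}
  {F : EuclideanSpace ℝ (Fin n) → EuclideanSpace ℝ (Fin n)}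

/-- The logarithmic gradient estimate. -/
lemma log_estimate (h : IsSol lam Lam U u F) (hlam : 0 < lam) (hLam : 0 ≤ Lam) {η : 𝔼 → ℝ}
    (hη : ContDiff ℝ (⊤ : ℕ∞) η) (hc : HasCompactSupport η) (hs : tsupport η ⊆ U) (h0 : ∀ x, 0 ≤ η x) :
    Integrable (fun x => η x ^ 2 * (‖fderiv ℝ u x‖ / u x) ^ 2) ∧
    ∫ x, η x ^ 2 * (‖fderiv ℝ u x‖ / u x) ^ 2 ≤
      2 / lam * (4 * Lam ^ 2 / lam + Lam) * ∫ x, (η x ^ 2 + ‖fderiv ℝ η x‖ ^ 2) := by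
  have hη2 : ContDiff ℝ (⊤ : ℕ∞) (fun x => η x ^ 2) := hη.pow 2
  have hc2 := hasCompactSupport_sq hc
  have hs2 := (tsupport_sq_subset η).trans hs
  have hinv : ContinuousOn (fun x => (u x)⁻¹) U := h.continuousOn.inv₀ fun x hx => (h.pos x hx).ne'
  have hinv2 : ContinuousOn (fun x => -(u x ^ 2)⁻¹) U :=
    ((h.continuousOn.pow 2).inv₀ fun x hx => (pow_pos (h.pos x hx) 2).ne').neg
  have hi1 := h.integrable_mul_fderiv_left hinv hη2 hc2 hs2
  have hi2 := h.integrable_mul_fderiv_right hinv2 hη2.continuous hc2 hs2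
  have hsq : ContinuousOn (fun t : ℝ => -(t ^ 2)⁻¹) (Ioi 0) :=
    ((continuousOn_pow 2).inv₀ fun t ht => (pow_pos (mem_Ioi.1 ht) 2).ne').neg
  have htest := h.integral_test (Φ := fun t => t⁻¹) (Φ' := fun t => -(t ^ 2)⁻¹)
    (fun t ht => hasDerivAt_inv ht.ne')
    hsq hη2 hc2 hs2
  set P : 𝔼 → ℝ := fun x => (u x)⁻¹ * fderiv ℝ (fun x => η x ^ 2) x (F x) +
    η x ^ 2 * (-(u x ^ 2)⁻¹) * fderiv ℝ u x (F x) with hP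
  have hPi : Integrable P := hi1.add hi2
  set C := 4 * Lam ^ 2 / lam + Lam with hC
  have hEi : Integrable fun x => η x ^ 2 + ‖fderiv ℝ η x‖ ^ 2 := by
    refine Integrable.add (hη2.continuous.integrable_of_hasCompactSupport hc2) ?_
    refine ((hη.continuous_fderiv (by simp)).norm.pow 2).integrable_of_hasCompactSupport ?_
    exact (hc.fderiv (𝕜 := ℝ)).mono fun x hx hx' => hx (by simp [hx'])
  have hpt : ∀ x, η x ^ 2 * (‖fderiv ℝ u x‖ / u x) ^ 2 ≤
      2 / lam * (C * (η x ^ 2 + ‖fderiv ℝ η x‖ ^ 2) - P x) := by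
    intro x
    by_cases hx : x ∈ tsupport η
    · have hxU := hs hx
      have key := log_estimate_pointwise (lam := lam) (Lam := Lam) (u := u x) (nu := ‖fderiv ℝ u x‖)
        (e := ‖fderiv ℝ η x‖) (η := η x) (T := fderiv ℝ η x (F x)) (D := fderiv ℝ u x (F x)) hlam hLam
        (h.pos x hxU) (norm_nonneg _) (h0 x)
        ((ContinuousLinearMap.le_opNorm (fderiv ℝ η x) (F x)).trans
          (mul_le_mul_of_nonneg_left (h.growth x hxU) (norm_nonneg _))) (h.ell x hxU)
      rw [← fderiv_sq_apply (hη.differentiable (by simp) x)] at key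
      rw [div_mul_eq_mul_div, le_div_iff₀ hlam]
      simp only [hP]
      linarith
    · have h1 : fderiv ℝ η x = 0 :=
        image_eq_zero_of_notMem_tsupport fun h => hx (tsupport_fderiv_subset ℝ h)
      have h2 : fderiv ℝ (fun x => η x ^ 2) x (F x) = 0 := by
        rw [fderiv_sq_apply (hη.differentiable (by simp) x), h1, zero_apply, mul_zero]
      simp only [hP, h2, h1, image_eq_zero_of_notMem_tsupport hx]
      simp
  have hi : Integrable fun x => 2 / lam * (C * (η x ^ 2 + ‖fderiv ℝ η x‖ ^ 2) - P x) :=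
    ((hEi.const_mul C).sub hPi).const_mul _
  have hmeas : Measurable fun x => η x ^ 2 * (‖fderiv ℝ u x‖ / u x) ^ 2 := by
    have := measurable_mul_of_tsupport_subset h.isOpen hη2.continuous hs2 (hinv.pow 2) (u := u) 2
    convert! this using 2 with x
    simp only [div_pow, Pi.pow_apply]
    ring
  refine ⟨integrable_of_le_of_measurable hmeas.aestronglyMeasurable (fun x => by positivity) hi hpt, ?_⟩
  refine (integral_mono_of_nonneg (Eventually.of_forall fun x => by positivity) hi
    (Eventually.of_forall hpt)).trans_eq ?_
  rw [integral_const_mul, integral_sub (hEi.const_mul C) hPi, integral_const_mul, htest]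
  ring

end IsSol

/-- Weak subsolutions: the integrated inequality is required after composing with any `C¹`
nonnegative nondecreasing function. -/
structure IsSub (lam Lam : ℝ) (U : Set (EuclideanSpace ℝ (Fin n)))
    (v : EuclideanSpace ℝ (Fin n) → ℝ) (H : EuclideanSpace ℝ (Fin n) → EuclideanSpace ℝ (Fin n)) :
    Prop where
  isOpen : IsOpen U
  diff : ∀ x ∈ U, DifferentiableAt ℝ v x
  growth : ∀ x ∈ U, ‖H x‖ ≤ Lam * (‖fderiv ℝ v x‖ + (1 + max (v x) 0))
  ell : ∀ x ∈ U, lam * ‖fderiv ℝ v x‖ ^ 2 - Lam * (1 + max (v x) 0) ^ 2 ≤ fderiv ℝ v x (H x)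
  test : ∀ s s' : ℝ → ℝ, (∀ t, HasDerivAt s (s' t) t) → Continuous s' → (∀ t, 0 ≤ s t) →
    ∀ η : EuclideanSpace ℝ (Fin n) → ℝ, ContDiff ℝ (⊤ : ℕ∞) η →
    HasCompactSupport η → tsupport η ⊆ U → (∀ x, 0 ≤ η x) →
    Integrable (fun x => s (v x) * fderiv ℝ η x (H x) + η x * s' (v x) * fderiv ℝ v x (H x)) ∧
    ∫ x, (s (v x) * fderiv ℝ η x (H x) + η x * s' (v x) * fderiv ℝ v x (H x)) ≤
      Lam * ∫ x, η x * s (v x)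

namespace IsSol

variable {lam Lam : ℝ} {U : Set (EuclideanSpace ℝ (Fin n))} {u : EuclideanSpace ℝ (Fin n) → ℝ}
  {F : EuclideanSpace ℝ (Fin n) → EuclideanSpace ℝ (Fin n)}

lemma isSub_div (h : IsSol lam Lam U u F) (hlam : 0 < lam) (hLam : 0 ≤ Lam) {σ : ℝ} (hσ : 0 < σ) :
    IsSub (lam / 2) (Lam + Lam ^ 2 / lam) U (fun x => σ⁻¹ * u x) (fun x => σ⁻¹ • F x) := by
  have hLL : 0 ≤ Lam ^ 2 / lam := by positivity
  have hv : ∀ x ∈ U, HasFDerivAt (fun x => σ⁻¹ * u x) (σ⁻¹ • fderiv ℝ u x) x := fun x hx =>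
    (h.diff x hx).hasFDerivAt.const_mul _
  refine ⟨h.isOpen, fun x hx => (hv x hx).differentiableAt, fun x hx => ?_, fun x hx => ?_, ?_⟩
  · have hp := h.pos x hx
    rw [(hv x hx).fderiv, norm_smul, norm_smul, Real.norm_of_nonneg (inv_nonneg.2 hσ.le),
      max_eq_left (by positivity)]
    have h1 := mul_le_mul_of_nonneg_left (h.growth x hx) (inv_nonneg.2 hσ.le)
    have h2 : 0 ≤ σ⁻¹ * ‖fderiv ℝ u x‖ := by positivity
    have h3 : 0 ≤ σ⁻¹ * u x := by positivity
    nlinarith [mul_nonneg hLL h2, mul_nonneg hLL h3]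
  · have hp := h.pos x hx
    rw [(hv x hx).fderiv, norm_smul, Real.norm_of_nonneg (inv_nonneg.2 hσ.le),
      max_eq_left (by positivity)]
    simp only [_root_.smul_apply, map_smul, smul_eq_mul]
    have h1 := mul_le_mul_of_nonneg_left (h.ell x hx) (sq_nonneg σ⁻¹)
    set w := σ⁻¹ * u x
    set p := σ⁻¹ * ‖fderiv ℝ u x‖ with hp'
    have h2 : 0 ≤ w := by positivity
    have h3 : σ⁻¹ ^ 2 * (lam * ‖fderiv ℝ u x‖ ^ 2 - Lam * u x * ‖fderiv ℝ u x‖) =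
      lam * p ^ 2 - Lam * w * p := by ring
    have h4 : Lam * w * p ≤ lam / 2 * p ^ 2 + Lam ^ 2 / lam * w ^ 2 := by
      have h5 : 0 ≤ 1 / (2 * lam) * (lam * p - Lam * w) ^ 2 := by positivity
      have h6 : 1 / (2 * lam) * (lam * p - Lam * w) ^ 2 =
        lam / 2 * p ^ 2 + Lam ^ 2 / lam * w ^ 2 / 2 - Lam * w * p := by field_simp; ring
      nlinarith [mul_nonneg hLL (sq_nonneg w)]
    have h7 : Lam ^ 2 / lam * w ^ 2 ≤ Lam ^ 2 / lam * (1 + w) ^ 2 := by gcongr; linarith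
    nlinarith [sq_nonneg (1 + w)]
  · intro s s' hs hs' hs0 η hη hc hsU hη0
    have hsc : Continuous s := continuous_iff_continuousAt.2 fun t => (hs t).continuousAt
    have hc1 : ContinuousOn (fun x => σ⁻¹ * s (σ⁻¹ * u x)) U :=
      continuousOn_const.mul (hsc.comp_continuousOn (continuousOn_const.mul h.continuousOn))
    have hc2 : ContinuousOn (fun x => σ⁻¹ ^ 2 * s' (σ⁻¹ * u x)) U :=
      continuousOn_const.mul (hs'.comp_continuousOn (continuousOn_const.mul h.continuousOn))
    have e : (fun x => s (σ⁻¹ * u x) * fderiv ℝ η x (σ⁻¹ • F x) +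
        η x * s' (σ⁻¹ * u x) * fderiv ℝ (fun x => σ⁻¹ * u x) x (σ⁻¹ • F x)) = fun x =>
        (σ⁻¹ * s (σ⁻¹ * u x)) * fderiv ℝ η x (F x) +
        η x * (σ⁻¹ ^ 2 * s' (σ⁻¹ * u x)) * fderiv ℝ u x (F x) := by
      ext x
      by_cases hx : x ∈ tsupport η
      · rw [(hv x (hsU hx)).fderiv]
        simp only [_root_.smul_apply, map_smul, smul_eq_mul]
        ring
      · simp only [image_eq_zero_of_notMem_tsupport hx, map_smul, smul_eq_mul]
        ring
    rw [e]
    refine ⟨(h.integrable_mul_fderiv_left hc1 hη hc hsU).add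
      (h.integrable_mul_fderiv_right hc2 hη.continuous hc hsU), ?_⟩
    have := h.integral_test (Φ := fun t => σ⁻¹ * s (σ⁻¹ * t)) (Φ' := fun t => σ⁻¹ ^ 2 * s' (σ⁻¹ * t))
      (fun t _ => ?_) (by fun_prop) hη hc hsU
    · rw [this]
      exact mul_nonneg (by positivity) (integral_nonneg fun x => mul_nonneg (hη0 x) (hs0 _))
    · have h1 : HasDerivAt (fun t : ℝ => σ⁻¹ * t) σ⁻¹ t := by
        simpa using (hasDerivAt_id t).const_mul σ⁻¹
      refine (((hs (σ⁻¹ * t)).comp t h1).const_mul σ⁻¹).congr_deriv ?_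
      ring

lemma isSub_log (h : IsSol lam Lam U u F) (hlam : 0 < lam) (hLam : 0 ≤ Lam) (c : ℝ) {N : ℝ}
    (hN : 1 ≤ N) :
    IsSub (lam / 2) (Lam + Lam ^ 2 / lam) U (fun x => N⁻¹ * (Real.log c - Real.log (u x)))
      (fun x => (-(N⁻¹ * (u x)⁻¹)) • F x) := by
  have hLL : 0 ≤ Lam ^ 2 / lam := by positivity
  have hN0 : 0 < N := by linarith
  set ν := N⁻¹ with hν
  have hν0 : 0 < ν := inv_pos.2 hN0
  have hν1 : ν ≤ 1 := inv_le_one_of_one_le₀ hN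
  have hv : ∀ x ∈ U, HasFDerivAt (fun x => ν * (Real.log c - Real.log (u x)))
      ((-(ν * (u x)⁻¹)) • fderiv ℝ u x) x := fun x hx => by
    have h1 := (((h.diff x hx).hasFDerivAt.log (h.pos x hx).ne').const_sub (Real.log c)).const_mul ν
    refine h1.congr_fderiv ?_
    ext w
    simp; ring
  have hlow : ∀ x ∈ U, -(Lam ^ 2 / lam) ≤ ((u x)⁻¹) ^ 2 * fderiv ℝ u x (F x) ∧
      lam * ((u x)⁻¹ * ‖fderiv ℝ u x‖) ^ 2 - Lam * ((u x)⁻¹ * ‖fderiv ℝ u x‖) ≤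
        ((u x)⁻¹) ^ 2 * fderiv ℝ u x (F x) := by
    intro x hx
    have hp := h.pos x hx
    have h1 := mul_le_mul_of_nonneg_left (h.ell x hx) (sq_nonneg (u x)⁻¹)
    have e : (u x)⁻¹ ^ 2 * (lam * ‖fderiv ℝ u x‖ ^ 2 - Lam * u x * ‖fderiv ℝ u x‖) =
      lam * ((u x)⁻¹ * ‖fderiv ℝ u x‖) ^ 2 - Lam * ((u x)⁻¹ * ‖fderiv ℝ u x‖) := by
      field_simp
    rw [e] at h1
    refine ⟨le_trans ?_ h1, h1⟩
    set p := (u x)⁻¹ * ‖fderiv ℝ u x‖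
    have h5 : 0 ≤ 1 / lam * ((lam * p - Lam / 2) ^ 2 + 3 * Lam ^ 2 / 4) := by positivity
    have h6 : 1 / lam * ((lam * p - Lam / 2) ^ 2 + 3 * Lam ^ 2 / 4) =
      lam * p ^ 2 - Lam * p + Lam ^ 2 / lam := by field_simp; ring
    linarith
  refine ⟨h.isOpen, fun x hx => (hv x hx).differentiableAt, fun x hx => ?_, fun x hx => ?_, ?_⟩
  · have hp := h.pos x hx
    have hq : 0 < ν * (u x)⁻¹ := by positivity
    rw [(hv x hx).fderiv, norm_smul, norm_smul, norm_neg, Real.norm_of_nonneg hq.le]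
    have h1 := mul_le_mul_of_nonneg_left (h.growth x hx) hq.le
    have h2 : 0 ≤ ν * (u x)⁻¹ * ‖fderiv ℝ u x‖ := by positivity
    have h3 : ν * (u x)⁻¹ * u x = ν := by field_simp
    have h4 : 0 ≤ max (ν * (Real.log c - Real.log (u x))) 0 := le_max_right _ _
    set m := max (ν * (Real.log c - Real.log (u x))) 0
    calc _ ≤ ν * (u x)⁻¹ * (Lam * (‖fderiv ℝ u x‖ + u x)) := h1
      _ = Lam * (ν * (u x)⁻¹ * ‖fderiv ℝ u x‖ + ν * (u x)⁻¹ * u x) := by ring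
      _ ≤ (Lam + Lam ^ 2 / lam) * (ν * (u x)⁻¹ * ‖fderiv ℝ u x‖ + (1 + m)) := by
        rw [h3]
        gcongr <;> linarith
  · have hp := h.pos x hx
    have hq : 0 < ν * (u x)⁻¹ := by positivity
    rw [(hv x hx).fderiv, norm_smul, norm_neg, Real.norm_of_nonneg hq.le]
    simp only [_root_.smul_apply, map_smul, smul_eq_mul]
    have h1 := mul_le_mul_of_nonneg_left (hlow x hx).2 (sq_nonneg ν)
    set p := (u x)⁻¹ * ‖fderiv ℝ u x‖ with hpd
    have hp0 : 0 ≤ p := by positivity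
    have e1 : ν * (u x)⁻¹ * ‖fderiv ℝ u x‖ = ν * p := by rw [hpd]; ring
    have e2 : -(ν * (u x)⁻¹) * (-(ν * (u x)⁻¹) * fderiv ℝ u x (F x)) =
      ν ^ 2 * ((u x)⁻¹ ^ 2 * fderiv ℝ u x (F x)) := by ring
    rw [e1, e2]
    refine le_trans ?_ h1
    have h4 : 0 ≤ max (ν * (Real.log c - Real.log (u x))) 0 := le_max_right _ _
    set m := max (ν * (Real.log c - Real.log (u x))) 0
    have h5 : 0 ≤ ν ^ 2 * (1 / (2 * lam) * (lam * p - Lam) ^ 2) := by positivity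
    have h6 : 1 / (2 * lam) * (lam * p - Lam) ^ 2 = lam / 2 * p ^ 2 - Lam * p + Lam ^ 2 / lam / 2 := by
      field_simp; ring
    rw [h6] at h5
    have h7 : ν ^ 2 * (Lam ^ 2 / lam) ≤ (Lam + Lam ^ 2 / lam) * (1 + m) ^ 2 := by
      have h8 : ν ^ 2 ≤ (1 + m) ^ 2 := by gcongr; linarith
      nlinarith [mul_nonneg hLam (sq_nonneg (1 + m)), mul_le_mul_of_nonneg_right h8 hLL]
    nlinarith [mul_nonneg hLL (sq_nonneg ν)]
  · intro s s' hs hs' hs0 η hη hc hsU hη0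
    have hsc : Continuous s := continuous_iff_continuousAt.2 fun t => (hs t).continuousAt
    have hinv : ContinuousOn (fun x => (u x)⁻¹) U := h.continuousOn.inv₀ fun x hx => (h.pos x hx).ne'
    have hvc : ContinuousOn (fun x => ν * (Real.log c - Real.log (u x))) U := fun x hx =>
      (hv x hx).continuousAt.continuousWithinAt
    have hc1 : ContinuousOn (fun x => -(ν * (u x)⁻¹) * s (ν * (Real.log c - Real.log (u x)))) U :=
      (continuousOn_const.mul hinv).neg.mul (hsc.comp_continuousOn hvc)
    have hc2 : ContinuousOn (fun x => ν ^ 2 * (u x)⁻¹ ^ 2 * s' (ν * (Real.log c - Real.log (u x)))) U :=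
      (continuousOn_const.mul (hinv.pow 2)).mul (hs'.comp_continuousOn hvc)
    have hc3 : ContinuousOn (fun x => ν * (u x)⁻¹ ^ 2 * s (ν * (Real.log c - Real.log (u x)))) U :=
      (continuousOn_const.mul (hinv.pow 2)).mul (hsc.comp_continuousOn hvc)
    have e : (fun x => s (ν * (Real.log c - Real.log (u x))) * fderiv ℝ η x ((-(ν * (u x)⁻¹)) • F x) +
        η x * s' (ν * (Real.log c - Real.log (u x))) *
          fderiv ℝ (fun x => ν * (Real.log c - Real.log (u x))) x ((-(ν * (u x)⁻¹)) • F x)) = fun x =>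
        (-(ν * (u x)⁻¹) * s (ν * (Real.log c - Real.log (u x)))) * fderiv ℝ η x (F x) +
        η x * (ν ^ 2 * (u x)⁻¹ ^ 2 * s' (ν * (Real.log c - Real.log (u x)))) * fderiv ℝ u x (F x) := by
      ext x
      by_cases hx : x ∈ tsupport η
      · rw [(hv x (hsU hx)).fderiv]
        simp only [_root_.smul_apply, map_smul, smul_eq_mul]
        ring
      · simp only [image_eq_zero_of_notMem_tsupport hx, map_smul, smul_eq_mul]
        ring
    rw [e]
    have hi1 := h.integrable_mul_fderiv_left hc1 hη hc hsU
    have hi2 := h.integrable_mul_fderiv_right hc2 hη.continuous hc hsU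
    have hi3 := h.integrable_mul_fderiv_right hc3 hη.continuous hc hsU
    refine ⟨hi1.add hi2, ?_⟩
    have hlogc : ContinuousOn (fun t => ν * (Real.log c - Real.log t)) (Ioi 0) :=
      continuousOn_const.mul (continuousOn_const.sub
        (Real.continuousOn_log.mono fun t ht => (mem_Ioi.1 ht).ne'))
    have hinvc : ContinuousOn (fun t : ℝ => t⁻¹ ^ 2) (Ioi 0) :=
      (continuousOn_id.inv₀ fun t ht => (mem_Ioi.1 ht).ne').pow 2
    have htest := h.integral_test (Φ := fun t => -(ν * t⁻¹) * s (ν * (Real.log c - Real.log t)))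
      (Φ' := fun t => ν ^ 2 * t⁻¹ ^ 2 * s' (ν * (Real.log c - Real.log t)) +
        ν * t⁻¹ ^ 2 * s (ν * (Real.log c - Real.log t)))
      (fun t ht => ?_) ?_ hη hc hsU
    · have hsplit : (fun x => (-(ν * (u x)⁻¹) * s (ν * (Real.log c - Real.log (u x)))) * fderiv ℝ η x (F x) +
          η x * (ν ^ 2 * (u x)⁻¹ ^ 2 * s' (ν * (Real.log c - Real.log (u x))) +
          ν * (u x)⁻¹ ^ 2 * s (ν * (Real.log c - Real.log (u x)))) * fderiv ℝ u x (F x)) = fun x =>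
          ((-(ν * (u x)⁻¹) * s (ν * (Real.log c - Real.log (u x)))) * fderiv ℝ η x (F x) +
          η x * (ν ^ 2 * (u x)⁻¹ ^ 2 * s' (ν * (Real.log c - Real.log (u x)))) * fderiv ℝ u x (F x)) +
          η x * (ν * (u x)⁻¹ ^ 2 * s (ν * (Real.log c - Real.log (u x)))) * fderiv ℝ u x (F x) := by
        ext x; ring
      rw [hsplit, integral_add (by exact hi1.add hi2) hi3] at htest
      rw [eq_neg_of_add_eq_zero_left htest, ← integral_neg, ← integral_const_mul]
      have hηs : Continuous fun x => η x * s (ν * (Real.log c - Real.log (u x))) :=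
        continuous_mul_of_tsupport_subset h.isOpen hη.continuous hsU (hsc.comp_continuousOn hvc)
      refine integral_mono hi3.neg ((hηs.integrable_of_hasCompactSupport hc.mul_right).const_mul _)
        fun x => ?_
      by_cases hx : x ∈ tsupport η
      · have h1 := (hlow x (hsU hx)).1
        have h2 : 0 ≤ η x * s (ν * (Real.log c - Real.log (u x))) := mul_nonneg (hη0 x) (hs0 _)
        set y := η x * s (ν * (Real.log c - Real.log (u x))) with hy
        set z := (u x)⁻¹ ^ 2 * fderiv ℝ u x (F x) with hz
        have e3 : -(η x * (ν * (u x)⁻¹ ^ 2 * s (ν * (Real.log c - Real.log (u x)))) * fderiv ℝ u x (F x))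
          = ν * y * (-z) := by rw [hy, hz]; ring
        rw [e3]
        calc ν * y * (-z) ≤ ν * y * (Lam ^ 2 / lam) :=
              mul_le_mul_of_nonneg_left (by linarith) (by positivity)
          _ ≤ 1 * y * (Lam ^ 2 / lam) := by gcongr
          _ ≤ _ := by nlinarith [mul_nonneg hLam h2]
      · simp [image_eq_zero_of_notMem_tsupport hx]
    · have h1 : HasDerivAt (fun t : ℝ => ν * (Real.log c - Real.log t)) (ν * (-t⁻¹)) t := by
        simpa using ((Real.hasDerivAt_log ht.ne').const_sub (Real.log c)).const_mul ν
      have h2 : HasDerivAt (fun t : ℝ => -(ν * t⁻¹)) (-(ν * (-(t ^ 2)⁻¹))) t :=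
        ((hasDerivAt_inv ht.ne').const_mul ν).neg
      refine (h2.mul ((hs _).comp t h1)).congr_deriv ?_
      simp only [inv_pow, Function.comp]
      field_simp
      ring
    · exact ((continuousOn_const.mul hinvc).mul (hs'.comp_continuousOn hlogc)).add
        ((continuousOn_const.mul hinvc).mul (hsc.comp_continuousOn hlogc))

end IsSol

lemma caccioppoli_pointwise {lam Lam η e D nv s s' p Q G T E : ℝ} (hlam : 0 < lam) (hLam : 0 ≤ Lam)
    (hη : 0 ≤ η) (hη1 : η ≤ 1) (hD : 1 ≤ D) (he : e ≤ D) (hnv : 0 ≤ nv) (hs : 0 ≤ s)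
    (hs' : 0 ≤ s') (hs1 : s' ≤ 1) (hsp : s ^ 2 ≤ p ^ 2 * s') (hp : 0 ≤ p) (hpQ : p ≤ Q)
    (hsp' : s ≤ p) (hG0 : 1 ≤ G) (hG : s' ≠ 0 → G ≤ Q) (hT : |T| ≤ e * (Lam * (nv + G)))
    (hE : lam * nv ^ 2 - Lam * G ^ 2 ≤ E) :
    lam / 2 * (η ^ 2 * s' * nv ^ 2) ≤
      (s * (2 * η * T) + η ^ 2 * s' * E) + (2 * Lam ^ 2 / lam + 3 * Lam) * (D ^ 2 * Q ^ 2) ∧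
    η ^ 2 * s ≤ Q ^ 2 := by
  have hQ0 : 0 ≤ Q := hp.trans hpQ
  rcases hs'.eq_or_lt with h0 | hpos
  · have : s = 0 := by rw [← h0, mul_zero] at hsp; nlinarith
    subst this
    rw [← h0]
    have : 0 ≤ (2 * Lam ^ 2 / lam + 3 * Lam) * (D ^ 2 * Q ^ 2) := by positivity
    constructor
    · simpa using this
    · simpa using sq_nonneg Q
  have hGQ := hG hpos.ne'
  have hQ1 : 1 ≤ Q := hG0.trans hGQ
  have hη2 : η ^ 2 ≤ 1 := pow_le_one₀ hη hη1
  constructor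
  · set r := √s' with hr
    have hr2 : r ^ 2 = s' := Real.sq_sqrt hs'
    have hr0 : 0 ≤ r := Real.sqrt_nonneg _
    have hspr : s ≤ p * r := by
      refine abs_le_of_sq_le_sq' ?_ (by positivity) |>.2
      rw [mul_pow, hr2]; exact hsp
    have h1 : -(2 * η * s * (D * (Lam * (nv + Q)))) ≤ s * (2 * η * T) := by
      have h2 : |T| ≤ D * (Lam * (nv + Q)) := hT.trans (by gcongr)
      have h3 := neg_le_of_abs_le h2
      have h4 : 0 ≤ 2 * η * s := by positivity
      nlinarith
    have h2 : 2 * η * s * D * Lam * nv ≤ lam / 2 * (η ^ 2 * s' * nv ^ 2) + 2 * Lam ^ 2 / lam * (D ^ 2 * Q ^ 2) := by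
      have h3 : 2 * η * s * D * Lam * nv ≤ 2 * η * (Q * r) * D * Lam * nv := by
        gcongr; exact hspr.trans (by gcongr)
      have h4 : 0 ≤ 2 / lam * (lam / 2 * (η * r * nv) - Lam * D * Q) ^ 2 := by positivity
      have h5 : 2 / lam * (lam / 2 * (η * r * nv) - Lam * D * Q) ^ 2 =
        lam / 2 * (η ^ 2 * r ^ 2 * nv ^ 2) + 2 * Lam ^ 2 / lam * (D ^ 2 * Q ^ 2)
          - 2 * η * (Q * r) * D * Lam * nv := by field_simp; ring
      rw [hr2] at h5
      linarith
    have h3 : 2 * η * s * D * Lam * Q ≤ 2 * Lam * (D ^ 2 * Q ^ 2) := by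
      have : 2 * η * s * D * Lam * Q ≤ 2 * 1 * Q * D * Lam * Q := by
        gcongr; exact hsp'.trans hpQ
      have h4 : D * 1 ≤ D * D := by gcongr
      nlinarith [mul_nonneg hLam (sq_nonneg Q)]
    have h4 : η ^ 2 * s' * lam * nv ^ 2 - Lam * (D ^ 2 * Q ^ 2) ≤ η ^ 2 * s' * E := by
      have h5 : η ^ 2 * s' * (lam * nv ^ 2 - Lam * G ^ 2) ≤ η ^ 2 * s' * E := by gcongr
      have h6 : η ^ 2 * s' * (Lam * G ^ 2) ≤ 1 * 1 * (Lam * (D ^ 2 * Q ^ 2)) := by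
        have : G ^ 2 ≤ D ^ 2 * Q ^ 2 := by
          rw [← mul_pow]; gcongr; nlinarith
        gcongr
      linarith
    linarith
  · calc η ^ 2 * s ≤ 1 * Q := by gcongr; exact hsp'.trans hpQ
      _ ≤ Q ^ 2 := by nlinarith

lemma iteration_decay {C : ℝ} (hC : 0 < C) (hn : 1 ≤ n) : ∃ δ q : ℝ, 0 < δ ∧ 0 < q ∧ q < 1 ∧
    ∀ A : ℕ → ℝ, (∀ j, 0 ≤ A j) → A 0 ≤ δ →
    (∀ j, A (j + 1) ≤ C * (64 * 16 ^ j * A j) ^ (1 + 1 / (n : ℝ))) → ∀ j, A j ≤ δ * q ^ j := by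
  have hn0 : n ≠ 0 := by omega
  set q : ℝ := (1 / 16) ^ (2 * n) with hq
  have hq0 : 0 < q := by positivity
  have hq1 : q < 1 := pow_lt_one₀ (by norm_num) (by norm_num) (by omega)
  have hq16 : 16 * q ≤ (1 / 16) ^ n := by
    rw [hq, two_mul, pow_add]
    have : ((1 : ℝ) / 16) ^ n ≤ (1 / 16) ^ 1 := pow_le_pow_of_le_one (by norm_num) (by norm_num) hn
    have h2 : (0 : ℝ) < (1 / 16) ^ n := by positivity
    nlinarith
  set δ : ℝ := (q / (64 * C)) ^ n / 64 with hδ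
  have hδ0 : 0 < δ := by positivity
  refine ⟨δ, q, hδ0, hq0, hq1, fun A hA h0 hstep j => ?_⟩
  induction j with
  | zero => simpa using h0
  | succ j ih =>
    have h1 : 64 * 16 ^ j * A j ≤ ((q / (64 * C)) * (1 / 16) ^ j) ^ n := by
      calc 64 * 16 ^ j * A j ≤ 64 * 16 ^ j * (δ * q ^ j) := by gcongr
        _ = (q / (64 * C)) ^ n * (16 * q) ^ j := by rw [hδ, mul_pow]; ring
        _ ≤ (q / (64 * C)) ^ n * ((1 / 16) ^ n) ^ j := by gcongr
        _ = _ := by rw [mul_pow, ← pow_mul, ← pow_mul, mul_comm n j]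
    have h2 : (64 * 16 ^ j * A j) ^ (1 / (n : ℝ)) ≤ (q / (64 * C)) * (1 / 16) ^ j := by
      have h0 := hA j
      calc _ ≤ (((q / (64 * C)) * (1 / 16) ^ j) ^ n) ^ (1 / (n : ℝ)) := by gcongr
        _ = _ := by rw [one_div (n : ℝ), Real.pow_rpow_inv_natCast (by positivity) hn0]
    have hx : 0 ≤ 64 * 16 ^ j * A j := by have := hA j; positivity
    calc A (j + 1) ≤ C * (64 * 16 ^ j * A j) ^ (1 + 1 / (n : ℝ)) := hstep j
      _ = C * ((64 * 16 ^ j * A j) * (64 * 16 ^ j * A j) ^ (1 / (n : ℝ))) := by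
        rw [Real.rpow_add_of_nonneg hx zero_le_one (by positivity), Real.rpow_one]
      _ ≤ C * ((64 * 16 ^ j * A j) * ((q / (64 * C)) * (1 / 16) ^ j)) := by gcongr
      _ = q * A j * (16 * (1 / 16)) ^ j := by rw [mul_pow]; field_simp
      _ = q * A j := by norm_num
      _ ≤ q * (δ * q ^ j) := by gcongr
      _ = _ := by ring

namespace IsSub

variable {lam Lam : ℝ} {U : Set (EuclideanSpace ℝ (Fin n))} {v : EuclideanSpace ℝ (Fin n) → ℝ}
  {H : EuclideanSpace ℝ (Fin n) → EuclideanSpace ℝ (Fin n)}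

lemma continuousOn (h : IsSub lam Lam U v H) : ContinuousOn v U := fun x hx =>
  (h.diff x hx).continuousAt.continuousWithinAt

lemma integrableOn_sq_posPart (h : IsSub lam Lam U v H) {x₀ : 𝔼} {R : ℝ} (hR : closedBall x₀ R ⊆ U)
    (k : ℝ) : IntegrableOn (fun x => max (v x - k) 0 ^ 2) (closedBall x₀ R) := by
  have : ContinuousOn (fun x => max (v x - k) 0 ^ 2) (closedBall x₀ R) :=
    (((h.continuousOn.mono hR).sub continuousOn_const).sup continuousOn_const).pow 2
  exact this.integrableOn_compact (isCompact_closedBall _ _)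

/-- Caccioppoli's inequality for truncations. -/
lemma caccioppoli (h : IsSub lam Lam U v H) (hlam : 0 < lam) (hLam : 0 ≤ Lam) {x₀ : 𝔼}
    {R D k d : ℝ} (hD : 1 ≤ D) (hd : 0 < d) (hd1 : d ≤ 1) (hk : 0 ≤ k) (hk1 : k ≤ 1)
    (hRU : closedBall x₀ R ⊆ U) {η : 𝔼 → ℝ}
    (hη : ContDiff ℝ (⊤ : ℕ∞) η) (hc : HasCompactSupport η) (hs : tsupport η ⊆ closedBall x₀ R)
    (h0 : ∀ x, 0 ≤ η x) (h1 : ∀ x, η x ≤ 1) (hηD : ∀ x, ‖fderiv ℝ η x‖ ≤ D) :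
    Integrable (fun x => η x ^ 2 * softPosDeriv (d / 2) (v x - (k + d / 2)) * ‖fderiv ℝ v x‖ ^ 2) ∧
    ∫ x, η x ^ 2 * softPosDeriv (d / 2) (v x - (k + d / 2)) * ‖fderiv ℝ v x‖ ^ 2 ≤
      2 / lam * (2 * Lam ^ 2 / lam + 4 * Lam) * 25 * (D ^ 2 / d ^ 2 *
        ∫ x in closedBall x₀ R, max (v x - k) 0 ^ 2) := by
  set δ := d / 2 with hδ
  have hδ0 : 0 < δ := by positivity
  set m := k + δ with hm
  set C := 2 * Lam ^ 2 / lam + 3 * Lam with hC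
  have hη2 : ContDiff ℝ (⊤ : ℕ∞) (fun x => η x ^ 2) := hη.pow 2
  have hc2 := hasCompactSupport_sq hc
  have hsU := hs.trans hRU
  have hs2 := (tsupport_sq_subset η).trans hsU
  obtain ⟨hPi, hPle⟩ := h.test (fun t => softPos δ (t - m)) (fun t => softPosDeriv δ (t - m))
    (fun t => by simpa using (hasDerivAt_softPos hδ0 (t - m)).comp_sub_const t m)
    ((continuous_softPosDeriv hδ0).comp (continuous_sub_right m)) (fun t => softPos_nonneg _) _ hη2 hc2 hs2
    (fun x => sq_nonneg _)
  set P : 𝔼 → ℝ := fun x => softPos δ (v x - m) * fderiv ℝ (fun x => η x ^ 2) x (H x) +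
    η x ^ 2 * softPosDeriv δ (v x - m) * fderiv ℝ v x (H x) with hP
  set J : 𝔼 → ℝ := (closedBall x₀ R).indicator fun x => max (v x - k) 0 ^ 2 with hJ
  have hJ0 : ∀ x, 0 ≤ J x := fun x => indicator_nonneg (fun x _ => sq_nonneg _) x
  have hJi : Integrable J := (integrable_indicator_iff measurableSet_closedBall).2
    (h.integrableOn_sq_posPart hRU k)
  have hJA : ∫ x, J x = ∫ x in closedBall x₀ R, max (v x - k) 0 ^ 2 :=
    integral_indicator measurableSet_closedBall
  rw [← hJA]
  have hpt : ∀ x, lam / 2 * (η x ^ 2 * softPosDeriv δ (v x - m) * ‖fderiv ℝ v x‖ ^ 2) ≤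
      P x + C * (25 * (D ^ 2 / d ^ 2)) * J x ∧ η x ^ 2 * softPos δ (v x - m) ≤ 25 / d ^ 2 * J x := by
    intro x
    by_cases hx : x ∈ tsupport η
    · have hxU := hsU hx
      have hpa : max (v x - m) 0 ≤ max (v x - k) 0 := by gcongr; linarith
      have ha : 0 ≤ max (v x - k) 0 := le_max_right _ _
      have hd5 : 1 ≤ 5 / d := by rw [le_div_iff₀ hd]; linarith
      have key := caccioppoli_pointwise (e := ‖fderiv ℝ η x‖) (D := D) (nv := ‖fderiv ℝ v x‖) (η := η x)
        (s := softPos δ (v x - m)) (s' := softPosDeriv δ (v x - m)) (p := max (v x - m) 0)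
        (Q := 5 / d * max (v x - k) 0) (G := 1 + max (v x) 0) (T := fderiv ℝ η x (H x))
        (E := fderiv ℝ v x (H x)) hlam hLam (h0 x) (h1 x) hD (hηD x) (norm_nonneg _) (softPos_nonneg _)
        (softPosDeriv_nonneg hδ0 _) (softPosDeriv_le_one hδ0 _) (sq_softPos_le hδ0 _)
        (le_max_right _ _) (hpa.trans (le_mul_of_one_le_left ha hd5)) (softPos_le hδ0 _)
        (by linarith [le_max_right (v x) 0]) ?_
        ((ContinuousLinearMap.le_opNorm (fderiv ℝ η x) (H x)).trans
          (mul_le_mul_of_nonneg_left (h.growth x hxU) (norm_nonneg _))) (h.ell x hxU)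
      · rw [← fderiv_sq_apply (hη.differentiable (by simp) x)] at key
        have hJx : J x = max (v x - k) 0 ^ 2 := indicator_of_mem (hs hx) _
        rw [hJx]
        refine ⟨key.1.trans_eq ?_, key.2.trans_eq ?_⟩
        · simp only [hP]; ring
        · ring
      · intro hne
        have hpos : 0 < v x - m := by
          by_contra hcon
          exact hne (by rw [softPosDeriv, max_eq_right (not_lt.1 hcon), zero_div])
        have e1 : max (v x) 0 = v x := max_eq_left (by linarith)
        have e2 : max (v x - k) 0 = v x - k := max_eq_left (by linarith)
        rw [e1, e2, div_mul_eq_mul_div, le_div_iff₀ hd]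
        have : δ < v x - k := by linarith
        nlinarith
    · have h1 : fderiv ℝ η x = 0 :=
        image_eq_zero_of_notMem_tsupport fun h => hx (tsupport_fderiv_subset ℝ h)
      have h2 : fderiv ℝ (fun x => η x ^ 2) x (H x) = 0 := by
        rw [fderiv_sq_apply (hη.differentiable (by simp) x), h1, zero_apply, mul_zero]
      have h3 := hJ0 x
      simp only [hP, h2, image_eq_zero_of_notMem_tsupport hx]
      have hC0 : 0 ≤ C := by positivity
      constructor
      · simp; positivity
      · simp; positivity
  have hPJ : Integrable fun x => 2 / lam * (P x + C * (25 * (D ^ 2 / d ^ 2)) * J x) :=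
    (hPi.add (hJi.const_mul _)).const_mul _
  have hle : ∀ x, η x ^ 2 * softPosDeriv δ (v x - m) * ‖fderiv ℝ v x‖ ^ 2 ≤
      2 / lam * (P x + C * (25 * (D ^ 2 / d ^ 2)) * J x) := fun x => by
    rw [div_mul_eq_mul_div, le_div_iff₀ hlam]
    linarith [(hpt x).1]
  have hnn : ∀ x, 0 ≤ η x ^ 2 * softPosDeriv δ (v x - m) * ‖fderiv ℝ v x‖ ^ 2 := fun x => by
    have := softPosDeriv_nonneg hδ0 (v x - m); positivity
  have hmeas : Measurable fun x => η x ^ 2 * softPosDeriv δ (v x - m) * ‖fderiv ℝ v x‖ ^ 2 := by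
    have := measurable_mul_of_tsupport_subset h.isOpen hη2.continuous hs2
      ((continuous_softPosDeriv hδ0).comp_continuousOn (h.continuousOn.sub (continuousOn_const (c := m))))
      (u := v) 2
    convert! this using 2 with x
    simp only [Function.comp, Pi.sub_apply]
    ring
  refine ⟨integrable_of_le_of_measurable hmeas.aestronglyMeasurable hnn hPJ hle, ?_⟩
  refine (integral_mono_of_nonneg (Eventually.of_forall hnn) hPJ (Eventually.of_forall hle)).trans ?_
  rw [integral_const_mul, integral_add hPi (hJi.const_mul _), integral_const_mul]
  have h5 : ∫ x, η x ^ 2 * softPos δ (v x - m) ≤ 25 / d ^ 2 * ∫ x, J x := by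
    rw [← integral_const_mul]
    exact integral_mono_of_nonneg (Eventually.of_forall fun x => mul_nonneg (sq_nonneg _)
      (softPos_nonneg _)) (hJi.const_mul _) (Eventually.of_forall fun x => (hpt x).2)
  have hJI : 0 ≤ ∫ x, J x := integral_nonneg hJ0
  have h6 : 25 / d ^ 2 * ∫ x, J x ≤ 25 * (D ^ 2 / d ^ 2) * ∫ x, J x := by
    rw [← mul_div_assoc]
    gcongr
    nlinarith
  have h7 : ∫ x, P x ≤ Lam * (25 * (D ^ 2 / d ^ 2) * ∫ x, J x) :=
    hPle.trans (mul_le_mul_of_nonneg_left (h5.trans h6) hLam)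
  calc _ ≤ 2 / lam * (Lam * (25 * (D ^ 2 / d ^ 2) * ∫ x, J x) + C * (25 * (D ^ 2 / d ^ 2)) * ∫ x, J x) := by
        gcongr
    _ = _ := by rw [hC]; ring

end IsSub

set_option maxHeartbeats 1000000 in
lemma deGiorgi_step (hn : 2 ≤ n) {lam Lam : ℝ} (hlam : 0 < lam) (hLam : 0 ≤ Lam) :
    ∃ C : ℝ, 0 < C ∧ ∀ (U : Set 𝔼) (v : 𝔼 → ℝ) (H : 𝔼 → 𝔼), IsSub lam Lam U v H →
    ∀ (x₀ : 𝔼) (r R k l : ℝ), 0 < r → r < R → R - r ≤ 1 → 0 ≤ k → k < l → l ≤ 1 →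
    closedBall x₀ R ⊆ U →
    ∫ x in closedBall x₀ r, max (v x - l) 0 ^ 2 ≤
      C * ((∫ x in closedBall x₀ R, max (v x - k) 0 ^ 2) / ((R - r) * (l - k)) ^ 2) ^ (1 + 1 / (n : ℝ)) := by
  obtain ⟨CS, hCS, hsob⟩ := exists_sobolev_const hn
  obtain ⟨C0, hC0, hcut⟩ := exists_cutoff (n := n)
  set C2 := 2 / lam * (2 * Lam ^ 2 / lam + 4 * Lam) * 25 * C0 ^ 2 with hC2
  have hC20 : 0 ≤ C2 := by positivity
  refine ⟨CS * (3 * C0 + 2 * C2), by positivity, fun U v H h x₀ r R k l hr hrR hRr hk hkl hl hRU => ?_⟩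
  obtain ⟨η, hη, h0, h1, hη1, -, hs, hc, hηD⟩ := hcut x₀ r R hr hrR
  set ρ := R - r with hρ
  have hρ0 : 0 < ρ := sub_pos.2 hrR
  set d := l - k with hd
  have hd0 : 0 < d := sub_pos.2 hkl
  have hd1 : d ≤ 1 := by linarith
  set D := C0 / ρ with hDdef
  have hD : 1 ≤ D := by rw [hDdef, le_div_iff₀ hρ0]; linarith
  set A := ∫ x in closedBall x₀ R, max (v x - k) 0 ^ 2 with hA
  have hA0 : 0 ≤ A := integral_nonneg fun x => sq_nonneg _
  set α := A / (ρ * d) ^ 2 with hα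
  have hα0 : 0 ≤ α := by positivity
  obtain ⟨hYi, hY⟩ := h.caccioppoli hlam hLam hD hd0 hd1 hk (hkl.le.trans hl) hRU hη hc hs h0 h1 hηD
  set Y : 𝔼 → ℝ := fun x => η x ^ 2 * softPosDeriv (d / 2) (v x - (k + d / 2)) * ‖fderiv ℝ v x‖ ^ 2
    with hYdef
  have hY0 : ∀ x, 0 ≤ Y x := fun x => by
    have := softPosDeriv_nonneg (half_pos hd0) (v x - (k + d / 2)); positivity
  have hY2 : ∫ x, Y x ≤ C2 * α := hY.trans_eq (by rw [← hA, hC2, hα, hDdef]; field_simp)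
  set J : 𝔼 → ℝ := (closedBall x₀ R).indicator fun x => max (v x - k) 0 ^ 2 with hJ
  have hJ0 : ∀ x, 0 ≤ J x := fun x => indicator_nonneg (fun x _ => sq_nonneg _) x
  have hJi : Integrable J := (integrable_indicator_iff measurableSet_closedBall).2
    (h.integrableOn_sq_posPart hRU k)
  have hJA : ∫ x, J x = A := integral_indicator measurableSet_closedBall
  set b : 𝔼 → ℝ := fun x => max (v x - l) 0 ^ 2 with hb
  set f : 𝔼 → ℝ := fun x => η x ^ 2 * b x with hf
  have hf0 : ∀ x, 0 ≤ f x := fun x => by positivity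
  have hsU := hs.trans hRU
  have hfd : ∀ x, HasFDerivAt f (η x ^ 2 • ((2 * max (v x - l) 0) • fderiv ℝ v x) +
      b x • ((2 * η x) • fderiv ℝ η x)) x := by
    intro x
    by_cases hx : x ∈ tsupport η
    · have h1 : HasFDerivAt (fun x => η x ^ 2) ((2 * η x) • fderiv ℝ η x) x := by
        simpa using (hη.differentiable (by simp) x).hasFDerivAt.pow 2
      have h2 : HasFDerivAt b ((2 * max (v x - l) 0) • fderiv ℝ v x) x :=
        HasDerivAt.comp_hasFDerivAt (h₂ := fun t => max t 0 ^ 2) (f := fun x => v x - l) x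
          (hasDerivAt_sq_posPart (v x - l)) ((h.diff x (hsU hx)).hasFDerivAt.sub_const l)
      exact h1.mul h2
    · have h1 : fderiv ℝ η x = 0 :=
        image_eq_zero_of_notMem_tsupport fun h => hx (tsupport_fderiv_subset ℝ h)
      rw [h1, image_eq_zero_of_notMem_tsupport hx]
      have : f =ᶠ[𝓝 x] fun _ => 0 := by
        filter_upwards [(isClosed_tsupport η).isOpen_compl.mem_nhds hx] with z hz
        simp [hf, image_eq_zero_of_notMem_tsupport hz]
      refine (HasFDerivAt.congr_of_eventuallyEq (hasFDerivAt_const 0 x) this).congr_fderiv ?_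
      ext; simp
  have hfb : ∀ x, ‖fderiv ℝ f x‖ ≤ 3 * D * J x + 2 * Y x := by
    intro x
    rw [(hfd x).fderiv]
    by_cases hx : x ∈ tsupport η
    · have hJx : J x = max (v x - k) 0 ^ 2 := indicator_of_mem (hs hx) _
      have hbJ : b x ≤ J x := by
        rw [hJx]; simp only [hb]
        have : max (v x - l) 0 ≤ max (v x - k) 0 := by gcongr
        have h0 : 0 ≤ max (v x - l) 0 := le_max_right _ _
        gcongr
      have hb0 : 0 ≤ b x := sq_nonneg _
      have e1 : ‖b x • ((2 * η x) • fderiv ℝ η x)‖ ≤ 2 * D * J x := by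
        rw [norm_smul, norm_smul, Real.norm_of_nonneg hb0, Real.norm_of_nonneg (by have := h0 x; positivity)]
        have := h0 x
        calc b x * (2 * η x * ‖fderiv ℝ η x‖) ≤ J x * (2 * 1 * D) := by
              gcongr
              · exact hJ0 x
              · exact h1 x
              · exact hηD x
          _ = _ := by ring
      have e2 : ‖η x ^ 2 • ((2 * max (v x - l) 0) • fderiv ℝ v x)‖ ≤ D * J x + 2 * Y x := by
        have hm0 : 0 ≤ max (v x - l) 0 := le_max_right _ _
        rw [norm_smul, norm_smul, Real.norm_of_nonneg (by positivity), Real.norm_of_nonneg (by positivity)]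
        rcases le_or_gt (v x - l) 0 with hv | hv
        · rw [max_eq_right hv]
          have := hJ0 x; have := hY0 x
          simp; positivity
        · have hsd : 1 / 2 ≤ softPosDeriv (d / 2) (v x - (k + d / 2)) :=
            half_le_softPosDeriv (half_pos hd0) _ (by linarith)
          have hη2 : η x ^ 2 ≤ 1 := pow_le_one₀ (h0 x) (h1 x)
          have h2 : η x ^ 2 * ‖fderiv ℝ v x‖ ^ 2 ≤ 2 * Y x := by
            have := mul_le_mul_of_nonneg_left hsd (show 0 ≤ η x ^ 2 * ‖fderiv ℝ v x‖ ^ 2 by positivity)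
            simp only [hYdef]; linarith
          have h3 : η x ^ 2 * (2 * max (v x - l) 0 * ‖fderiv ℝ v x‖) ≤
              η x ^ 2 * (b x + ‖fderiv ℝ v x‖ ^ 2) := by
            gcongr; simp only [hb]; nlinarith [sq_nonneg (max (v x - l) 0 - ‖fderiv ℝ v x‖)]
          have h4 : η x ^ 2 * b x ≤ D * J x := mul_le_mul (hη2.trans hD) hbJ hb0 (by linarith)
          linarith
      exact (norm_add_le _ _).trans (by linarith)
    · have h1 : fderiv ℝ η x = 0 :=
        image_eq_zero_of_notMem_tsupport fun h => hx (tsupport_fderiv_subset ℝ h)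
      rw [h1, image_eq_zero_of_notMem_tsupport hx]
      have := hJ0 x; have := hY0 x
      simp; positivity
  have hdom : Integrable fun x => 3 * D * J x + 2 * Y x := (hJi.const_mul _).add (hYi.const_mul _)
  have hfi : Integrable (fderiv ℝ f) :=
    hdom.mono' (measurable_fderiv ℝ f).aestronglyMeasurable (Eventually.of_forall hfb)
  have hfc : HasCompactSupport f := hc.mono fun x hx hx' => hx (by simp [hf, hx'])
  have hS := hsob f (fun x => (hfd x).differentiableAt) hfc hfi
  have hgrad : ∫ x, ‖fderiv ℝ f x‖ ≤ (3 * C0 + 2 * C2) * α := by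
    refine (integral_mono hfi.norm hdom hfb).trans ?_
    rw [integral_add (hJi.const_mul _) (hYi.const_mul _), integral_const_mul, integral_const_mul, hJA]
    have : D * A ≤ C0 * α := by
      rw [hDdef, hα, div_mul_eq_mul_div, mul_div_assoc]
      have : (ρ * d) ^ 2 ≤ ρ := by
        have h1 : d ^ 2 ≤ 1 := pow_le_one₀ hd0.le hd1
        calc (ρ * d) ^ 2 = ρ * ρ * d ^ 2 := by ring
          _ ≤ ρ * 1 * 1 := by gcongr
          _ = ρ := by ring
      gcongr
    linarith
  have hsupp : volume.real (Function.support f) ≤ α := by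
    have h1 : volume.real (Function.support f) ≤ volume.real {x | d ^ 2 ≤ J x} := by
      refine measureReal_mono ?_ ?_
      · intro x hx
        have hη0 : η x ≠ 0 := fun h => hx (by simp [hf, h])
        have hxR : x ∈ closedBall x₀ R := hs (subset_tsupport _ hη0)
        have hv : 0 < v x - l := by
          by_contra hcon
          exact hx (by simp [hf, hb, max_eq_right (not_lt.1 hcon)])
        rw [mem_ofPred_eq, hJ, indicator_of_mem hxR, max_eq_left (by linarith)]
        gcongr; linarith
      · exact (hJi.measure_ge_lt_top (by positivity)).ne
    have h2 := mul_meas_ge_le_integral_of_nonneg (Eventually.of_forall hJ0) hJi (d ^ 2)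
    rw [hJA] at h2
    have h3 : volume.real (Function.support f) ≤ A / d ^ 2 := by
      rw [le_div_iff₀ (by positivity)]
      calc _ ≤ volume.real {x | d ^ 2 ≤ J x} * d ^ 2 := by gcongr
        _ ≤ A := by rw [mul_comm]; exact h2
    refine h3.trans ?_
    rw [hα, mul_pow]
    have : ρ ^ 2 ≤ 1 := pow_le_one₀ hρ0.le hRr
    have h4 : ρ ^ 2 * d ^ 2 ≤ 1 * d ^ 2 := by gcongr
    rw [one_mul] at h4
    gcongr
  have hfint : Integrable f :=
    (continuous_iff_continuousAt.2 fun x => (hfd x).continuousAt).integrable_of_hasCompactSupport hfc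
  calc ∫ x in closedBall x₀ r, max (v x - l) 0 ^ 2 = ∫ x in closedBall x₀ r, ‖f x‖ := by
        refine setIntegral_congr_fun measurableSet_closedBall fun x hx => ?_
        rw [Real.norm_of_nonneg (hf0 x)]; simp only [hf, hb, hη1 x hx]; ring
    _ ≤ ∫ x, ‖f x‖ := setIntegral_le_integral hfint.norm (Eventually.of_forall fun x => norm_nonneg _)
    _ ≤ CS * volume.real (Function.support f) ^ (1 / (n : ℝ)) * ∫ x, ‖fderiv ℝ f x‖ := hS
    _ ≤ CS * α ^ (1 / (n : ℝ)) * ((3 * C0 + 2 * C2) * α) := by gcongr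
    _ = _ := by
      rw [Real.rpow_add_of_nonneg hα0 zero_le_one (by positivity), Real.rpow_one]; ring

/-- De Giorgi's local boundedness theorem. -/
lemma exists_deGiorgi_const (hn : 2 ≤ n) {lam Lam : ℝ} (hlam : 0 < lam) (hLam : 0 ≤ Lam) :
    ∃ δ : ℝ, 0 < δ ∧ ∀ (U : Set 𝔼) (v : 𝔼 → ℝ) (H : 𝔼 → 𝔼), IsSub lam Lam U v H →
    ∀ x₀ : 𝔼, closedBall x₀ 1 ⊆ U → ∫ x in closedBall x₀ 1, max (v x) 0 ^ 2 ≤ δ → v x₀ ≤ 1 := by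
  obtain ⟨C, hC, hstep⟩ := deGiorgi_step hn hlam hLam
  obtain ⟨δ, q, hδ, hq, hq1, hiter⟩ := iteration_decay (n := n) hC (by omega)
  refine ⟨δ, hδ, fun U v H h x₀ hU hle => ?_⟩
  set t : ℕ → ℝ := fun j => (1 / 2) ^ j with ht
  have ht0 : ∀ j, 0 < t j := fun j => by positivity
  have hts : ∀ j, t (j + 1) = t j / 2 := fun j => by simp only [ht, pow_succ]; ring
  have ht1 : ∀ j, t j ≤ 1 := fun j => pow_le_one₀ (by norm_num) (by norm_num)
  set A : ℕ → ℝ := fun j => ∫ x in closedBall x₀ (1 / 2 + t j / 2), max (v x - (1 - t j)) 0 ^ 2 with hA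
  have hAq : ∀ j, A j ≤ δ * q ^ j := by
    refine hiter A (fun j => integral_nonneg fun x => sq_nonneg _) ?_ fun j => ?_
    · refine Eq.trans_le ?_ hle
      simp only [hA, ht, pow_zero]; norm_num
    · have := hstep U v H h x₀ (1 / 2 + t (j + 1) / 2) (1 / 2 + t j / 2) (1 - t j) (1 - t (j + 1))
        (by linarith [ht0 (j + 1)]) (by rw [hts]; linarith [ht0 j]) (by rw [hts]; linarith [ht1 j, ht0 j])
        (by linarith [ht1 j]) (by rw [hts]; linarith [ht0 j]) (by linarith [ht0 (j + 1)])
        ((closedBall_subset_closedBall (by linarith [ht1 j])).trans hU)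
      refine this.trans_eq ?_
      congr 2
      have e : (1 / 2 + t j / 2 - (1 / 2 + t (j + 1) / 2)) * (1 - t (j + 1) - (1 - t j)) = t j ^ 2 / 8 := by
        rw [hts]; ring
      rw [e]
      have h16 : (16 : ℝ) ^ j * t j ^ 4 = 1 := by
        simp only [ht]; rw [← pow_mul, mul_comm j 4, pow_mul, ← mul_pow]; norm_num
      rw [div_eq_iff (by have := ht0 j; positivity)]
      simp only [hA]
      linear_combination (-(∫ x in closedBall x₀ (1 / 2 + t j / 2), max (v x - (1 - t j)) 0 ^ 2)) * h16
  have hUh : closedBall x₀ (1 / 2) ⊆ U := (closedBall_subset_closedBall (by norm_num)).trans hU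
  have hint : ∀ k, IntegrableOn (fun x => max (v x - k) 0 ^ 2) (closedBall x₀ (1 / 2)) := fun k =>
    h.integrableOn_sq_posPart hUh k
  have hzero : ∫ x in closedBall x₀ (1 / 2), max (v x - 1) 0 ^ 2 = 0 := by
    refine le_antisymm ?_ (integral_nonneg fun x => sq_nonneg _)
    have hlim : Tendsto (fun j : ℕ => δ * q ^ j) atTop (𝓝 (δ * 0)) :=
      (tendsto_pow_atTop_nhds_zero_of_lt_one hq.le hq1).const_mul δ
    rw [mul_zero] at hlim
    refine ge_of_tendsto' hlim fun j => ?_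
    refine le_trans ?_ (hAq j)
    calc _ ≤ ∫ x in closedBall x₀ (1 / 2), max (v x - (1 - t j)) 0 ^ 2 := by
          refine integral_mono (hint 1) (hint _) fun x => ?_
          have h0 : 0 ≤ max (v x - 1) 0 := le_max_right _ _
          have := ht0 j
          simp only
          gcongr; linarith
      _ ≤ _ := by
          refine setIntegral_mono_set ?_ (ae_of_all _ fun x => sq_nonneg _) ?_
          · exact h.integrableOn_sq_posPart ((closedBall_subset_closedBall (by linarith [ht1 j])).trans hU) _
          · exact (closedBall_subset_closedBall (by linarith [ht0 j])).eventuallyLE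
  by_contra! hcon
  rw [setIntegral_eq_zero_iff_of_nonneg_ae (ae_of_all _ fun x => sq_nonneg _) (hint 1)] at hzero
  have hcont : ContinuousOn v (ball x₀ (1 / 2)) := h.continuousOn.mono (ball_subset_closedBall.trans hUh)
  have hopen : IsOpen (ball x₀ (1 / 2) ∩ v ⁻¹' Ioi 1) := hcont.isOpen_inter_preimage isOpen_ball isOpen_Ioi
  have hpos : 0 < volume (ball x₀ (1 / 2) ∩ v ⁻¹' Ioi 1) :=
    hopen.measure_pos _ ⟨x₀, mem_ball_self (by norm_num), hcon⟩
  have hnull : volume (ball x₀ (1 / 2) ∩ v ⁻¹' Ioi 1) = 0 := by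
    have h2 := (ae_restrict_iff' measurableSet_closedBall).1 hzero
    refine measure_mono_null ?_ h2
    rintro x ⟨hx, hv⟩ hx'
    have h3 := hx' (ball_subset_closedBall hx)
    have h4 : (1 : ℝ) < v x := hv
    simp only [Pi.zero_apply] at h3
    rw [max_eq_left (by linarith)] at h3
    nlinarith
  exact hpos.ne' hnull

lemma volume_closedBall_eq_ofReal (x : 𝔼) (r : ℝ) :
    volume (closedBall x r) = ENNReal.ofReal (volume.real (closedBall (0 : 𝔼) r)) := by
  rw [Measure.real, ENNReal.ofReal_toReal measure_closedBall_lt_top.ne,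
    Measure.addHaar_closedBall_center]

lemma volume_real_closedBall (x : 𝔼) (r : ℝ) :
    volume.real (closedBall x r) = volume.real (closedBall (0 : 𝔼) r) := by
  rw [Measure.real, Measure.addHaar_closedBall_center, Measure.real]

/-- The logarithmic gradient estimate on balls. -/
lemma exists_log_gradient_const {lam Lam : ℝ} (hlam : 0 < lam) (hLam : 0 ≤ Lam) :
    ∃ C : ℝ, 0 ≤ C ∧ ∀ (U : Set 𝔼) (u : 𝔼 → ℝ) (F : 𝔼 → 𝔼), IsSol lam Lam U u F →
    ∀ x : 𝔼, closedBall x 3 ⊆ U →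
    ∫⁻ z in ball x 2, ENNReal.ofReal ((‖fderiv ℝ u z‖ / u z) ^ 2) ≤ ENNReal.ofReal C := by
  obtain ⟨C0, hC0, hcut⟩ := exists_cutoff (n := n)
  set CL := 2 / lam * (4 * Lam ^ 2 / lam + Lam) with hCL
  have hCL0 : 0 ≤ CL := by positivity
  refine ⟨CL * (volume.real (closedBall (0 : 𝔼) 3) * (1 + C0 ^ 2)), by positivity,
    fun U u F h x hU => ?_⟩
  obtain ⟨η, hη, h0, h1, hη1, hη0, hs, hc, hηD⟩ := hcut x 2 3 (by norm_num) (by norm_num)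
  obtain ⟨hi, hle⟩ := h.log_estimate hlam hLam hη hc (hs.trans hU) h0
  have hE : ∫ z, (η z ^ 2 + ‖fderiv ℝ η z‖ ^ 2) ≤ volume.real (closedBall (0 : 𝔼) 3) * (1 + C0 ^ 2) := by
    have hcon : IntegrableOn (fun _ : 𝔼 => 1 + C0 ^ 2) (closedBall x 3) :=
      integrableOn_const measure_closedBall_lt_top.ne
    calc _ ≤ ∫ z, (closedBall x 3).indicator (fun _ => 1 + C0 ^ 2) z := by
          refine integral_mono_of_nonneg (ae_of_all _ fun z => by positivity)
            ((integrable_indicator_iff measurableSet_closedBall).2 hcon) (ae_of_all _ fun z => ?_)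
          by_cases hz : z ∈ closedBall x 3
          · rw [indicator_of_mem hz]
            have e1 : η z ^ 2 ≤ 1 := pow_le_one₀ (h0 z) (h1 z)
            have e2 : ‖fderiv ℝ η z‖ ≤ C0 := (hηD z).trans_eq (by norm_num)
            simp only
            gcongr
          · rw [indicator_of_notMem hz]
            have e1 : fderiv ℝ η z = 0 :=
              image_eq_zero_of_notMem_tsupport fun h => hz (hs (tsupport_fderiv_subset ℝ h))
            simp [e1, hη0 z hz]
      _ = _ := by
          rw [integral_indicator measurableSet_closedBall, setIntegral_const, volume_real_closedBall,
            smul_eq_mul]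
  calc _ = ∫⁻ z in ball x 2, ENNReal.ofReal (η z ^ 2 * (‖fderiv ℝ u z‖ / u z) ^ 2) := by
        refine setLIntegral_congr_fun measurableSet_ball fun z hz => ?_
        simp only [hη1 z (ball_subset_closedBall hz), one_pow, one_mul]
    _ ≤ ∫⁻ z, ENNReal.ofReal (η z ^ 2 * (‖fderiv ℝ u z‖ / u z) ^ 2) := setLIntegral_le_lintegral _ _
    _ = ENNReal.ofReal (∫ z, η z ^ 2 * (‖fderiv ℝ u z‖ / u z) ^ 2) :=
        (ofReal_integral_eq_lintegral_ofReal hi (ae_of_all _ fun z => by positivity)).symm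
    _ ≤ _ := ENNReal.ofReal_le_ofReal (hle.trans (by gcongr))

/-- A positive solution that is large on a set of positive measure is bounded below. -/
lemma exists_growth_const (hn : 2 ≤ n) {lam Lam : ℝ} (hlam : 0 < lam) (hLam : 0 ≤ Lam) {μ : ℝ}
    (hμ : 0 < μ) :
    ∃ κ : ℝ, 0 < κ ∧ κ ≤ 1 ∧ ∀ (U : Set 𝔼) (u : 𝔼 → ℝ) (F : 𝔼 → 𝔼), IsSol lam Lam U u F →
    ∀ x : 𝔼, closedBall x 3 ⊆ U → ∀ c : ℝ, 0 < c →
    μ ≤ volume.real (ball x 2 ∩ {z | c ≤ u z}) → ∀ z ∈ ball x 1, κ * c ≤ u z := by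
  obtain ⟨δ, hδ, hDG⟩ := exists_deGiorgi_const hn (half_pos hlam)
    (show 0 ≤ Lam + Lam ^ 2 / lam by positivity)
  obtain ⟨C1, hC1, hgrad⟩ := exists_log_gradient_const (n := n) hlam hLam
  set V : ℝ → ℝ := fun r => volume.real (closedBall (0 : 𝔼) r) with hV
  have hV0 : ∀ r, 0 ≤ V r := fun r => measureReal_nonneg
  set C2 := 4 ^ 2 * 2 ^ n * V 2 * C1 with hC2
  have hC20 : 0 ≤ C2 := by have := hV0 2; positivity
  set T := 2 * (C2 / μ) + 2 * V 1 with hT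
  have hT0 : 0 ≤ T := by have := hV0 1; positivity
  set N := 1 + T / δ with hN
  have hTδ : 0 ≤ T / δ := by positivity
  have hN1 : 1 ≤ N := by linarith
  have hN0 : 0 < N := by linarith
  have hNT : N⁻¹ ^ 2 * T ≤ δ := by
    rw [inv_pow, inv_mul_le_iff₀ (by positivity)]
    have : T = T / δ * δ := by field_simp
    calc T = T / δ * δ := this
      _ ≤ N ^ 2 * δ := by gcongr; nlinarith
  refine ⟨Real.exp (-N), Real.exp_pos _, Real.exp_le_one_iff.2 (by linarith),
    fun U u F h x hU c hc hZ z hz => ?_⟩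
  have h2U : ball x 2 ⊆ U := (ball_subset_closedBall.trans (closedBall_subset_closedBall (by norm_num))).trans hU
  set w : 𝔼 → ℝ := fun z => Real.log c - Real.log (u z) with hw
  set f : 𝔼 → ℝ := fun z => softPos 1 (w z) with hf
  have hfd : ∀ z ∈ U, HasFDerivAt f (softPosDeriv 1 (w z) • -((u z)⁻¹ • fderiv ℝ u z)) z := fun z hz =>
    HasDerivAt.comp_hasFDerivAt (h₂ := softPos 1) (f := w) z (hasDerivAt_softPos one_pos _)
      (((h.diff z hz).hasFDerivAt.log (h.pos z hz).ne').const_sub _)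
  have hfn : ∀ z ∈ U, ‖fderiv ℝ f z‖ ≤ ‖fderiv ℝ u z‖ / u z := fun z hz => by
    have hp := h.pos z hz
    rw [(hfd z hz).fderiv, norm_smul, norm_neg, norm_smul,
      Real.norm_of_nonneg (softPosDeriv_nonneg one_pos _), Real.norm_of_nonneg (inv_nonneg.2 hp.le)]
    have := softPosDeriv_le_one one_pos (w z)
    calc _ ≤ 1 * ((u z)⁻¹ * ‖fderiv ℝ u z‖) := by gcongr
      _ = _ := by ring
  have hP := poincare_ball (f := f) (x₀ := x) (R := 2) (fun z hz => (hfd z (h2U hz)).differentiableAt)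
    (Z := ball x 2 ∩ {z | c ≤ u z}) inter_subset_left fun z hz => by
      refine softPos_of_nonpos one_pos _ ?_
      have := Real.log_le_log hc hz.2
      simp only [hw]; linarith
  have hμZ : ENNReal.ofReal μ ≤ volume (ball x 2 ∩ {z | c ≤ u z}) := ENNReal.ofReal_le_of_le_toReal hZ
  have hI : ∫⁻ y in ball x 2, ‖f y‖ₑ ^ 2 ≤ ENNReal.ofReal (C2 / μ) := by
    rw [ENNReal.ofReal_div_of_pos hμ, ENNReal.le_div_iff_mul_le (Or.inl (by simpa using hμ))
      (Or.inl ENNReal.ofReal_ne_top), mul_comm]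
    calc _ ≤ _ := mul_le_mul_left hμZ _
      _ ≤ _ := hP
      _ ≤ ENNReal.ofReal (2 * 2) ^ 2 * 2 ^ n * ENNReal.ofReal (V 2) * ENNReal.ofReal C1 := by
        gcongr
        · rw [hV, ← volume_closedBall_eq_ofReal x 2]; exact measure_mono ball_subset_closedBall
        · refine le_trans (setLIntegral_mono' measurableSet_ball fun y hy => ?_) (hgrad U u F h x hU)
          rw [← ofReal_norm, ← ENNReal.ofReal_pow (norm_nonneg _)]
          have := hfn y (h2U hy)
          gcongr
      _ = _ := by
        have e2 : (2 : ℝ≥0∞) = ENNReal.ofReal 2 := by simp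
        have := hV0 2
        rw [e2, ← ENNReal.ofReal_pow (by norm_num), ← ENNReal.ofReal_pow (by norm_num),
          ← ENNReal.ofReal_mul (by positivity), ← ENNReal.ofReal_mul (by positivity),
          ← ENNReal.ofReal_mul (by positivity), hC2]
        norm_num
  have hz2 : closedBall z 1 ⊆ ball x 2 := fun y hy => by
    have h1 := mem_closedBall.1 hy
    have h2 := mem_ball.1 hz
    have := dist_triangle y z x
    exact mem_ball.2 (by linarith)
  have hsub := h.isSub_log hlam hLam c hN1
  have hfc : ContinuousOn f (closedBall z 1) := fun y hy =>
    (hfd y (h2U (hz2 hy))).continuousAt.continuousWithinAt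
  have hfi : IntegrableOn (fun y => f y ^ 2) (closedBall z 1) :=
    (hfc.pow 2).integrableOn_compact (isCompact_closedBall _ _)
  have hIr : ∫ y in closedBall z 1, f y ^ 2 ≤ C2 / μ := by
    rw [integral_eq_lintegral_of_nonneg_ae (ae_of_all _ fun y => sq_nonneg _) hfi.aestronglyMeasurable]
    refine ENNReal.toReal_le_of_le_ofReal (by positivity) (le_trans ?_ hI)
    refine (lintegral_mono fun y => le_of_eq ?_).trans (lintegral_mono_set hz2)
    rw [← ofReal_norm, ← ENNReal.ofReal_pow (norm_nonneg _), Real.norm_eq_abs, sq_abs]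
  have hcon : IntegrableOn (fun _ : 𝔼 => (1 : ℝ)) (closedBall z 1) :=
    integrableOn_const measure_closedBall_lt_top.ne
  have hle : ∫ y in closedBall z 1, max (N⁻¹ * w y) 0 ^ 2 ≤ δ := by
    calc _ ≤ ∫ y in closedBall z 1, N⁻¹ ^ 2 * (2 * f y ^ 2 + 2 * 1) := by
          refine integral_mono_of_nonneg (ae_of_all _ fun y => sq_nonneg _)
            (((hfi.const_mul 2).add (hcon.const_mul 2)).const_mul _) (ae_of_all _ fun y => ?_)
          have e1 : max (N⁻¹ * w y) 0 = N⁻¹ * max (w y) 0 := by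
            rw [mul_max_of_nonneg _ _ (inv_nonneg.2 hN0.le), mul_zero]
          simp only [e1, mul_pow]
          have e2 : max (w y) 0 - 1 ≤ f y := le_softPos _
          have e3 : 0 ≤ max (w y) 0 := le_max_right _ _
          have e4 : 0 ≤ f y := softPos_nonneg _
          gcongr
          nlinarith [sq_nonneg (f y - 1)]
      _ = N⁻¹ ^ 2 * (2 * (∫ y in closedBall z 1, f y ^ 2) + 2 * V 1) := by
          rw [integral_const_mul, integral_add (hfi.const_mul 2) (hcon.const_mul 2), integral_const_mul,
            integral_const_mul, setIntegral_const, volume_real_closedBall, smul_eq_mul, mul_one]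
      _ ≤ N⁻¹ ^ 2 * T := mul_le_mul_of_nonneg_left (by rw [hT]; linarith) (by positivity)
      _ ≤ δ := hNT
  have hv := hDG U _ _ hsub z (hz2.trans h2U) hle
  rw [inv_mul_le_iff₀ hN0, mul_one] at hv
  have hp := h.pos z (h2U (hz2 (mem_closedBall_self zero_le_one)))
  rw [← Real.log_le_log_iff (by positivity) hp, Real.log_mul (Real.exp_pos _).ne' hc.ne', Real.log_exp]
  linarith

section Dilation

variable {ρ : ℝ} (x₀ : EuclideanSpace ℝ (Fin n))

lemma quasiMeasurePreserving_dilation (hρ : ρ ≠ 0) :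
    Measure.QuasiMeasurePreserving (fun z : 𝔼 => x₀ + ρ • z) volume volume :=
  (measurePreserving_add_left volume x₀).quasiMeasurePreserving.comp
    (Measure.quasiMeasurePreserving_smul volume hρ)

lemma hasFDerivAt_comp_dilation {u : 𝔼 → ℝ} {z : 𝔼} (h : DifferentiableAt ℝ u (x₀ + ρ • z)) :
    HasFDerivAt (fun z => u (x₀ + ρ • z)) (ρ • fderiv ℝ u (x₀ + ρ • z)) z := by
  have h1 : HasFDerivAt (fun z : 𝔼 => x₀ + ρ • z) (ρ • ContinuousLinearMap.id ℝ 𝔼) z :=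
    ((hasFDerivAt_id z).const_smul ρ).const_add x₀
  refine (h.hasFDerivAt.comp z h1).congr_fderiv ?_
  ext v
  simp

lemma integral_fderiv_dilation (hρ : 0 < ρ) {φ : 𝔼 → ℝ} (hφ : Differentiable ℝ φ) (F : 𝔼 → 𝔼) :
    ∫ z, fderiv ℝ φ z (ρ • F (x₀ + ρ • z)) =
      ρ ^ 2 * (ρ ^ n)⁻¹ * ∫ x, fderiv ℝ (fun x => φ (ρ⁻¹ • (x - x₀))) x (F x) := by
  set ψ : 𝔼 → ℝ := fun x => φ (ρ⁻¹ • (x - x₀)) with hψ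
  have hψd : Differentiable ℝ ψ := hφ.comp ((differentiable_id.sub_const x₀).const_smul ρ⁻¹)
  have e : φ = fun z => ψ (x₀ + ρ • z) := by
    ext z; simp [hψ, smul_smul, inv_mul_cancel₀ hρ.ne']
  have h1 : ∀ z, fderiv ℝ φ z (ρ • F (x₀ + ρ • z)) =
      ρ ^ 2 * fderiv ℝ ψ (x₀ + ρ • z) (F (x₀ + ρ • z)) := by
    intro z
    have h2 : fderiv ℝ φ z = ρ • fderiv ℝ ψ (x₀ + ρ • z) := by
      conv_lhs => rw [e]
      exact (hasFDerivAt_comp_dilation x₀ (hψd _)).fderiv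
    rw [h2, _root_.smul_apply, map_smul, smul_eq_mul, smul_eq_mul]; ring
  simp_rw [h1]
  rw [integral_const_mul, Measure.integral_comp_smul volume (fun w => fderiv ℝ ψ (x₀ + w) (F (x₀ + w))),
    integral_add_left_eq_self (fun w => fderiv ℝ ψ w (F w)) x₀, finrank_euclideanSpace_fin,
    abs_of_nonneg (by positivity), smul_eq_mul]
  ring

lemma contDiff_comp_inv_dilation {φ : 𝔼 → ℝ} (hφ : ContDiff ℝ (⊤ : ℕ∞) φ) :
    ContDiff ℝ (⊤ : ℕ∞) (fun x => φ (ρ⁻¹ • (x - x₀))) :=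
  hφ.comp ((contDiff_id.sub contDiff_const).const_smul ρ⁻¹)

lemma tsupport_comp_inv_dilation (hρ : 0 < ρ) {φ : 𝔼 → ℝ} (hc : HasCompactSupport φ) :
    HasCompactSupport (fun x => φ (ρ⁻¹ • (x - x₀))) ∧
    tsupport (fun x => φ (ρ⁻¹ • (x - x₀))) ⊆ (fun z => x₀ + ρ • z) '' tsupport φ := by
  have hK : IsCompact ((fun z => x₀ + ρ • z) '' tsupport φ) :=
    IsCompact.image hc (by fun_prop)
  have hsub : Function.support (fun x => φ (ρ⁻¹ • (x - x₀))) ⊆ (fun z => x₀ + ρ • z) '' tsupport φ := by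
    intro x hx
    refine ⟨ρ⁻¹ • (x - x₀), subset_tsupport _ hx, ?_⟩
    simp [smul_smul, mul_inv_cancel₀ hρ.ne']
  exact ⟨HasCompactSupport.of_support_subset_isCompact hK hsub, closure_minimal hsub hK.isClosed⟩

/-- Dilations turn a drift term of critical size into a bounded one. -/
lemma isSol_comp_dilation {lam Lam : ℝ} (hρ : 0 < ρ) {U : Set 𝔼} {u : 𝔼 → ℝ} {F : 𝔼 → 𝔼}
    (isOpen : IsOpen U) (pos : ∀ x ∈ U, 0 < u x) (diff : ∀ x ∈ U, DifferentiableAt ℝ u x)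
    (loc : ∀ K ⊆ U, IsCompact K → MemLp (fderiv ℝ u) 2 (volume.restrict K))
    (meas : AEStronglyMeasurable F (volume.restrict U))
    (growth : ∀ x ∈ U, ‖F x‖ ≤ Lam * (‖fderiv ℝ u x‖ + ρ⁻¹ * u x))
    (ell : ∀ x ∈ U, lam * ‖fderiv ℝ u x‖ ^ 2 - Lam * (ρ⁻¹ * u x) * ‖fderiv ℝ u x‖ ≤ fderiv ℝ u x (F x))
    (eq : ∀ φ : EuclideanSpace ℝ (Fin n) → ℝ, ContDiff ℝ (⊤ : ℕ∞) φ → HasCompactSupport φ →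
      tsupport φ ⊆ U → ∫ x, fderiv ℝ φ x (F x) = 0) :
    IsSol lam Lam ((fun z => x₀ + ρ • z) ⁻¹' U) (fun z => u (x₀ + ρ • z))
      (fun z => ρ • F (x₀ + ρ • z)) := by
  have hT : Continuous fun z : 𝔼 => x₀ + ρ • z := by fun_prop
  refine ⟨isOpen.preimage hT, fun z hz => pos _ hz,
    fun z hz => (hasFDerivAt_comp_dilation x₀ (diff _ hz)).differentiableAt, ?_, ?_, ?_, ?_, ?_⟩
  · intro K hK hKc
    have h1 := loc ((fun z => x₀ + ρ • z) '' K) (image_subset_iff.2 hK) (hKc.image hT)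
    have hm1 := (measurable_fderiv ℝ u).norm.aestronglyMeasurable (μ := volume)
    rw [memLp_two_iff_integrable_sq_norm (measurable_fderiv ℝ u).aestronglyMeasurable] at h1
    rw [memLp_two_iff_integrable_sq_norm (measurable_fderiv ℝ _).aestronglyMeasurable]
    have h2 := (integrable_indicator_iff (hKc.image hT).measurableSet).2 h1
    have h3 : Integrable fun z => ((fun z => x₀ + ρ • z) '' K).indicator
        (fun x => ‖fderiv ℝ u x‖ ^ 2) (x₀ + ρ • z) :=
      Integrable.comp_smul (f := fun w => ((fun z => x₀ + ρ • z) '' K).indicator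
        (fun x => ‖fderiv ℝ u x‖ ^ 2) (x₀ + w)) (h2.comp_add_left x₀) hρ.ne'
    refine (integrable_indicator_iff hKc.measurableSet).1 ?_
    convert! h3.const_mul (ρ ^ 2) using 2 with z
    by_cases hz : z ∈ K
    · rw [indicator_of_mem hz, indicator_of_mem (mem_image_of_mem _ hz),
        (hasFDerivAt_comp_dilation x₀ (diff _ (hK hz))).fderiv, norm_smul, mul_pow, Real.norm_eq_abs,
        sq_abs]
    · rw [indicator_of_notMem hz, indicator_of_notMem, mul_zero]
      rintro ⟨w, hw, hwz⟩
      have : w = z := smul_right_injective _ hρ.ne' (add_left_cancel hwz)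
      exact hz (this ▸ hw)
  · have h1 := (aestronglyMeasurable_indicator_iff isOpen.measurableSet).2 meas
    have h2 := h1.comp_quasiMeasurePreserving (quasiMeasurePreserving_dilation x₀ hρ.ne')
    have h3 : AEStronglyMeasurable (fun z => F (x₀ + ρ • z))
        (volume.restrict ((fun z => x₀ + ρ • z) ⁻¹' U)) :=
      (aestronglyMeasurable_indicator_iff (isOpen.preimage hT).measurableSet).1 h2
    exact h3.const_smul ρ
  · intro z hz
    rw [(hasFDerivAt_comp_dilation x₀ (diff _ hz)).fderiv, norm_smul, norm_smul, Real.norm_of_nonneg hρ.le]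
    have h1 := mul_le_mul_of_nonneg_left (growth _ hz) hρ.le
    refine h1.trans_eq ?_
    field_simp
  · intro z hz
    rw [(hasFDerivAt_comp_dilation x₀ (diff _ hz)).fderiv, norm_smul, Real.norm_of_nonneg hρ.le]
    simp only [_root_.smul_apply, map_smul, smul_eq_mul]
    have h1 := mul_le_mul_of_nonneg_left (ell _ hz) (sq_nonneg ρ)
    refine le_trans (le_of_eq ?_) (h1.trans_eq ?_)
    · field_simp
    · ring
  · intro φ hφ hc hs
    rw [integral_fderiv_dilation x₀ hρ (hφ.differentiable (by simp)), eq _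
      (contDiff_comp_inv_dilation x₀ hφ) (tsupport_comp_inv_dilation x₀ hρ hc).1
      ((tsupport_comp_inv_dilation x₀ hρ hc).2.trans (image_subset_iff.2 hs)), mul_zero]

lemma IsSol.comp_dilation {lam Lam : ℝ} (hLam : 0 ≤ Lam) {U : Set 𝔼} {u : 𝔼 → ℝ} {F : 𝔼 → 𝔼}
    (h : IsSol lam Lam U u F) (hρ : 0 < ρ) (hρ1 : ρ ≤ 1) :
    IsSol lam Lam ((fun z => x₀ + ρ • z) ⁻¹' U) (fun z => u (x₀ + ρ • z))
      (fun z => ρ • F (x₀ + ρ • z)) := by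
  have hle : ∀ x ∈ U, u x ≤ ρ⁻¹ * u x := fun x hx =>
    le_mul_of_one_le_left (h.pos x hx).le ((one_le_inv₀ hρ).2 hρ1)
  refine isSol_comp_dilation x₀ hρ h.isOpen h.pos h.diff h.loc h.meas (fun x hx => ?_) (fun x hx => ?_) h.eq
  · refine (h.growth x hx).trans ?_
    have := hle x hx
    gcongr
  · refine le_trans ?_ (h.ell x hx)
    have := hle x hx
    gcongr

lemma closedBall_subset_preimage_dilation (hρ : 0 < ρ) {U : Set 𝔼} {R : ℝ}
    (hU : closedBall x₀ (R * ρ) ⊆ U) : closedBall (0 : 𝔼) R ⊆ (fun z => x₀ + ρ • z) ⁻¹' U := by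
  intro z hz
  refine hU ?_
  rw [mem_closedBall_zero_iff] at hz
  rw [mem_closedBall, dist_eq_norm, add_sub_cancel_left, norm_smul, Real.norm_of_nonneg hρ.le, mul_comm]
  gcongr

lemma exists_eq_dilation (hρ : 0 < ρ) {x : 𝔼} {R : ℝ} (hx : x ∈ ball x₀ (R * ρ)) :
    ∃ z ∈ ball (0 : 𝔼) R, x₀ + ρ • z = x := by
  refine ⟨ρ⁻¹ • (x - x₀), ?_, by simp [smul_smul, mul_inv_cancel₀ hρ.ne']⟩
  rw [mem_ball, dist_eq_norm] at hx
  rw [mem_ball_zero_iff, norm_smul, norm_inv, Real.norm_of_nonneg hρ.le, inv_mul_lt_iff₀ hρ]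
  linarith

end Dilation

lemma exists_lower_of_local_max (hn : 2 ≤ n) {lam Lam : ℝ} (hlam : 0 < lam) (hLam : 0 ≤ Lam) :
    ∃ κ : ℝ, 0 < κ ∧ ∀ (U : Set 𝔼) (u : 𝔼 → ℝ) (F : 𝔼 → 𝔼), IsSol lam Lam U u F →
    ∀ (x₀ : 𝔼) (ρ : ℝ), 0 < ρ → ρ ≤ 1 → closedBall x₀ (3 * ρ) ⊆ U →
    (∀ z ∈ closedBall x₀ ρ, u z ≤ 2 * u x₀) → ∀ z ∈ ball x₀ ρ, κ * u x₀ ≤ u z := by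
  obtain ⟨δ, hδ, hDG⟩ := exists_deGiorgi_const hn (half_pos hlam)
    (show 0 ≤ Lam + Lam ^ 2 / lam by positivity)
  set V := volume.real (closedBall (0 : 𝔼) 1) with hV
  have hV0 : 0 ≤ V := measureReal_nonneg
  set c1 := √(δ / (8 * (V + 1))) with hc1
  have hc10 : 0 < c1 := Real.sqrt_pos.2 (by positivity)
  have hc1V : 4 * c1 ^ 2 * V ≤ δ / 2 := by
    rw [hc1, Real.sq_sqrt (by positivity), ← mul_div_assoc, div_mul_eq_mul_div, div_le_iff₀ (by positivity)]
    nlinarith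
  obtain ⟨κ, hκ, -, hG⟩ := exists_growth_const hn hlam hLam (show 0 < δ / 32 by positivity)
  refine ⟨κ * c1, by positivity, fun U u F h x₀ ρ hρ hρ1 hU hmax z hz => ?_⟩
  have h' := h.comp_dilation x₀ hLam hρ hρ1
  have hU3 := closedBall_subset_preimage_dilation x₀ hρ hU
  have hU1 : closedBall (0 : 𝔼) 1 ⊆ (fun z => x₀ + ρ • z) ⁻¹' U :=
    (closedBall_subset_closedBall (by norm_num)).trans hU3
  have hmax' : ∀ z ∈ closedBall (0 : 𝔼) 1, u (x₀ + ρ • z) ≤ 2 * u x₀ := fun z hz => hmax _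
    (closedBall_subset_preimage_dilation x₀ hρ (U := closedBall x₀ ρ) (R := 1) (by rw [one_mul]) hz)
  set w : 𝔼 → ℝ := fun z => u (x₀ + ρ • z) with hw
  have hw0 : w 0 = u x₀ := by simp [hw]
  rw [← hw0] at hmax' ⊢
  have hp0 : 0 < w 0 := h'.pos 0 (hU1 (by simp))
  set S := closedBall (0 : 𝔼) 1 ∩ {z | c1 * w 0 ≤ w z} with hS
  have hScl : IsClosed S :=
    ((h'.continuousOn.mono hU1).preimage_isClosed_of_isClosed isClosed_closedBall isClosed_Ici :
      IsClosed (closedBall (0 : 𝔼) 1 ∩ w ⁻¹' Ici (c1 * w 0)))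
  have hSμ : δ / 32 ≤ volume.real S := by
    by_contra! hcon
    have hsub := h'.isSub_div hlam hLam (half_pos hp0)
    have hcon1 : IntegrableOn (fun _ : 𝔼 => 4 * c1 ^ 2) (closedBall (0 : 𝔼) 1) :=
      integrableOn_const measure_closedBall_lt_top.ne
    have hSi : IntegrableOn (S.indicator fun _ => (16 : ℝ)) (closedBall (0 : 𝔼) 1) := by
      have : IntegrableOn (fun _ : 𝔼 => (16 : ℝ)) (closedBall (0 : 𝔼) 1) :=
        integrableOn_const measure_closedBall_lt_top.ne
      exact this.indicator hScl.measurableSet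
    have hle : ∫ z in closedBall (0 : 𝔼) 1, max ((w 0 / 2)⁻¹ * w z) 0 ^ 2 ≤ δ := by
      calc _ ≤ ∫ z in closedBall (0 : 𝔼) 1, (4 * c1 ^ 2 + S.indicator (fun _ => (16 : ℝ)) z) := by
            refine integral_mono_of_nonneg (ae_of_all _ fun z => sq_nonneg _) (hcon1.add hSi) ?_
            refine (ae_restrict_iff' measurableSet_closedBall).2 (ae_of_all _ fun z hz => ?_)
            have hpz := h'.pos z (hU1 hz)
            have hpz' : 0 < w z := hpz
            simp only
            rw [max_eq_left (by positivity)]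
            by_cases hzS : z ∈ S
            · rw [indicator_of_mem hzS]
              have : (w 0 / 2)⁻¹ * w z ≤ 4 := by
                rw [inv_mul_le_iff₀ (by positivity)]; linarith [hmax' z hz]
              have h0 : 0 ≤ (w 0 / 2)⁻¹ * w z := by positivity
              nlinarith [sq_nonneg c1]
            · rw [indicator_of_notMem hzS]
              have hlt : w z < c1 * w 0 := by
                by_contra! hge; exact hzS ⟨hz, hge⟩
              have : (w 0 / 2)⁻¹ * w z ≤ 2 * c1 := by
                rw [inv_mul_le_iff₀ (by positivity)]; linarith
              have h0 : 0 ≤ (w 0 / 2)⁻¹ * w z := by positivity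
              nlinarith
        _ = 4 * c1 ^ 2 * V + 16 * volume.real S := by
            rw [integral_add hcon1 hSi, setIntegral_const, smul_eq_mul, integral_indicator hScl.measurableSet,
              Measure.restrict_restrict hScl.measurableSet, setIntegral_const, smul_eq_mul,
              inter_eq_left.2 inter_subset_left]
            ring
        _ ≤ δ := by linarith
    have := hDG _ _ _ hsub 0 hU1 hle
    rw [inv_mul_le_iff₀ (by positivity)] at this
    linarith
  have hmono : volume.real S ≤ volume.real (ball (0 : 𝔼) 2 ∩ {z | c1 * w 0 ≤ w z}) :=
    measureReal_mono (inter_subset_inter_left _ (closedBall_subset_ball (by norm_num)))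
      (measure_ne_top_of_subset inter_subset_left measure_ball_lt_top.ne)
  obtain ⟨z', hz', rfl⟩ := exists_eq_dilation x₀ hρ (R := 1) (by rwa [one_mul])
  have := hG _ _ _ h' 0 hU3 (c1 * w 0) (by positivity) (hSμ.trans hmono) z' hz'
  rw [mul_assoc]
  exact this

lemma exists_expansion_const (hn : 2 ≤ n) {lam Lam : ℝ} (hlam : 0 < lam) (hLam : 0 ≤ Lam) :
    ∃ κ : ℝ, 0 < κ ∧ ∀ (U : Set 𝔼) (u : 𝔼 → ℝ) (F : 𝔼 → 𝔼), IsSol lam Lam U u F →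
    ∀ (x₀ : 𝔼) (ρ c : ℝ), 0 < ρ → 2 * ρ ≤ 1 → 0 < c → closedBall x₀ (6 * ρ) ⊆ U →
    (∀ z ∈ ball x₀ ρ, c ≤ u z) → ∀ z ∈ ball x₀ (2 * ρ), κ * c ≤ u z := by
  have hμ : 0 < volume.real (ball (0 : 𝔼) (1 / 2)) :=
    ENNReal.toReal_pos (measure_ball_pos _ _ (by norm_num)).ne' measure_ball_lt_top.ne
  obtain ⟨κ, hκ, -, hG⟩ := exists_growth_const hn hlam hLam hμ
  refine ⟨κ, hκ, fun U u F h x₀ ρ c hρ hρ1 hc hU hge z hz => ?_⟩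
  have h2 : 0 < 2 * ρ := by positivity
  have h' := h.comp_dilation x₀ hLam h2 hρ1
  have hU3 := closedBall_subset_preimage_dilation x₀ h2 (U := U) (R := 3) (by convert! hU using 2; ring)
  obtain ⟨z', hz', rfl⟩ := exists_eq_dilation x₀ h2 (R := 1) (by rwa [one_mul])
  refine hG _ _ _ h' 0 hU3 c hc (measureReal_mono ?_ ?_) z' hz'
  · intro z hz
    refine ⟨ball_subset_ball (by norm_num) hz, hge _ ?_⟩
    rw [mem_ball_zero_iff] at hz
    rw [mem_ball, dist_eq_norm, add_sub_cancel_left, norm_smul, Real.norm_of_nonneg h2.le]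
    nlinarith
  · exact measure_ne_top_of_subset inter_subset_left measure_ball_lt_top.ne

/-- The Harnack inequality. -/
lemma exists_harnack_const (hn : 2 ≤ n) {lam Lam : ℝ} (hlam : 0 < lam) (hLam : 0 ≤ Lam) :
    ∃ C : ℝ, 0 < C ∧ ∀ (U : Set 𝔼) (u : 𝔼 → ℝ) (F : 𝔼 → 𝔼), IsSol lam Lam U u F →
    ∀ (y : 𝔼) (r : ℝ), 0 < r → 4 * r ≤ 1 → closedBall y (20 * r) ⊆ U →
    ∀ x ∈ ball y r, u y ≤ C * u x := by
  obtain ⟨κ1, hκ1, hL⟩ := exists_lower_of_local_max hn hlam hLam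
  obtain ⟨κ2, hκ2, hE⟩ := exists_expansion_const hn hlam hLam
  obtain ⟨γ', hγ'⟩ := exists_pow_lt_of_lt_one hκ2 (show (1 : ℝ) / 2 < 1 by norm_num)
  set γ := γ' + 1 with hγ
  have hγκ : (1 / 2 : ℝ) ^ γ ≤ κ2 := by
    refine le_trans ?_ hγ'.le
    exact pow_le_pow_of_le_one (by norm_num) (by norm_num) (by omega)
  have hγ1 : (1 : ℝ) ≤ γ := by rw [hγ]; push_cast; linarith [γ'.cast_nonneg (α := ℝ)]
  set θ : ℝ := 1 / (2 * γ) with hθ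
  have hθ0 : 0 < θ := by positivity
  have hθ1 : θ ≤ 1 / 2 := by
    rw [hθ]; gcongr; linarith
  have hbern : 1 / 2 ≤ (1 - θ) ^ γ := by
    have := one_add_mul_le_pow (show (-2 : ℝ) ≤ -θ by linarith) γ
    rw [← sub_eq_add_neg] at this
    refine le_trans (le_of_eq ?_) this
    rw [hθ]; field_simp; norm_num
  have hcpos : 0 < κ1 * (θ / 4) ^ γ := by positivity
  refine ⟨(κ1 * (θ / 4) ^ γ)⁻¹, by positivity, fun U u F h y r hr hr4 hU x hx => ?_⟩
  rw [← div_eq_inv_mul, le_div_iff₀' hcpos]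
  have hyU : closedBall y r ⊆ U := (closedBall_subset_closedBall (by linarith)).trans hU
  set w : 𝔼 → ℝ := fun z => 1 - dist z y / r with hw
  have hwc : Continuous w := by fun_prop
  have hΨ : ContinuousOn (fun z => w z ^ γ * u z) (closedBall y r) :=
    (hwc.pow γ).continuousOn.mul (h.continuousOn.mono hyU)
  obtain ⟨x₀, hx₀, hmax⟩ := (isCompact_closedBall y r).exists_isMaxOn
    ⟨y, mem_closedBall_self hr.le⟩ hΨ
  have hx₀p := h.pos x₀ (hyU hx₀)
  have hwx : 0 ≤ w x₀ := by
    have := mem_closedBall.1 hx₀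
    simp only [hw, sub_nonneg]
    rwa [div_le_one hr]
  set d := w x₀ with hd
  have huy : u y ≤ d ^ γ * u x₀ := by
    have := hmax (mem_closedBall_self hr.le)
    simpa [hw] using this
  have hyp := h.pos y (hyU (mem_closedBall_self hr.le))
  have hd0 : 0 < d := by
    refine hwx.lt_of_ne fun h0 => ?_
    rw [← h0, zero_pow (by omega), zero_mul] at huy
    linarith
  have hd1 : d ≤ 1 := by
    have : 0 ≤ dist x₀ y / r := by positivity
    simp only [hd, hw]; linarith
  have hdist : dist x₀ y = r * (1 - d) := by simp only [hd, hw]; field_simp; ring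
  set ρ := θ * d * r with hρ
  have hρ0 : 0 < ρ := by positivity
  have hρr : ρ ≤ r / 2 := by
    calc ρ ≤ 1 / 2 * 1 * r := by rw [hρ]; gcongr
      _ = r / 2 := by ring
  have hballU : ∀ s, s ≤ 19 * r → closedBall x₀ s ⊆ U := fun s hs => by
    refine (closedBall_subset_closedBall' ?_).trans hU
    rw [hdist]; nlinarith
  have hlocal : ∀ z ∈ closedBall x₀ ρ, u z ≤ 2 * u x₀ := by
    intro z hz
    have hzx := mem_closedBall.1 hz
    have htri := dist_triangle z x₀ y
    have hwz : d * (1 - θ) ≤ w z := by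
      have h1 : dist z y ≤ r * (1 - d * (1 - θ)) := by rw [hdist] at htri; rw [hρ] at hzx; linarith
      have h2 : dist z y / r ≤ 1 - d * (1 - θ) := by rw [div_le_iff₀ hr]; linarith
      simp only [hw]; linarith
    have hzr : z ∈ closedBall y r := by
      rw [mem_closedBall]
      have : 0 ≤ w z := le_trans (mul_nonneg hd0.le (by linarith)) hwz
      simp only [hw, sub_nonneg] at this
      rwa [div_le_one hr] at this
    have hzp := h.pos z (hyU hzr)
    have h3 : w z ^ γ * u z ≤ d ^ γ * u x₀ := hmax hzr
    have h4 : d ^ γ * (1 / 2) ≤ w z ^ γ := by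
      calc d ^ γ * (1 / 2) ≤ d ^ γ * (1 - θ) ^ γ := by gcongr
        _ = (d * (1 - θ)) ^ γ := by rw [mul_pow]
        _ ≤ w z ^ γ := by
          have : 0 ≤ d * (1 - θ) := mul_nonneg hd0.le (by linarith)
          gcongr
    have h5 : d ^ γ * (1 / 2 * u z) ≤ d ^ γ * u x₀ := by
      calc _ = d ^ γ * (1 / 2) * u z := by ring
        _ ≤ w z ^ γ * u z := by gcongr
        _ ≤ _ := h3
    have := le_of_mul_le_mul_left h5 (by positivity)
    linarith
  have hiter : ∀ j : ℕ, 2 ^ j * ρ ≤ 4 * r → ∀ z ∈ ball x₀ (2 ^ j * ρ), κ2 ^ j * (κ1 * u x₀) ≤ u z := by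
    intro j
    induction j with
    | zero =>
      intro _ z hz
      rw [pow_zero, one_mul] at hz ⊢
      exact hL U u F h x₀ ρ hρ0 (by linarith) (hballU _ (by linarith)) hlocal z hz
    | succ j ih =>
      intro hj z hz
      have e : (2 : ℝ) ^ (j + 1) * ρ = 2 * (2 ^ j * ρ) := by ring
      rw [e] at hj hz
      have hp : 0 < 2 ^ j * ρ := by positivity
      have := hE U u F h x₀ (2 ^ j * ρ) (κ2 ^ j * (κ1 * u x₀)) hp (by linarith) (by positivity)
        (hballU _ (by linarith)) (ih (by linarith)) z hz
      rw [pow_succ']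
      linarith
  obtain ⟨m, hm1, hm2⟩ := exists_nat_pow_near (show 1 ≤ 2 * r / ρ by rw [le_div_iff₀ hρ0]; linarith)
    (one_lt_two (α := ℝ))
  rw [le_div_iff₀ hρ0] at hm1
  rw [div_lt_iff₀ hρ0] at hm2
  have e : (2 : ℝ) ^ (m + 1) * ρ = 2 * (2 ^ m * ρ) := by ring
  have hfin := hiter (m + 1) (by linarith) x (by
    rw [mem_ball] at hx ⊢
    have := dist_triangle_right x x₀ y
    have h2 := mem_closedBall.1 hx₀
    linarith)
  have hκ : (θ / 4 * d) ^ γ ≤ κ2 ^ (m + 1) := by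
    calc (θ / 4 * d) ^ γ ≤ ((1 / 2) ^ (m + 1)) ^ γ := by
          gcongr
          rw [one_div, inv_pow, le_inv_comm₀ (by positivity) (by positivity), ← one_div,
            le_div_iff₀ (by positivity)]
          have h1 : 2 ^ (m + 1) * (θ * d * r) ≤ 4 * r := by rw [← hρ]; linarith
          have h2 : (2 ^ (m + 1) * (θ / 4 * d)) * (4 * r) ≤ 1 * (4 * r) := by linarith
          exact le_of_mul_le_mul_right h2 (by positivity)
      _ = ((1 / 2) ^ γ) ^ (m + 1) := by rw [← pow_mul, ← pow_mul, mul_comm]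
      _ ≤ κ2 ^ (m + 1) := by gcongr
  calc κ1 * (θ / 4) ^ γ * u y ≤ κ1 * (θ / 4) ^ γ * (d ^ γ * u x₀) := by gcongr
    _ = (θ / 4 * d) ^ γ * (κ1 * u x₀) := by rw [mul_pow]; ring
    _ ≤ κ2 ^ (m + 1) * (κ1 * u x₀) := by gcongr
    _ ≤ u x := hfin

section Pole

/-- The punctured ball on which normalized Green functions are studied. -/
def puncturedBall (n : ℕ) : Set (EuclideanSpace ℝ (Fin n)) := ball 0 (3 / 2) \ {0}

lemma closedBall_subset_puncturedBall {x : 𝔼} (h1 : 3 / 4 ≤ ‖x‖) (h2 : ‖x‖ ≤ 5 / 4) :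
    closedBall x (20 * (1 / 100)) ⊆ puncturedBall n := by
  intro z hz
  have hz' := mem_closedBall.1 hz
  rw [dist_eq_norm] at hz'
  have h3 := norm_le_insert' z x
  have h4 := norm_le_insert z x
  refine ⟨mem_ball_zero_iff.2 (by linarith), fun h0 => ?_⟩
  rw [mem_singleton_iff.1 h0, norm_zero] at h4
  rw [mem_singleton_iff.1 h0] at hz'
  linarith

/-- The Harnack inequality on the unit sphere. -/
lemma exists_harnack_sphere_const (hn : 2 ≤ n) {lam Lam : ℝ} (hlam : 0 < lam) (hLam : 0 ≤ Lam) :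
    ∃ C : ℝ, 0 < C ∧ ∀ (u : 𝔼 → ℝ) (F : 𝔼 → 𝔼), IsSol lam Lam (puncturedBall n) u F →
    ∀ x z : 𝔼, ‖x‖ = 1 → 1 - 1 / 100 < ‖z‖ → ‖z‖ < 1 + 1 / 100 → u z ≤ C * u x := by
  obtain ⟨C, hC, hH⟩ := exists_harnack_const hn hlam hLam
  have hloc : ∀ (u : 𝔼 → ℝ) (F : 𝔼 → 𝔼), IsSol lam Lam (puncturedBall n) u F → ∀ x z : 𝔼,
      3 / 4 ≤ ‖x‖ → ‖x‖ ≤ 5 / 4 → z ∈ ball x (1 / 100) → u x ≤ C * u z := fun u F h x z h1 h2 hz =>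
    hH _ u F h x (1 / 100) (by norm_num) (by norm_num) (closedBall_subset_puncturedBall h1 h2) z hz
  have hpos : ∀ (u : 𝔼 → ℝ) (F : 𝔼 → 𝔼), IsSol lam Lam (puncturedBall n) u F → ∀ x : 𝔼, ‖x‖ = 1 → 0 < u x :=
    fun u F h x hx => h.pos x (closedBall_subset_puncturedBall (by rw [hx]; norm_num) (by rw [hx]; norm_num)
      (mem_closedBall_self (by norm_num)))
  set S : Set 𝔼 := sphere 0 1 with hS
  have hS1 : ∀ x ∈ S, ‖x‖ = 1 := fun x hx => mem_sphere_zero_iff_norm.1 hx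
  have hconn : IsPreconnected S := by
    refine isPreconnected_sphere ?_ 0 1
    rw [← Module.finrank_eq_rank, finrank_euclideanSpace_fin]
    exact_mod_cast hn
  have hpair : ∀ x ∈ S, ∀ z ∈ S, ∃ C' : ℝ, 0 < C' ∧ ∀ (u : 𝔼 → ℝ) (F : 𝔼 → 𝔼),
      IsSol lam Lam (puncturedBall n) u F → u x ≤ C' * u z ∧ u z ≤ C' * u x := by
    intro x hx z hz
    refine hconn.induction₂ (fun x z => ∃ C' : ℝ, 0 < C' ∧ ∀ (u : 𝔼 → ℝ) (F : 𝔼 → 𝔼),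
      IsSol lam Lam (puncturedBall n) u F → u x ≤ C' * u z ∧ u z ≤ C' * u x) ?_ ?_ ?_ hx hz
    · intro x hx
      filter_upwards [self_mem_nhdsWithin, mem_nhdsWithin_of_mem_nhds (ball_mem_nhds x
        (show (0 : ℝ) < 1 / 100 by norm_num))] with z hz hzx
      refine ⟨C, hC, fun u F h => ⟨?_, ?_⟩⟩
      · exact hloc u F h x z (by rw [hS1 x hx]; norm_num) (by rw [hS1 x hx]; norm_num) hzx
      · exact hloc u F h z x (by rw [hS1 z hz]; norm_num) (by rw [hS1 z hz]; norm_num) (mem_ball_comm.1 hzx)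
    · rintro x y z _ _ _ ⟨C1, h1, hC1⟩ ⟨C2, h2, hC2⟩
      refine ⟨C1 * C2, by positivity, fun u F h => ⟨?_, ?_⟩⟩
      · calc u x ≤ C1 * u y := (hC1 u F h).1
          _ ≤ C1 * (C2 * u z) := by gcongr; exact (hC2 u F h).1
          _ = _ := by ring
      · calc u z ≤ C2 * u y := (hC2 u F h).2
          _ ≤ C2 * (C1 * u x) := by gcongr; exact (hC1 u F h).2
          _ = _ := by ring
    · rintro x y _ _ ⟨C1, h1, hC1⟩
      exact ⟨C1, h1, fun u F h => (hC1 u F h).symm⟩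
  obtain ⟨x₀, hx₀⟩ : ∃ x₀ : 𝔼, x₀ ∈ S := by
    have : Nonempty (Fin n) := ⟨⟨0, by omega⟩⟩
    exact (NormedSpace.sphere_nonempty (x := (0 : 𝔼)) (r := 1)).2 zero_le_one
  obtain ⟨C', hC', hunif⟩ : ∃ C' : ℝ, 0 < C' ∧ ∀ (u : 𝔼 → ℝ) (F : 𝔼 → 𝔼),
      IsSol lam Lam (puncturedBall n) u F → ∀ x ∈ S, u x ≤ C' * u x₀ ∧ u x₀ ≤ C' * u x := by
    refine (isCompact_sphere (0 : 𝔼) 1).induction_on (p := fun s => ∃ C' : ℝ, 0 < C' ∧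
      ∀ (u : 𝔼 → ℝ) (F : 𝔼 → 𝔼), IsSol lam Lam (puncturedBall n) u F → ∀ x ∈ s,
      u x ≤ C' * u x₀ ∧ u x₀ ≤ C' * u x) ?_ ?_ ?_ ?_
    · exact ⟨1, one_pos, by simp⟩
    · rintro s t hst ⟨C1, h1, hC1⟩
      exact ⟨C1, h1, fun u F h x hx => hC1 u F h x (hst hx)⟩
    · rintro s t ⟨C1, h1, hC1⟩ ⟨C2, h2, hC2⟩
      refine ⟨C1 + C2, by positivity, fun u F h x hx => ?_⟩
      have hp0 := hpos u F h x₀ (hS1 x₀ hx₀)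
      rcases hx with hx | hx
      · have h3 := hC1 u F h x hx
        have hpx : 0 < u x := by by_contra! hc; nlinarith
        exact ⟨by nlinarith, by nlinarith⟩
      · have h3 := hC2 u F h x hx
        have hpx : 0 < u x := by by_contra! hc; nlinarith
        exact ⟨by nlinarith, by nlinarith⟩
    · intro x hx
      obtain ⟨C1, h1, hC1⟩ := hpair x hx x₀ hx₀
      refine ⟨S ∩ ball x (1 / 100), inter_mem_nhdsWithin _ (ball_mem_nhds x (by norm_num)), C1 * C,
        by positivity, fun u F h z hz => ?_⟩
      have e1 := hS1 x hx
      have e2 := hS1 z hz.1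
      have h3 := hloc u F h x z (by rw [e1]; norm_num) (by rw [e1]; norm_num) hz.2
      have h4 := hloc u F h z x (by rw [e2]; norm_num) (by rw [e2]; norm_num) (mem_ball_comm.1 hz.2)
      constructor
      · calc u z ≤ C * u x := h4
          _ ≤ C * (C1 * u x₀) := by gcongr; exact (hC1 u F h).1
          _ = _ := by ring
      · calc u x₀ ≤ C1 * u x := (hC1 u F h).2
          _ ≤ C1 * (C * u z) := by gcongr
          _ = _ := by ring
  refine ⟨C * C' * C', by positivity, fun u F h x z hx hz1 hz2 => ?_⟩
  have hz0 : 0 < ‖z‖ := by linarith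
  set z' : 𝔼 := ‖z‖⁻¹ • z with hz'
  have hz'1 : ‖z'‖ = 1 := by rw [hz', norm_smul, norm_inv, norm_norm, inv_mul_cancel₀ hz0.ne']
  have hzz' : z' ∈ ball z (1 / 100) := by
    have e : z' - z = (1 - ‖z‖) • z' := by
      rw [sub_smul, one_smul, hz', smul_smul, mul_inv_cancel₀ hz0.ne', one_smul]
    rw [mem_ball, dist_eq_norm, e, norm_smul, hz'1, mul_one, Real.norm_eq_abs, abs_lt]
    constructor <;> linarith
  calc u z ≤ C * u z' := hloc u F h z z' (by linarith) (by linarith) hzz'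
    _ ≤ C * (C' * u x₀) := by
      gcongr; exact (hunif u F h z' (mem_sphere_zero_iff_norm.2 hz'1)).1
    _ ≤ C * (C' * (C' * u x)) := by
      gcongr; exact (hunif u F h x (mem_sphere_zero_iff_norm.2 hx)).2
    _ = _ := by ring

/-- The flux through the unit sphere is controlled by the values of the solution there. -/
lemma exists_flux_const (hn : 2 ≤ n) {lam Lam : ℝ} (hlam : 0 < lam) (hLam : 0 ≤ Lam) :
    ∃ C : ℝ, 0 < C ∧ ∀ (u : 𝔼 → ℝ) (F : 𝔼 → 𝔼), IsSol lam Lam (puncturedBall n) u F →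
    ∀ P : ℝ, (∀ φ : 𝔼 → ℝ, ContDiff ℝ (⊤ : ℕ∞) φ → HasCompactSupport φ →
      tsupport φ ⊆ ball 0 (3 / 2) → ∫ x, fderiv ℝ φ x (F x) = P * φ 0) →
    ∀ x : 𝔼, ‖x‖ = 1 → P ≤ C * u x := by
  obtain ⟨CH, hCH, hsph⟩ := exists_harnack_sphere_const hn hlam hLam
  obtain ⟨C0, hC0, hcut⟩ := exists_cutoff (n := n)
  obtain ⟨η, hη, -, -, hη1, -, hηs, hηc, hηD⟩ := hcut 0 (1 - 1 / 200) (1 + 1 / 200) (by norm_num) (by norm_num)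
  obtain ⟨ζ₁, hζ₁, h10, h11, hζ₁1, hζ₁0, -, hζ₁c, -⟩ := hcut 0 (1 + 1 / 200) (1 + 1 / 100) (by norm_num) (by norm_num)
  obtain ⟨ζ₂, hζ₂, h20, h21, hζ₂1, hζ₂0, -, -, -⟩ := hcut 0 (1 / 2) (3 / 4) (by norm_num) (by norm_num)
  set ζ : 𝔼 → ℝ := fun x => ζ₁ x * (1 - ζ₂ x) with hζ
  have hζd : ContDiff ℝ (⊤ : ℕ∞) ζ := hζ₁.mul (contDiff_const.sub hζ₂)
  have hζc : HasCompactSupport ζ := hζ₁c.mono fun x hx h0 => hx (by simp [hζ, h0])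
  have hζ0 : ∀ x, 0 ≤ ζ x := fun x => mul_nonneg (h10 x) (by linarith [h21 x])
  have hζs : tsupport ζ ⊆ puncturedBall n := by
    have h1 : Function.support ζ ⊆ closedBall 0 (1 + 1 / 100) ∩ (ball 0 (1 / 2))ᶜ := by
      intro x hx
      refine ⟨?_, fun hx' => ?_⟩
      · by_contra hcon
        exact hx (by simp [hζ, hζ₁0 x hcon])
      · exact hx (by simp [hζ, hζ₂1 x (ball_subset_closedBall hx')])
    refine (closure_minimal h1 (isClosed_closedBall.inter isOpen_ball.isClosed_compl)).trans ?_
    rintro x ⟨hx1, hx2⟩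
    refine ⟨closedBall_subset_ball (by norm_num) hx1, fun h0 => hx2 ?_⟩
    rw [mem_singleton_iff.1 h0]
    exact mem_ball_self (by norm_num)
  set D := C0 / (1 + 1 / 200 - (1 - 1 / 200)) with hD
  have hD0 : 0 < D := by rw [hD]; norm_num; linarith
  set I := 2 / lam * (4 * Lam ^ 2 / lam + Lam) * ∫ x, (ζ x ^ 2 + ‖fderiv ℝ ζ x‖ ^ 2) with hI
  have hI0 : 0 ≤ I := mul_nonneg (by positivity) (integral_nonneg fun x => by positivity)
  have hζi : Integrable fun x => ζ x ^ 2 :=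
    (hζd.continuous.pow 2).integrable_of_hasCompactSupport (hasCompactSupport_sq hζc)
  have hζI : 0 ≤ ∫ x, ζ x ^ 2 := integral_nonneg fun x => sq_nonneg _
  refine ⟨D * Lam * CH * (2 * (∫ x, ζ x ^ 2) + I) + 1, by positivity, fun u F h P hP x hx => ?_⟩
  have hxp : 0 < u x := h.pos x (closedBall_subset_puncturedBall (by rw [hx]; norm_num)
    (by rw [hx]; norm_num) (mem_closedBall_self (by norm_num)))
  obtain ⟨hgi, hgle⟩ := h.log_estimate hlam hLam hζd hζc hζs hζ0
  have hPη := hP η hη hηc (hηs.trans (closedBall_subset_ball (by norm_num)))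
  rw [hη1 0 (mem_closedBall_self (by norm_num)), mul_one] at hPη
  set m := CH * u x with hm
  have hm0 : 0 < m := by positivity
  have hdom : Integrable fun z => D * Lam * m * (2 * ζ z ^ 2 + ζ z ^ 2 * (‖fderiv ℝ u z‖ / u z) ^ 2) :=
    ((hζi.const_mul 2).add hgi).const_mul _
  have hpt : ∀ z, ‖fderiv ℝ η z (F z)‖ ≤
      D * Lam * m * (2 * ζ z ^ 2 + ζ z ^ 2 * (‖fderiv ℝ u z‖ / u z) ^ 2) := by
    intro z
    have hnn : 0 ≤ D * Lam * m * (2 * ζ z ^ 2 + ζ z ^ 2 * (‖fderiv ℝ u z‖ / u z) ^ 2) := by positivity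
    by_cases hz1 : z ∈ closedBall (0 : 𝔼) (1 + 1 / 200)
    · by_cases hz2 : z ∈ ball (0 : 𝔼) (1 - 1 / 200)
      · have h1 : η =ᶠ[𝓝 z] fun _ => 1 := by
          filter_upwards [isOpen_ball.mem_nhds hz2] with y hy using hη1 y (ball_subset_closedBall hy)
        rw [h1.fderiv_eq, fderiv_fun_const]
        simpa using hnn
      · have e1 : ζ₂ z = 0 := hζ₂0 z fun h => hz2 (closedBall_subset_ball (by norm_num) h)
        have e2 : ζ z = 1 := by simp [hζ, e1, hζ₁1 z hz1]
        have n1 := mem_closedBall_zero_iff.1 hz1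
        have n2 : 1 - 1 / 200 ≤ ‖z‖ := by simpa using hz2
        have hzW : z ∈ puncturedBall n := closedBall_subset_puncturedBall (by linarith) (by linarith)
          (mem_closedBall_self (by norm_num))
        have hzp := h.pos z hzW
        have hzm : u z ≤ m := hsph u F h x z hx (by linarith) (by linarith)
        rw [e2]
        have e3 : ‖fderiv ℝ u z‖ = u z * (‖fderiv ℝ u z‖ / u z) := by field_simp
        set q := ‖fderiv ℝ u z‖ / u z with hq
        have hq0 : 0 ≤ q := by positivity
        have hq2 : q + 1 ≤ 2 + q ^ 2 := by nlinarith [sq_nonneg (q - 1)]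
        have hmul := mul_le_mul hzm hq2 (by positivity) hm0.le
        calc ‖fderiv ℝ η z (F z)‖ ≤ ‖fderiv ℝ η z‖ * ‖F z‖ := ContinuousLinearMap.le_opNorm (fderiv ℝ η z) (F z)
          _ ≤ D * (Lam * (‖fderiv ℝ u z‖ + u z)) := by
            gcongr
            · exact hηD z
            · exact h.growth z hzW
          _ = D * (Lam * (u z * (q + 1))) := by rw [e3]; ring
          _ ≤ D * (Lam * (m * (2 + q ^ 2))) :=
            mul_le_mul_of_nonneg_left (mul_le_mul_of_nonneg_left hmul hLam) hD0.le
          _ = _ := by ring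
    · have h1 : fderiv ℝ η z = 0 :=
        image_eq_zero_of_notMem_tsupport fun h => hz1 (hηs (tsupport_fderiv_subset ℝ h))
      rw [h1]
      simpa using hnn
  calc P = ∫ z, fderiv ℝ η z (F z) := hPη.symm
    _ ≤ ‖∫ z, fderiv ℝ η z (F z)‖ := Real.le_norm_self _
    _ ≤ ∫ z, D * Lam * m * (2 * ζ z ^ 2 + ζ z ^ 2 * (‖fderiv ℝ u z‖ / u z) ^ 2) :=
      norm_integral_le_of_norm_le hdom (ae_of_all _ hpt)
    _ = D * Lam * m * (2 * (∫ z, ζ z ^ 2) + ∫ z, ζ z ^ 2 * (‖fderiv ℝ u z‖ / u z) ^ 2) := by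
      rw [integral_const_mul, integral_add (hζi.const_mul 2) hgi, integral_const_mul]
    _ ≤ D * Lam * m * (2 * (∫ z, ζ z ^ 2) + I) := by gcongr
    _ ≤ _ := by rw [hm]; nlinarith

end Pole

section Green

/-- The conormal field `Aᵀ∇g - gB`. -/
def conormalField (A : EuclideanSpace ℝ (Fin n) → Matrix (Fin n) (Fin n) ℝ)
    (B : EuclideanSpace ℝ (Fin n) → EuclideanSpace ℝ (Fin n)) (g : EuclideanSpace ℝ (Fin n) → ℝ)
    (x : EuclideanSpace ℝ (Fin n)) : EuclideanSpace ℝ (Fin n) :=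
  WithLp.toLp 2 (fun i => ∑ j, A x j i * gradient g x j) - g x • B x

lemma fderiv_apply_eq_sum (φ : 𝔼 → ℝ) (x v : 𝔼) : fderiv ℝ φ x v = ∑ i, v i * gradient φ x i := by
  rw [← inner_gradient, PiLp.inner_apply]
  simp [mul_comm]

lemma fderiv_conormalField (A : 𝔼 → Matrix (Fin n) (Fin n) ℝ) (B : 𝔼 → 𝔼) (g φ : 𝔼 → ℝ) (x : 𝔼) :
    fderiv ℝ φ x (conormalField A B g x) =
      (∑ i, ∑ j, A x j i * gradient g x j * gradient φ x i) - g x * ∑ i, B x i * gradient φ x i := by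
  rw [fderiv_apply_eq_sum, Finset.mul_sum, ← Finset.sum_sub_distrib]
  refine Finset.sum_congr rfl fun i _ => ?_
  simp [conormalField, sub_mul, Finset.sum_mul, mul_assoc]

lemma norm_gradient_eq (g : 𝔼 → ℝ) (x : 𝔼) : ‖gradient g x‖ = ‖fderiv ℝ g x‖ := by
  rw [gradient, LinearIsometryEquiv.norm_map]

lemma norm_le_sum_abs (v : 𝔼) : ‖v‖ ≤ ∑ i, |v i| := by
  rw [EuclideanSpace.norm_eq]
  refine Real.sqrt_le_iff.2 ⟨Finset.sum_nonneg fun i _ => abs_nonneg _, ?_⟩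
  exact Finset.sum_sq_le_sq_sum_of_nonneg fun i _ => abs_nonneg (v i)

lemma norm_conormalField_le {A : 𝔼 → Matrix (Fin n) (Fin n) ℝ} {B : 𝔼 → 𝔼} {g : 𝔼 → ℝ} {x : 𝔼}
    {M : ℝ} (hA : ∑ i, ∑ j, |A x i j| ≤ M) (hg : 0 ≤ g x) :
    ‖conormalField A B g x‖ ≤ M * ‖fderiv ℝ g x‖ + g x * ‖B x‖ := by
  refine (norm_sub_le _ _).trans ?_
  rw [norm_smul, Real.norm_of_nonneg hg, ← norm_gradient_eq]
  gcongr
  refine (norm_le_sum_abs _).trans ?_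
  calc ∑ i, |∑ j, A x j i * gradient g x j| ≤ ∑ i, ∑ j, |A x j i| * ‖gradient g x‖ := by
        gcongr with i
        refine (Finset.abs_sum_le_sum_abs _ _).trans ?_
        gcongr with j
        rw [abs_mul]
        gcongr
        exact PiLp.norm_apply_le (gradient g x) j
    _ = (∑ i, ∑ j, |A x i j|) * ‖gradient g x‖ := by
        rw [Finset.sum_comm]
        simp_rw [Finset.sum_mul]
    _ ≤ _ := by gcongr

lemma le_fderiv_conormalField {A : 𝔼 → Matrix (Fin n) (Fin n) ℝ} {B : 𝔼 → 𝔼} {g : 𝔼 → ℝ} {x : 𝔼}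
    {lam : ℝ} (hA : ∀ ξ : 𝔼, lam * ‖ξ‖ ^ 2 ≤ ∑ i, ∑ j, A x i j * ξ i * ξ j) (hg : 0 ≤ g x) :
    lam * ‖fderiv ℝ g x‖ ^ 2 - g x * ‖B x‖ * ‖fderiv ℝ g x‖ ≤ fderiv ℝ g x (conormalField A B g x) := by
  rw [fderiv_conormalField, ← norm_gradient_eq, mul_assoc, Finset.sum_comm]
  have h1 := hA (gradient g x)
  have h2 : ∑ i, B x i * gradient g x i ≤ ‖B x‖ * ‖gradient g x‖ := by
    refine le_trans (le_of_eq ?_) (real_inner_le_norm (B x) (gradient g x))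
    rw [PiLp.inner_apply]
    simp [mul_comm]
  have h3 := mul_le_mul_of_nonneg_left h2 hg
  linarith

/-- A field whose distributional divergence is a Dirac mass is measurable near the pole. -/
lemma aestronglyMeasurable_of_integral_fderiv_eq {Ω : Set 𝔼} {F : 𝔼 → 𝔼} {y : 𝔼} {r R : ℝ}
    (hr : 0 < r) (hrR : r < R) (hR : closedBall y R ⊆ Ω)
    (hF : ∀ φ : EuclideanSpace ℝ (Fin n) → ℝ, ContDiff ℝ (⊤ : ℕ∞) φ → HasCompactSupport φ →
      tsupport φ ⊆ Ω → ∫ x in Ω, fderiv ℝ φ x (F x) = φ y) :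
    AEStronglyMeasurable F (volume.restrict (ball y r)) := by
  obtain ⟨C, -, hcut⟩ := exists_cutoff (n := n)
  obtain ⟨η, hη, -, -, hη1, -, hηs, hηc, -⟩ := hcut y r R hr hrR
  have hηy : η y = 1 := hη1 y (mem_closedBall_self hr.le)
  have hηΩ := hηs.trans hR
  have hne : ∀ φ : 𝔼 → ℝ, ContDiff ℝ (⊤ : ℕ∞) φ → HasCompactSupport φ → tsupport φ ⊆ Ω → φ y ≠ 0 →
      IntegrableOn (fun x => fderiv ℝ φ x (F x)) Ω := fun φ h1 h2 h3 h4 => by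
    by_contra hcon
    exact h4 ((hF φ h1 h2 h3).symm.trans (integral_undef hcon))
  have hint : ∀ φ : 𝔼 → ℝ, ContDiff ℝ (⊤ : ℕ∞) φ → HasCompactSupport φ → tsupport φ ⊆ Ω →
      IntegrableOn (fun x => fderiv ℝ φ x (F x)) Ω := fun φ h1 h2 h3 => by
    by_cases h4 : φ y = 0
    · have h5 := hne (fun x => φ x + η x) (h1.add hη) (h2.add hηc)
        ((tsupport_add φ η).trans (union_subset h3 hηΩ)) (by rw [h4, hηy]; norm_num)
      have h6 := hne η hη hηc hηΩ (by rw [hηy]; norm_num)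
      refine (Integrable.sub h5 h6).congr (ae_of_all _ fun x => ?_)
      have e : fderiv ℝ (fun x => φ x + η x) x = fderiv ℝ φ x + fderiv ℝ η x :=
        fderiv_fun_add (h1.differentiable (by simp) x) (hη.differentiable (by simp) x)
      simp [e]
    · exact hne φ h1 h2 h3 h4
  have hcoord : ∀ i, AEMeasurable (fun x => F x i) (volume.restrict (ball y r)) := by
    intro i
    have hl : ContDiff ℝ (⊤ : ℕ∞) (fun x : 𝔼 => EuclideanSpace.proj (𝕜 := ℝ) i x) :=
      (EuclideanSpace.proj (𝕜 := ℝ) i : 𝔼 →L[ℝ] ℝ).contDiff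
    have h1 := hint (fun x => η x * EuclideanSpace.proj (𝕜 := ℝ) i x) (hη.mul hl) hηc.mul_right
      ((tsupport_mul_subset_left (f := η)).trans hηΩ)
    have h2 := h1.mono_set ((ball_subset_closedBall.trans (closedBall_subset_closedBall hrR.le)).trans hR)
    refine h2.aestronglyMeasurable.aemeasurable.congr ?_
    filter_upwards [ae_restrict_mem measurableSet_ball] with x hx
    have h3 : (fun x => η x * EuclideanSpace.proj (𝕜 := ℝ) i x) =ᶠ[𝓝 x]
        (EuclideanSpace.proj (𝕜 := ℝ) i : 𝔼 →L[ℝ] ℝ) := by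
      filter_upwards [isOpen_ball.mem_nhds hx] with z hz
      rw [hη1 z (ball_subset_closedBall hz), one_mul]
    rw [h3.fderiv_eq, ContinuousLinearMap.fderiv]
    simp
  exact ((PiLp.continuous_toLp 2 _).measurable.comp_aemeasurable
    (aemeasurable_pi_lambda (fun x i => F x i) hcoord)).aestronglyMeasurable

/-- The open ball around a point of `Ω` with radius the distance to the boundary lies in `Ω`. -/
lemma ball_bdryDist_subset {Ω : Set 𝔼} (hΩ : IsOpen Ω) {y : 𝔼} (hy : y ∈ Ω) :
    ball y (bdryDist Ω y) ⊆ Ω := by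
  intro z hz
  have hpos : 0 < bdryDist Ω y := dist_nonneg.trans_lt (mem_ball.1 hz)
  have hdisj : Disjoint (ball y (bdryDist Ω y)) (frontier Ω) := disjoint_ball_infDist
  have hconn := (convex_ball y (bdryDist Ω y)).isPreconnected
  refine hconn.subset_of_closure_inter_subset hΩ ⟨y, mem_ball_self hpos, hy⟩ ?_ hz
  rintro w ⟨hw1, hw2⟩
  by_contra hw3
  exact disjoint_left.1 hdisj hw2 ⟨hw1, by rwa [hΩ.interior_eq]⟩

lemma puncturedBall_eq_preimage {y : 𝔼} {r : ℝ} (hr : 0 < r) :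
    puncturedBall n = (fun z => y + r • z) ⁻¹' (ball y (3 * r / 2) \ {y}) := by
  ext z
  simp only [puncturedBall, Set.mem_sdiff, sub_zero, mem_singleton_iff, mem_preimage, mem_ball,
    dist_eq_norm, add_sub_cancel_left, norm_smul, Real.norm_of_nonneg hr.le, add_eq_left, smul_eq_zero,
    hr.ne', false_or]
  refine and_congr_left fun _ => ⟨fun h => by nlinarith, fun h => by nlinarith⟩

end Green

section LowerBound

/-- Up to an arbitrarily small constant, a Green function is a solution near its pole, after rescaling. -/
lemma IsGreenWithPole.isSol {Ω : Set 𝔼} (hΩ : IsOpen Ω) {A : 𝔼 → Matrix (Fin n) (Fin n) ℝ} {B : 𝔼 → 𝔼}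
    {lam M : ℝ} (hM : 0 < M) (hAB : EllipticCoeffs Ω A B lam M) {y : 𝔼} (hy : y ∈ Ω) {g : 𝔼 → ℝ}
    (hg : IsGreenWithPole Ω A B y g) {r ε : ℝ} (hr : 0 < r) (hrδ : r ≤ bdryDist Ω y / 2) (hε : 0 < ε) :
    IsSol lam (2 * M) (puncturedBall n) (fun z => g (y + r • z) + ε)
      (fun z => r • conormalField A B g (y + r • z)) := by
  obtain ⟨h0, -, hd, hL2, -, -, heq⟩ := hg
  have hΩ' := ball_bdryDist_subset hΩ hy
  have hVΩ : ball y (3 * r / 2) ⊆ Ω := (ball_subset_ball (by linarith)).trans hΩ'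
  have hVΩ' : ball y (3 * r / 2) \ {y} ⊆ Ω \ {y} := sdiff_subset_sdiff_left hVΩ
  have hfd : ∀ x, fderiv ℝ (fun x => g x + ε) x = fderiv ℝ g x := fun x => fderiv_add_const ε
  have hB : ∀ x ∈ ball y (3 * r / 2), ‖B x‖ ≤ 2 * M * r⁻¹ := by
    intro x hx
    have h1 := hAB.2.2 x (hVΩ hx)
    have h2 : bdryDist Ω y ≤ bdryDist Ω x + dist y x := infDist_le_infDist_add_dist
    rw [mem_ball'] at hx
    have h3 : r / 2 ≤ bdryDist Ω x := by linarith
    rw [← div_eq_mul_inv, le_div_iff₀ hr]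
    have := mul_le_mul_of_nonneg_right h3 (norm_nonneg (B x))
    linarith
  rw [puncturedBall_eq_preimage (y := y) hr]
  refine isSol_comp_dilation (u := fun x => g x + ε) y hr (isOpen_ball.sdiff isClosed_singleton)
    (fun x hx => add_pos_of_nonneg_of_pos (h0 x (hVΩ hx.1)) hε) (fun x hx => (hd x (hVΩ' hx)).add_const ε)
    ?_ ?_ ?_ ?_ ?_
  · intro K hK hKc
    simp_rw [funext hfd]
    rw [memLp_two_iff_integrable_sq_norm (measurable_fderiv ℝ g).aestronglyMeasurable]
    have h1 := hL2.integrableOn_compact_subset (hK.trans hVΩ') hKc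
    simp only [norm_gradient_eq] at h1
    exact h1
  · have h1 : AEStronglyMeasurable (conormalField A B g) (volume.restrict (ball y (3 * r / 2))) := by
      refine aestronglyMeasurable_of_integral_fderiv_eq (R := 7 * r / 4) (by positivity) (by linarith)
        ((closedBall_subset_ball (by linarith)).trans hΩ') fun φ h1 h2 h3 => ?_
      simpa only [fderiv_conormalField] using heq φ h1 h2 h3
    exact h1.mono_set sdiff_subset
  · intro x hx
    have hgx := h0 x (hVΩ hx.1)
    rw [hfd]
    refine (norm_conormalField_le (hAB.1 x (hVΩ hx.1)) hgx).trans ?_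
    have h1 := mul_le_mul_of_nonneg_left (hB x hx.1) hgx
    have h2 : 0 ≤ M * ‖fderiv ℝ g x‖ := by positivity
    have h3 : 0 ≤ M * r⁻¹ * ε := by positivity
    linarith
  · intro x hx
    have hgx := h0 x (hVΩ hx.1)
    rw [hfd]
    refine le_trans ?_ (le_fderiv_conormalField (hAB.2.1 x (hVΩ hx.1)) hgx)
    have h1 := mul_le_mul_of_nonneg_right (mul_le_mul_of_nonneg_left (hB x hx.1) hgx)
      (norm_nonneg (fderiv ℝ g x))
    have h3 : 0 ≤ M * r⁻¹ * ε * ‖fderiv ℝ g x‖ := by positivity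
    linarith
  · intro φ h1 h2 h3
    have h4 := heq φ h1 h2 (h3.trans (hVΩ'.trans sdiff_subset))
    simp only [← fderiv_conormalField] at h4
    rw [setIntegral_eq_integral_of_forall_compl_eq_zero] at h4
    · rw [h4]
      exact image_eq_zero_of_notMem_tsupport fun h => (h3 h).2 rfl
    · intro x hx
      have : fderiv ℝ φ x = 0 := image_eq_zero_of_notMem_tsupport fun h =>
        hx (hVΩ (h3 (tsupport_fderiv_subset ℝ h)).1)
      simp [this]

lemma IsGreenWithPole.integral_fderiv_dilation {Ω : Set 𝔼} (hΩ : IsOpen Ω)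
    {A : 𝔼 → Matrix (Fin n) (Fin n) ℝ} {B : 𝔼 → 𝔼} {y : 𝔼} (hy : y ∈ Ω) {g : 𝔼 → ℝ}
    (hg : IsGreenWithPole Ω A B y g) {r : ℝ} (hr : 0 < r) (hrδ : r ≤ bdryDist Ω y / 2) {φ : 𝔼 → ℝ}
    (hφ : ContDiff ℝ (⊤ : ℕ∞) φ) (hc : HasCompactSupport φ) (hs : tsupport φ ⊆ ball 0 (3 / 2)) :
    ∫ z, fderiv ℝ φ z (r • conormalField A B g (y + r • z)) = r ^ 2 * (r ^ n)⁻¹ * φ 0 := by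
  obtain ⟨hc', hs'⟩ := tsupport_comp_inv_dilation y hr hc
  have hsΩ : tsupport (fun x => φ (r⁻¹ • (x - y))) ⊆ Ω := by
    refine hs'.trans (image_subset_iff.2 fun z hz => ?_)
    refine ball_bdryDist_subset hΩ hy ?_
    have h1 := mem_ball_zero_iff.1 (hs hz)
    rw [mem_ball, dist_eq_norm, add_sub_cancel_left, norm_smul, Real.norm_of_nonneg hr.le]
    nlinarith
  have h4 := hg.2.2.2.2.2.2 _ (contDiff_comp_inv_dilation y hφ) hc' hsΩ
  simp only [← fderiv_conormalField] at h4
  rw [setIntegral_eq_integral_of_forall_compl_eq_zero] at h4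
  · rw [_root_.integral_fderiv_dilation y hr (hφ.differentiable (by simp)), h4, sub_self, smul_zero]
  · intro x hx
    have : fderiv ℝ (fun x => φ (r⁻¹ • (x - y))) x = 0 := image_eq_zero_of_notMem_tsupport fun h =>
      hx (hsΩ (tsupport_fderiv_subset ℝ h))
    simp [this]

end LowerBound

end Helpers

/-- Pointwise lower bound for the Green function (Theorem 5.1 of the paper). -/
theorem green_pointwise_lower_bound (n : ℕ) (hn : 3 ≤ n) (lam M : ℝ)
    (hlam : 0 < lam) (hM : 0 < M) :
    ∃ K : ℝ, 0 < K ∧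
      ∀ (Ω : Set (EuclideanSpace ℝ (Fin n))), IsOpen Ω → Ω.Nonempty →
      ∀ (A : EuclideanSpace ℝ (Fin n) → Matrix (Fin n) (Fin n) ℝ)
        (B : EuclideanSpace ℝ (Fin n) → EuclideanSpace ℝ (Fin n)),
        EllipticCoeffs Ω A B lam M →
      ∀ y ∈ Ω, ∀ g : EuclideanSpace ℝ (Fin n) → ℝ, IsGreenWithPole Ω A B y g →
      ∀ x ∈ Ω, 0 < dist x y → dist x y ≤ bdryDist Ω y / 2 →
        0 < g x ∧ K * dist x y ^ ((2 : ℝ) - n) ≤ g x := by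
  obtain ⟨C, hC, hflux⟩ := exists_flux_const (n := n) (by omega) hlam (by positivity : 0 ≤ 2 * M)
  suffices h : ∀ (Ω : Set (EuclideanSpace ℝ (Fin n))), IsOpen Ω →
      ∀ (A : EuclideanSpace ℝ (Fin n) → Matrix (Fin n) (Fin n) ℝ)
        (B : EuclideanSpace ℝ (Fin n) → EuclideanSpace ℝ (Fin n)), EllipticCoeffs Ω A B lam M →
      ∀ y ∈ Ω, ∀ g : EuclideanSpace ℝ (Fin n) → ℝ, IsGreenWithPole Ω A B y g →
      ∀ x ∈ Ω, 0 < dist x y → dist x y ≤ bdryDist Ω y / 2 → C⁻¹ * dist x y ^ ((2 : ℝ) - n) ≤ g x by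
    refine ⟨C⁻¹, by positivity, fun Ω hΩ _ A B hAB y hy g hg x hx h1 h2 => ?_⟩
    have h3 := h Ω hΩ A B hAB y hy g hg x hx h1 h2
    exact ⟨lt_of_lt_of_le (mul_pos (inv_pos.2 hC) (Real.rpow_pos_of_pos h1 _)) h3, h3⟩
  intro Ω hΩ A B hAB y hy g hg x hx hr hrδ
  rw [Real.rpow_sub hr, Real.rpow_natCast, Real.rpow_two, div_eq_mul_inv, inv_mul_le_iff₀ hC]
  refine le_of_forall_pos_le_add fun ε hε => ?_
  have h1 := hflux _ _ (hg.isSol hΩ hM hAB hy hr hrδ (div_pos hε hC)) _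
    (fun φ h1 h2 h3 => hg.integral_fderiv_dilation hΩ hy hr hrδ h1 h2 h3) ((dist x y)⁻¹ • (x - y))
    (by rw [norm_smul, norm_inv, Real.norm_of_nonneg hr.le, ← dist_eq_norm, inv_mul_cancel₀ hr.ne'])
  rw [smul_smul, mul_inv_cancel₀ hr.ne', one_smul, add_sub_cancel, mul_add, mul_div_cancel₀ _ hC.ne'] at h1
  exact h1
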